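/- arXiv:1410.8189 — 2 statements merged into one kernel-verified Lean document; each statement's English description precedes it below -/
import Mathlib

section
/- There is an absolute constant C > 0 such that the following holds. Let q and k be integers with 3 ≤ k ≤ (log q)/(400·log log q), let y and z be reals with k·log k ≤ y ≤ z ≤ k^{log log k}, and let 𝒜 be any subset of {n ∈ ℕ : y < n ≤ z and P⁻(n) > y}. Then (1/φ(q))·∑_{χ mod q} S_𝒜(χ)^{2k} ≤ exp(C·k·(log log y)/(log y))·k^k/(e·y·log y)^k + e^{C·k}/(log y)^{50k}. -/
open Real Complex MeasureTheory
open scoped BigOperators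

attribute [local instance] Classical.propDecidable

/-- `e(x) = exp(2πix)` -/
noncomputable def e2pi (x : ℝ) : ℂ := Complex.exp (2 * Real.pi * Complex.I * x)

/-- `∑_{n ≤ x} χ(n)` -/
noncomputable def charSum {q : ℕ} (χ : DirichletCharacter ℂ q) (x : ℝ) : ℂ :=
  ∑ n ∈ Finset.Icc 1 ⌊x⌋₊, χ (n : ZMod q)

/-- `M(χ) = max_{1 ≤ N ≤ q} |∑_{n ≤ N} χ(n)|` -/
noncomputable def Mchi {q : ℕ} (χ : DirichletCharacter ℂ q) : ℝ :=
  ⨆ N ∈ Finset.Icc 1 q, ‖charSum χ (N : ℝ)‖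

/-- `m(χ) = π M(χ)/(e^γ √q)` -/
noncomputable def mchi {q : ℕ} (χ : DirichletCharacter ℂ q) : ℝ :=
  Real.pi * Mchi χ / (Real.exp Real.eulerMascheroniConstant * Real.sqrt q)

/-- the modified Bessel function `I₀` -/
noncomputable def I0 (t : ℝ) : ℝ := ∑' n : ℕ, (t ^ 2 / 4) ^ n / ((n.factorial : ℝ)) ^ 2

/-- the constant `A` -/
noncomputable def Aconst : ℝ :=
  Real.log 2 - 1 - (∫ t in (0:ℝ)..2, Real.log (I0 t) / t ^ 2)
    - ∫ t in Set.Ioi (2:ℝ), (Real.log (I0 t) - t) / t ^ 2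

/-- `Φ_q(τ)` -/
noncomputable def Phi (q : ℕ) (τ : ℝ) : ℝ :=
  (Nat.card {χ : DirichletCharacter ℂ q // χ ≠ 1 ∧ τ < mchi χ} : ℝ) / q.totient

/-- `S_𝒜(χ) = max_{α ∈ [0,1]} |∑_{n ∈ 𝒜} χ(n) e(nα)/n|` -/
noncomputable def SA {q : ℕ} (χ : DirichletCharacter ℂ q) (A : Finset ℕ) : ℝ :=
  ⨆ α : Set.Icc (0:ℝ) 1, ‖∑ n ∈ A, χ (n : ZMod q) * e2pi (n * (α : ℝ)) / n‖

/-- `S_{y,z}(χ)` -/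
noncomputable def Syz {q : ℕ} (χ : DirichletCharacter ℂ q) (y z : ℝ) : ℝ :=
  SA χ ((Finset.Icc 1 ⌊z⌋₊).filter fun n => ∃ p : ℕ, p.Prime ∧ p ∣ n ∧ y < (p : ℝ))

/-- `L(1,χ)` -/
noncomputable def Lone {q : ℕ} (χ : DirichletCharacter ℂ q) : ℂ :=
  ∑' n : ℕ, χ (n : ZMod q) / n

/-- the Gauss sum `G(χ) = ∑_{a=1}^{q} χ(a) e(a/q)` -/
noncomputable def gaussS {q : ℕ} (χ : DirichletCharacter ℂ q) : ℂ :=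
  ∑ a ∈ Finset.Icc 1 q, χ (a : ZMod q) * e2pi ((a : ℝ) / q)

/-- the pretentious distance `𝔻(χ, ξ; y)` -/
noncomputable def Ddist {q D : ℕ} (χ : DirichletCharacter ℂ q) (ξ : DirichletCharacter ℂ D)
    (y : ℝ) : ℝ :=
  Real.sqrt (∑ p ∈ (Finset.Icc 1 ⌊y⌋₊).filter Nat.Prime,
    (1 - (χ (p : ZMod q) * (starRingEnd ℂ) (ξ (p : ZMod D))).re) / p)

/-- Measurability and size make `{u} u^{-(s+1)}` integrable beyond a positive point. -/
lemma integrableOn_fract_mul_cpow {c : ℝ} (hc : 0 < c) {s : ℂ} (hs : 0 < s.re) :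
    IntegrableOn (fun u : ℝ => ((Int.fract u : ℝ) : ℂ) * (u : ℂ) ^ (-(s + 1))) (Set.Ioi c) := by
  have h := integrableOn_Ioi_cpow_of_lt (a := -(s + 1)) (by simp; linarith) hc
  refine Integrable.bdd_mul (c := 1) h ?_ ?_
  · exact (Complex.measurable_ofReal.comp measurable_fract).aestronglyMeasurable
  · refine Filter.Eventually.of_forall fun u => ?_
    rw [Complex.norm_real, Real.norm_eq_abs, abs_of_nonneg (Int.fract_nonneg u)]
    exact (Int.fract_lt_one u).le

lemma sum_Icc_ite_lt (N M : ℕ) :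
    ∑ k ∈ Finset.Icc 1 M, (if N < k then (1 : ℂ) else 0) = ((M - N : ℕ) : ℂ) := by
  rw [Finset.sum_ite, Finset.sum_const_zero, add_zero, Finset.sum_const, nsmul_eq_mul, mul_one]
  congr 1
  have : (Finset.Icc 1 M).filter (fun k => N < k) = Finset.Ioc N M := by
    ext k; simp only [Finset.mem_filter, Finset.mem_Icc, Finset.mem_Ioc]; omega
  rw [this, Nat.card_Ioc]

lemma LSeries_ite_lt (N : ℕ) (hN : 1 ≤ N) {s : ℂ} (hs : 1 < s.re) :
    LSeries (fun n => if N < n then (1 : ℂ) else 0) s =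
      (N : ℂ) ^ (1 - s) / (s - 1) -
        s * ∫ u in Set.Ioi (N : ℝ), ((Int.fract u : ℝ) : ℂ) * (u : ℂ) ^ (-(s + 1)) := by
  have hN0 : (0 : ℝ) < N := by exact_mod_cast hN
  have hs0 : s ≠ 0 := by rintro rfl; simp at hs; linarith
  have hs1 : s - 1 ≠ 0 := by
    intro h; rw [sub_eq_zero] at h; rw [h] at hs; simp at hs
  rw [LSeries_eq_mul_integral' _ zero_le_one hs]
  · have h1 : ∫ t in Set.Ioi (1 : ℝ), (∑ k ∈ Finset.Icc 1 ⌊t⌋₊, if N < k then (1 : ℂ) else 0) *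
        (t : ℂ) ^ (-(s + 1)) = ∫ t in Set.Ioi (N : ℝ), ((t : ℂ) ^ (-s) -
          N * (t : ℂ) ^ (-(s + 1)) - ((Int.fract t : ℝ) : ℂ) * (t : ℂ) ^ (-(s + 1))) := by
      rw [setIntegral_eq_of_subset_of_forall_sdiff_eq_zero (s := Set.Ioi (N : ℝ))
        (t := Set.Ioi (1 : ℝ)) measurableSet_Ioi (Set.Ioi_subset_Ioi (by exact_mod_cast hN))]
      · refine setIntegral_congr_fun measurableSet_Ioi fun t ht => ?_
        have ht' : (N : ℝ) < t := ht
        have ht0 : 0 < t := hN0.trans ht'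
        have hfl : N ≤ ⌊t⌋₊ := Nat.le_floor ht'.le
        rw [sum_Icc_ite_lt, Nat.cast_sub hfl]
        have h2 : ((⌊t⌋₊ : ℕ) : ℂ) = (t : ℂ) - ((Int.fract t : ℝ) : ℂ) := by
          rw [← Complex.ofReal_natCast, ← Complex.ofReal_sub, natCast_floor_eq_intCast_floor ht0.le]
          rw [Int.self_sub_fract]
        have h3 : (t : ℂ) ^ (-s) = t * (t : ℂ) ^ (-(s + 1)) := by
          rw [show -s = 1 + -(s + 1) by ring, Complex.cpow_add _ _ (by exact_mod_cast ht0.ne'),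
            Complex.cpow_one]
        rw [h2, h3]; ring
      · intro t ht
        have ht' : t ≤ N := not_lt.mp ht.2
        rw [sum_Icc_ite_lt, Nat.sub_eq_zero_of_le]
        · simp
        · exact Nat.floor_le_of_le ht'
    rw [h1]
    have i1 := integrableOn_Ioi_cpow_of_lt (a := -s) (by simp; linarith) hN0
    have i2 := integrableOn_Ioi_cpow_of_lt (a := -(s + 1)) (by simp; linarith) hN0
    have i3 := integrableOn_fract_mul_cpow hN0 (s := s) (by linarith)
    have i4 : IntegrableOn (fun t : ℝ => (t : ℂ) ^ (-s) - N * (t : ℂ) ^ (-(s + 1)))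
        (Set.Ioi (N : ℝ)) := i1.sub (i2.const_mul _)
    rw [integral_sub i4 i3, integral_sub i1 (i2.const_mul _),
      integral_const_mul, integral_Ioi_cpow_of_lt (by simp; linarith) hN0,
      integral_Ioi_cpow_of_lt (by simp; linarith) hN0]
    have hNc : (N : ℂ) ≠ 0 := by exact_mod_cast hN0.ne'
    have h4 : ((N : ℝ) : ℂ) ^ (-s + 1) = N ^ (1 - s) := by
      rw [Complex.ofReal_natCast]; congr 1; ring
    have h5 : (N : ℂ) * ((N : ℝ) : ℂ) ^ (-(s + 1) + 1) = N ^ (1 - s) := by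
      rw [Complex.ofReal_natCast, show (1 : ℂ) - s = 1 + (-(s + 1) + 1) by ring,
        Complex.cpow_add 1 (-(s + 1) + 1) hNc, Complex.cpow_one]
    have h6 : -s + 1 ≠ 0 := fun h => hs1 (by linear_combination -h)
    have h7 : -(s + 1) + 1 ≠ 0 := fun h => hs0 (by linear_combination -h)
    rw [mul_sub, h4]
    congr 1
    rw [neg_div, neg_div, mul_neg, sub_neg_eq_add, ← mul_div_assoc, h5]
    field_simp
    ring
  · refine Asymptotics.IsBigO.of_bound 1 (Filter.Eventually.of_forall fun n => ?_)
    rw [one_mul, Real.rpow_one, Real.norm_of_nonneg (by positivity),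
      Real.norm_of_nonneg (by positivity)]
    calc _ ≤ ∑ k ∈ Finset.Icc 1 n, (1 : ℝ) := by
          refine Finset.sum_le_sum fun k _ => ?_
          split_ifs <;> simp
      _ = n := by simp

/-- Truncated Euler–Maclaurin formula for `ζ` in the half-plane of absolute convergence. -/
lemma riemannZeta_eq_sum_add (N : ℕ) (hN : 1 ≤ N) {s : ℂ} (hs : 1 < s.re) :
    riemannZeta s = ∑ n ∈ Finset.Icc 1 N, (n : ℂ) ^ (-s) + (N : ℂ) ^ (1 - s) / (s - 1) -
        s * ∫ u in Set.Ioi (N : ℝ), ((Int.fract u : ℝ) : ℂ) * (u : ℂ) ^ (-(s + 1)) := by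
  have hs0 : s ≠ 0 := by rintro rfl; simp at hs; linarith
  rw [add_sub_assoc, ← LSeries_ite_lt N hN hs, zeta_eq_tsum_one_div_nat_cpow hs, LSeries]
  have hsum : Summable fun n : ℕ => 1 / (n : ℂ) ^ s := Complex.summable_one_div_nat_cpow.mpr hs
  have e1 : ∑ n ∈ Finset.Icc 1 N, (n : ℂ) ^ (-s) =
      ∑' n : ℕ, if n ∈ Finset.Icc 1 N then 1 / (n : ℂ) ^ s else 0 := by
    rw [tsum_eq_sum (s := Finset.Icc 1 N) (fun n hn => if_neg hn)]
    refine Finset.sum_congr rfl fun n hn => ?_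
    rw [if_pos hn, Complex.cpow_neg, one_div]
  rw [e1, ← Summable.tsum_add]
  · refine tsum_congr fun n => ?_
    rcases Nat.eq_zero_or_pos n with rfl | hn
    · simp [hs0]
    · rw [LSeries.term_of_ne_zero hn.ne']
      by_cases h : N < n
      · simp [h]
      · simp [h, not_lt.mp h, Nat.succ_le_of_lt hn]
  · exact summable_of_ne_finset_zero (s := Finset.Icc 1 N) (fun n hn => if_neg hn)
  · refine LSeriesSummable_of_bounded_of_one_lt_re (m := 1) (fun n _ => ?_) hs
    split_ifs <;> simp

lemma differentiableAt_integral_fract_mul_cpow {c : ℝ} (hc : 0 < c) {s : ℂ} (hs : 0 < s.re) :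
    DifferentiableAt ℂ (fun s : ℂ =>
      ∫ u in Set.Ioi c, ((Int.fract u : ℝ) : ℂ) * (u : ℂ) ^ (-(s + 1))) s := by
  set f : ℝ → ℂ := Set.indicator (Set.Ioi c) (fun u => ((Int.fract u : ℝ) : ℂ)) with hf
  have hfm : Measurable f :=
    (Complex.measurable_ofReal.comp measurable_fract).indicator measurableSet_Ioi
  have hf1 : ∀ u, ‖f u‖ ≤ 1 := fun u => by
    rw [hf, Set.indicator_apply]
    split_ifs
    · rw [Complex.norm_real, Real.norm_eq_abs, abs_of_nonneg (Int.fract_nonneg u)]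
      exact (Int.fract_lt_one u).le
    · simp
  have hEq : (fun s : ℂ => ∫ u in Set.Ioi c, ((Int.fract u : ℝ) : ℂ) * (u : ℂ) ^ (-(s + 1))) =
      fun s => mellin f (-s) := by
    funext s
    rw [mellin]
    have : ∀ u : ℝ, (u : ℂ) ^ (-s - 1) • f u = Set.indicator (Set.Ioi c)
        (fun u : ℝ => ((Int.fract u : ℝ) : ℂ) * (u : ℂ) ^ (-(s + 1))) u := fun u => by
      rw [hf, Set.indicator_apply, Set.indicator_apply]
      split_ifs
      · rw [smul_eq_mul, mul_comm]; congr 2; ring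
      · simp
    simp_rw [this]
    rw [setIntegral_indicator measurableSet_Ioi,
      Set.inter_eq_self_of_subset_right (Set.Ioi_subset_Ioi hc.le)]
  rw [hEq]
  have hd : DifferentiableAt ℂ (mellin f) (-s) := by
    refine mellin_differentiableAt_of_isBigO_rpow (a := 0) (b := -s.re - 1) ?_ ?_ (by simpa) ?_
      (by simp)
    · refine (LocallyIntegrable.mono (f := fun _ : ℝ => (1 : ℂ))
        (continuous_const.locallyIntegrable) hfm.aestronglyMeasurable ?_).locallyIntegrableOn _
      exact Filter.Eventually.of_forall fun u => by simpa using hf1 u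
    · refine Asymptotics.IsBigO.of_bound 1 (Filter.Eventually.of_forall fun u => ?_)
      simpa using hf1 u
    · refine Asymptotics.IsBigO.of_bound 1 ?_
      filter_upwards [nhdsWithin_le_nhds (Iio_mem_nhds hc)] with u hu
      have : f u = 0 := by
        rw [hf, Set.indicator_of_notMem]
        exact fun h => lt_asymm (Set.mem_Ioi.mp h) (Set.mem_Iio.mp hu)
      rw [this]; simp
  exact hd.comp s differentiableAt_id.neg

lemma norm_integral_fract_mul_cpow_le {c : ℝ} (hc : 0 < c) {s : ℂ} (hs : 0 < s.re) :
    ‖∫ u in Set.Ioi c, ((Int.fract u : ℝ) : ℂ) * (u : ℂ) ^ (-(s + 1))‖ ≤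
      c ^ (-s.re) / s.re := by
  have h := integral_Ioi_rpow_of_lt (a := -(s.re + 1)) (by linarith) hc
  have h2 : -c ^ (-(s.re + 1) + 1) / (-(s.re + 1) + 1) = c ^ (-s.re) / s.re := by
    rw [show -(s.re + 1) + 1 = -s.re by ring, neg_div_neg_eq]
  rw [← h2, ← h]
  refine norm_integral_le_of_norm_le (integrableOn_Ioi_rpow_of_lt (by linarith) hc) ?_
  filter_upwards [ae_restrict_mem measurableSet_Ioi] with u hu
  have hu0 : 0 < u := hc.trans hu
  rw [norm_mul, Complex.norm_real, Real.norm_eq_abs, abs_of_nonneg (Int.fract_nonneg u),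
    Complex.norm_cpow_eq_rpow_re_of_pos hu0]
  have : (-(s + 1)).re = -(s.re + 1) := by simp
  rw [this]
  exact mul_le_of_le_one_left (by positivity) (Int.fract_lt_one u).le

/-- The truncated Euler–Maclaurin formula, continued to the first quadrant. -/
lemma riemannZeta_eq_sum_add_of_im_pos (N : ℕ) (hN : 1 ≤ N) {s : ℂ} (hs : 0 < s.re)
    (ht : 0 < s.im) :
    riemannZeta s = ∑ n ∈ Finset.Icc 1 N, (n : ℂ) ^ (-s) + (N : ℂ) ^ (1 - s) / (s - 1) -
        s * ∫ u in Set.Ioi (N : ℝ), ((Int.fract u : ℝ) : ℂ) * (u : ℂ) ^ (-(s + 1)) := by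
  have hN0 : (0 : ℝ) < N := by exact_mod_cast hN
  set D : Set ℂ := {s | 0 < s.re} ∩ {s | 0 < s.im} with hD
  have hDo : IsOpen D := (isOpen_lt continuous_const Complex.continuous_re).inter
    (isOpen_lt continuous_const Complex.continuous_im)
  have hDc : IsPreconnected D :=
    ((convex_halfSpace_re_gt 0).inter (convex_halfSpace_im_gt 0)).isPreconnected
  have hne : ∀ s ∈ D, s ≠ 1 := fun s hs h => by have := hs.2; simp [h] at this
  have h1 : AnalyticOnNhd ℂ riemannZeta D := DifferentiableOn.analyticOnNhd
    (fun s hs => (differentiableAt_riemannZeta (hne s hs)).differentiableWithinAt) hDo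
  have h2 : AnalyticOnNhd ℂ (fun s : ℂ =>
      ∑ n ∈ Finset.Icc 1 N, (n : ℂ) ^ (-s) + (N : ℂ) ^ (1 - s) / (s - 1) -
        s * ∫ u in Set.Ioi (N : ℝ), ((Int.fract u : ℝ) : ℂ) * (u : ℂ) ^ (-(s + 1))) D := by
    refine DifferentiableOn.analyticOnNhd (fun s hs => ?_) hDo
    have hsne : s - 1 ≠ 0 := sub_ne_zero.mpr (hne s hs)
    refine DifferentiableAt.differentiableWithinAt ?_
    refine DifferentiableAt.sub (DifferentiableAt.add ?_ ?_) ?_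
    · refine DifferentiableAt.fun_sum fun n hn => ?_
      refine DifferentiableAt.const_cpow differentiableAt_id.neg (Or.inl ?_)
      have := (Finset.mem_Icc.mp hn).1
      exact_mod_cast (by omega : n ≠ 0)
    · refine DifferentiableAt.div ?_ (by fun_prop) hsne
      refine DifferentiableAt.const_cpow (by fun_prop) (Or.inl ?_)
      exact_mod_cast hN0.ne'
    · exact differentiableAt_id.mul (differentiableAt_integral_fract_mul_cpow hN0 hs.1)
  have hmem : (2 + Complex.I) ∈ D := by simp [hD]
  refine h1.eqOn_of_preconnected_of_eventuallyEq h2 hDc hmem ?_ ⟨hs, ht⟩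
  filter_upwards [(isOpen_lt continuous_const Complex.continuous_re).mem_nhds
    (show (1 : ℝ) < (2 + Complex.I).re by simp)] with s hs
  exact riemannZeta_eq_sum_add N hN hs

lemma norm_riemannZeta_le_of_im_pos {s : ℂ} {t : ℝ} (ht : 2 ≤ t) (hσ : 1 - 1 / 100 ≤ s.re)
    (hσ' : s.re ≤ 4) (h1 : t - 1 / 100 ≤ s.im) (h2 : s.im ≤ t + 1 / 100) :
    ‖riemannZeta s‖ ≤ 250 * t ^ (1 / 50 : ℝ) := by
  set N := ⌈t⌉₊ with hNdef
  have hNt : t ≤ N := Nat.le_ceil t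
  have hN2 : (N : ℝ) ≤ 2 * t := by
    have := Nat.ceil_lt_add_one (by linarith : 0 ≤ t); linarith
  have hN0 : (0 : ℝ) < N := by linarith
  have hN1r : (1 : ℝ) ≤ N := by linarith
  have hN1 : 1 ≤ N := by exact_mod_cast hN1r
  have hσ0 : 0 < s.re := by linarith
  rw [riemannZeta_eq_sum_add_of_im_pos N hN1 hσ0 (by linarith)]
  set E : ℝ := (N : ℝ) ^ (1 / 100 : ℝ) with hE
  have hE1 : 1 ≤ E := Real.one_le_rpow hN1r (by norm_num)
  have hlog : Real.log N ≤ 100 * E := by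
    have := Real.log_le_rpow_div hN0.le (by norm_num : (0 : ℝ) < 1 / 100)
    rw [div_div_eq_mul_div, div_one, mul_comm] at this
    exact this
  have hA : ‖∑ n ∈ Finset.Icc 1 N, (n : ℂ) ^ (-s)‖ ≤ E * (1 + Real.log N) := by
    calc _ ≤ ∑ n ∈ Finset.Icc 1 N, E * (n : ℝ)⁻¹ := by
          refine (norm_sum_le _ _).trans (Finset.sum_le_sum fun n hn => ?_)
          obtain ⟨hn1, hn2⟩ := Finset.mem_Icc.mp hn
          have hn0 : (0 : ℝ) < n := by exact_mod_cast hn1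
          have hn1' : (1 : ℝ) ≤ n := by exact_mod_cast hn1
          rw [Complex.norm_natCast_cpow_of_pos (by omega)]
          calc (n : ℝ) ^ (-s).re ≤ (n : ℝ) ^ (1 / 100 + (-1) : ℝ) :=
                Real.rpow_le_rpow_of_exponent_le hn1' (by simp; linarith)
            _ = (n : ℝ) ^ (1 / 100 : ℝ) * (n : ℝ)⁻¹ := by
                rw [Real.rpow_add hn0, Real.rpow_neg_one]
            _ ≤ _ := by
                gcongr
                exact Real.rpow_le_rpow hn0.le (by exact_mod_cast hn2) (by norm_num)
      _ = E * ∑ n ∈ Finset.Icc 1 N, (n : ℝ)⁻¹ := by rw [Finset.mul_sum]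
      _ ≤ _ := by
          gcongr
          have := harmonic_le_one_add_log N
          rw [harmonic_eq_sum_Icc] at this
          push_cast at this
          exact this
  have hB : ‖(N : ℂ) ^ (1 - s) / (s - 1)‖ ≤ E := by
    rw [norm_div, Complex.norm_natCast_cpow_of_pos (by omega)]
    have h3 : 1 ≤ ‖s - 1‖ := by
      have := Complex.abs_im_le_norm (s - 1)
      simp only [Complex.sub_im, Complex.one_im, sub_zero] at this
      have h4 := le_abs_self s.im
      linarith
    refine (div_le_self (by positivity) h3).trans ?_
    exact Real.rpow_le_rpow_of_exponent_le hN1r (by simp; linarith)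
  have hC : ‖s * ∫ u in Set.Ioi (N : ℝ), ((Int.fract u : ℝ) : ℂ) * (u : ℂ) ^ (-(s + 1))‖ ≤
      4 * E := by
    rw [norm_mul]
    have h3 : ‖s‖ ≤ 3.2 * N := by
      have := Complex.norm_le_abs_re_add_abs_im s
      rw [abs_of_pos hσ0, abs_of_pos (by linarith)] at this
      linarith
    have h4 := norm_integral_fract_mul_cpow_le hN0 hσ0
    have h5 : (N : ℝ) ^ (-s.re) / s.re ≤ (E * (N : ℝ)⁻¹) * (100 / 99) := by
      rw [div_eq_mul_inv]
      gcongr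
      · calc (N : ℝ) ^ (-s.re) ≤ (N : ℝ) ^ (1 / 100 + (-1) : ℝ) :=
              Real.rpow_le_rpow_of_exponent_le hN1r (by linarith)
          _ = _ := by rw [Real.rpow_add hN0, Real.rpow_neg_one]
      · rw [inv_le_comm₀ hσ0 (by norm_num)]; norm_num; linarith
    calc _ ≤ (3.2 * N) * ((E * (N : ℝ)⁻¹) * (100 / 99)) := by
          gcongr; exact h4.trans h5
      _ = 3.2 * (100 / 99) * E * (N * (N : ℝ)⁻¹) := by ring
      _ ≤ 4 * E := by
          rw [mul_inv_cancel₀ hN0.ne']; nlinarith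
  have hEE : E * E ≤ 2 * t ^ (1 / 50 : ℝ) := by
    rw [hE, ← Real.rpow_add hN0]
    norm_num
    calc (N : ℝ) ^ (1 / 50 : ℝ) ≤ (2 * t) ^ (1 / 50 : ℝ) :=
          Real.rpow_le_rpow hN0.le hN2 (by norm_num)
      _ = 2 ^ (1 / 50 : ℝ) * t ^ (1 / 50 : ℝ) := Real.mul_rpow (by norm_num) (by linarith)
      _ ≤ 2 * t ^ (1 / 50 : ℝ) := by
          gcongr
          calc (2 : ℝ) ^ (1 / 50 : ℝ) ≤ 2 ^ (1 : ℝ) :=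
                Real.rpow_le_rpow_of_exponent_le (by norm_num) (by norm_num)
            _ = 2 := Real.rpow_one 2
  calc _ ≤ E * (1 + Real.log N) + E + 4 * E :=
        (norm_sub_le _ _).trans (add_le_add ((norm_add_le _ _).trans (add_le_add hA hB)) hC)
    _ ≤ 106 * (E * E) := by nlinarith
    _ ≤ _ := by
        have : 0 ≤ t ^ (1 / 50 : ℝ) := by positivity
        linarith

lemma norm_riemannZeta_le_of_mem_closedBall {s₀ s : ℂ} (h1 : 1 ≤ s₀.re) (h3 : s₀.re ≤ 3)
    (ht : 2 ≤ |s₀.im|) (hs : s ∈ Metric.closedBall s₀ (1 / 100)) :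
    ‖riemannZeta s‖ ≤ 250 * |s₀.im| ^ (1 / 50 : ℝ) := by
  rw [Metric.mem_closedBall, dist_eq_norm] at hs
  have hre := (Complex.abs_re_le_norm (s - s₀)).trans hs
  have him := (Complex.abs_im_le_norm (s - s₀)).trans hs
  rw [Complex.sub_re, abs_le] at hre
  rw [Complex.sub_im, abs_le] at him
  rcases le_abs.mp ht with h | h
  · rw [abs_of_nonneg (by linarith)]
    exact norm_riemannZeta_le_of_im_pos h (by linarith) (by linarith) (by linarith) (by linarith)
  · rw [abs_of_nonpos (by linarith), ← Complex.norm_conj, ← riemannZeta_conj]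
    exact norm_riemannZeta_le_of_im_pos h (by simp; linarith) (by simp; linarith)
      (by simp; linarith) (by simp; linarith)

lemma ne_one_of_mem_closedBall {s₀ s : ℂ} (ht : 2 ≤ |s₀.im|)
    (hs : s ∈ Metric.closedBall s₀ (1 / 100)) : s ≠ 1 := by
  rintro rfl
  rw [Metric.mem_closedBall, dist_eq_norm] at hs
  have him := (Complex.abs_im_le_norm (1 - s₀)).trans hs
  rw [Complex.sub_im, Complex.one_im, zero_sub, abs_neg] at him
  linarith

lemma norm_deriv_riemannZeta_le_of_mem_closedBall {s₀ s : ℂ} (h1 : 1 ≤ s₀.re) (h3 : s₀.re ≤ 3)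
    (ht : 2 ≤ |s₀.im|) (hs : s ∈ Metric.closedBall s₀ (1 / 200)) :
    ‖deriv riemannZeta s‖ ≤ 50000 * |s₀.im| ^ (1 / 50 : ℝ) := by
  have hsub : Metric.closedBall s (1 / 200) ⊆ Metric.closedBall s₀ (1 / 100) := by
    refine Metric.closedBall_subset_closedBall' ?_
    rw [Metric.mem_closedBall] at hs
    linarith
  have h := Complex.norm_deriv_le_of_forall_mem_sphere_norm_le (f := riemannZeta) (c := s)
    (R := 1 / 200) (C := 250 * |s₀.im| ^ (1 / 50 : ℝ)) (by norm_num) ?_ ?_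
  · refine h.trans (le_of_eq ?_); ring
  · refine DifferentiableOn.diffContOnCl_ball (U := Metric.closedBall s₀ (1 / 100)) ?_ hsub
    exact fun w hw =>
      (differentiableAt_riemannZeta (ne_one_of_mem_closedBall ht hw)).differentiableWithinAt
  · exact fun w hw => norm_riemannZeta_le_of_mem_closedBall h1 h3 ht
      (hsub (Metric.sphere_subset_closedBall hw))

lemma exists_norm_riemannZeta_one_add_le :
    ∃ C : ℝ, 1 ≤ C ∧ ∀ η : ℝ, 0 < η → η ≤ 1 → ‖riemannZeta (1 + η)‖ ≤ C / η := by
  have hc : Continuous fun η : ℝ => riemannZeta₁ (1 + η) :=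
    differentiable_riemannZeta₁.continuous.comp (by fun_prop)
  obtain ⟨C, hC⟩ := (isCompact_Icc (a := (0 : ℝ)) (b := 1)).exists_bound_of_continuousOn
    hc.continuousOn
  refine ⟨max C 1, le_max_right _ _, fun η h0 h1 => ?_⟩
  have hne : (1 + η : ℂ) ≠ 1 := by
    intro h; rw [add_eq_left] at h; exact h0.ne' (by exact_mod_cast h)
  rw [riemannZeta_eq_inv_sub_mul hne, norm_mul, add_sub_cancel_left, norm_inv, Complex.norm_real,
    Real.norm_of_nonneg h0.le, div_eq_inv_mul]
  gcongr
  exact (hC η ⟨h0.le, h1⟩).trans (le_max_left _ _)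

lemma one_le_norm_riemannZeta_product {η : ℝ} (hη : 0 < η) (t : ℝ) :
    1 ≤ ‖riemannZeta (1 + η)‖ ^ 3 * ‖riemannZeta (1 + η + Complex.I * t)‖ ^ 4 *
      ‖riemannZeta (1 + η + 2 * Complex.I * t)‖ := by
  have h := DirichletCharacter.norm_LFunction_product_ge_one (1 : DirichletCharacter ℂ 1) hη t
  simp only [DirichletCharacter.LFunctionTrivChar, one_pow,
    DirichletCharacter.LFunction_modOne_eq, norm_mul, norm_pow] at h
  exact h

/-- A polynomial lower bound for `ζ` to the right of the line `Re s = 1`. -/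
lemma exists_le_norm_riemannZeta :
    ∃ a : ℝ, 0 < a ∧ a ≤ 1 ∧ ∀ s : ℂ, 1 < s.re → s.re ≤ 2 → 2 ≤ |s.im| →
      a * (|s.im| ^ (1 / 50 : ℝ))⁻¹ ^ 4 ≤ ‖riemannZeta s‖ := by
  obtain ⟨C, hC1, hC⟩ := exists_norm_riemannZeta_one_add_le
  set M : ℝ := 50000 with hM
  set K : ℝ := C ^ 3 * (2 * M) with hK
  have hK0 : 0 < K := by positivity
  set c : ℝ := 1 / (16 * K * M ^ 4) with hc
  have hc0 : 0 < c := by positivity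
  have hK1 : 1 ≤ K := by
    have : 1 ≤ C ^ 3 := one_le_pow₀ hC1
    rw [hK, hM]; nlinarith
  have hcM : c * M ≤ 1 := by
    rw [hc, div_mul_eq_mul_div, one_mul, div_le_one (by positivity)]
    have : M ≤ M ^ 4 := by rw [hM]; norm_num
    nlinarith [mul_le_mul_of_nonneg_right hK1 (by positivity : (0 : ℝ) ≤ M ^ 4)]
  have hc200 : c ≤ 1 / 200 := by
    have : c * 200 ≤ c * M := by gcongr; rw [hM]; norm_num
    linarith
  refine ⟨c * M, by positivity, hcM, fun s hs1 hs2 ht => ?_⟩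
  set U : ℝ := |s.im| ^ (1 / 50 : ℝ) with hU
  have hU1 : 1 ≤ U := Real.one_le_rpow (by linarith) (by norm_num)
  have hU0 : 0 < U := by linarith
  -- the bound when the real part is not too close to `1`
  have key : ∀ η : ℝ, c * U⁻¹ ^ 5 ≤ η → η ≤ 1 →
      2 * (c * M * U⁻¹ ^ 4) ≤ ‖riemannZeta (1 + η + Complex.I * s.im)‖ := by
    intro η h1 h2
    have hη0 : 0 < η := lt_of_lt_of_le (by positivity) h1
    have hp := one_le_norm_riemannZeta_product hη0 s.im
    have hz2 : ‖riemannZeta (1 + η + 2 * Complex.I * s.im)‖ ≤ 2 * M * U := by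
      have h := norm_riemannZeta_le_of_mem_closedBall
        (s₀ := 1 + η + 2 * Complex.I * s.im) (s := 1 + η + 2 * Complex.I * s.im)
        (by simp; linarith) (by simp; linarith) (by simp [abs_mul]; linarith)
        (Metric.mem_closedBall_self (by norm_num))
      have him : (1 + η + 2 * Complex.I * s.im : ℂ).im = 2 * s.im := by simp
      rw [him, abs_mul, abs_two, Real.mul_rpow (by norm_num) (abs_nonneg _)] at h
      refine h.trans ?_
      have : (2 : ℝ) ^ (1 / 50 : ℝ) ≤ 2 := by
        calc (2 : ℝ) ^ (1 / 50 : ℝ) ≤ 2 ^ (1 : ℝ) :=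
              Real.rpow_le_rpow_of_exponent_le (by norm_num) (by norm_num)
          _ = 2 := Real.rpow_one 2
      calc 250 * ((2 : ℝ) ^ (1 / 50 : ℝ) * U) ≤ 250 * (2 * U) := by gcongr
        _ ≤ 2 * M * U := by rw [hM]; nlinarith
    have hz1 := hC η hη0 h2
    set Z := ‖riemannZeta (1 + η + Complex.I * s.im)‖ with hZ
    have h5 : 1 ≤ (C / η) ^ 3 * Z ^ 4 * (2 * M * U) := hp.trans (by gcongr)
    have h6 : η ^ 3 * U⁻¹ ≤ K * Z ^ 4 := by
      calc η ^ 3 * U⁻¹ = η ^ 3 * U⁻¹ * 1 := by ring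
        _ ≤ η ^ 3 * U⁻¹ * ((C / η) ^ 3 * Z ^ 4 * (2 * M * U)) := by gcongr
        _ = K * Z ^ 4 := by rw [hK]; field_simp
    have h7 : (2 * (c * M * U⁻¹ ^ 4)) ^ 4 ≤ Z ^ 4 := by
      have h8 : (c * U⁻¹ ^ 5) ^ 3 * U⁻¹ ≤ K * Z ^ 4 := le_trans (by gcongr) h6
      have h9 : K * (2 * (c * M * U⁻¹ ^ 4)) ^ 4 = (c * U⁻¹ ^ 5) ^ 3 * U⁻¹ := by
        have : 16 * K * M ^ 4 * c = 1 := by rw [hc]; field_simp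
        calc _ = (16 * K * M ^ 4 * c) * (c ^ 3 * U⁻¹ ^ 16) := by ring
          _ = _ := by rw [this]; ring
      rw [← h9] at h8
      exact le_of_mul_le_mul_left h8 hK0
    exact le_of_pow_le_pow_left₀ (by norm_num) (norm_nonneg _) h7
  have hsform : s = 1 + ((s.re - 1 : ℝ) : ℂ) + Complex.I * s.im := by
    apply Complex.ext <;> simp
  have hpos : 0 ≤ c * M * U⁻¹ ^ 4 := by positivity
  by_cases hcase : c * U⁻¹ ^ 5 ≤ s.re - 1
  · have := key (s.re - 1) hcase (by linarith)
    rw [← hsform] at this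
    linarith
  · push Not at hcase
    set η := c * U⁻¹ ^ 5 with hη
    have hη1 : η ≤ 1 / 200 := by
      calc η ≤ c * 1 := by
            rw [hη]; gcongr; exact pow_le_one₀ (by positivity) (inv_le_one_of_one_le₀ hU1)
        _ ≤ _ := by linarith
    have h1 := key η le_rfl (by linarith)
    have hη0 : 0 < η := by positivity
    set s' : ℂ := 1 + η + Complex.I * s.im with hs'
    have hdist : ‖s' - s‖ ≤ η := by
      have : s' - s = ((η - (s.re - 1) : ℝ) : ℂ) := by
        conv_lhs => rw [hsform]
        rw [hs']; push_cast; ring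
      rw [this, Complex.norm_real, Real.norm_of_nonneg (by linarith)]
      linarith
    have h2 : ‖riemannZeta s' - riemannZeta s‖ ≤ M * U * ‖s' - s‖ := by
      refine Convex.norm_image_sub_le_of_norm_deriv_le (s := Metric.closedBall s (1 / 200))
        (fun w hw => differentiableAt_riemannZeta (ne_one_of_mem_closedBall ht
          (Metric.closedBall_subset_closedBall (by norm_num) hw)))
        (fun w hw => norm_deriv_riemannZeta_le_of_mem_closedBall hs1.le (by linarith) ht hw)
        (convex_closedBall _ _) (Metric.mem_closedBall_self (by norm_num)) ?_
      rw [Metric.mem_closedBall, dist_eq_norm]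
      linarith
    have h3 : M * U * ‖s' - s‖ ≤ c * M * U⁻¹ ^ 4 := by
      calc _ ≤ M * U * η := by gcongr
        _ = c * M * U⁻¹ ^ 4 * (U * U⁻¹) := by rw [hη]; ring
        _ = _ := by rw [mul_inv_cancel₀ hU0.ne', mul_one]
    have h4 := norm_sub_norm_le (riemannZeta s') (riemannZeta s)
    linarith

/-- Minus the sum of `ζ` and its logarithmic derivative, holomorphic near the closed
half-plane `1 ≤ Re s`. -/
noncomputable def negLogDerivSubZeta (s : ℂ) : ℂ :=
  -deriv riemannZeta₁ s / riemannZeta₁ s - riemannZeta₀ s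

lemma riemannZeta₁_eq_mul {s : ℂ} (hs : s ≠ 1) : riemannZeta₁ s = (s - 1) * riemannZeta s := by
  rw [riemannZeta_eq_inv_sub_mul hs, mul_inv_cancel_left₀ (sub_ne_zero.mpr hs)]

lemma negLogDerivSubZeta_eq {s : ℂ} (hs : s ≠ 1) (hz : riemannZeta s ≠ 0) :
    negLogDerivSubZeta s = -deriv riemannZeta s / riemannZeta s - riemannZeta s := by
  have hs1 : s - 1 ≠ 0 := sub_ne_zero.mpr hs
  have hev : riemannZeta₁ =ᶠ[nhds s] fun w => (w - 1) * riemannZeta w := by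
    filter_upwards [isOpen_ne.mem_nhds hs] with w hw
    exact riemannZeta₁_eq_mul hw
  have hd : deriv riemannZeta₁ s = riemannZeta s + (s - 1) * deriv riemannZeta s := by
    rw [hev.deriv_eq, deriv_fun_mul (by fun_prop) (differentiableAt_riemannZeta hs)]
    simp
  have h0 : riemannZeta₀ s = riemannZeta s - (s - 1)⁻¹ := by
    rw [riemannZeta_eq_inv_sub_add hs]; ring
  rw [negLogDerivSubZeta, hd, h0, riemannZeta₁_eq_mul hs]
  field_simp
  ring

lemma riemannZeta₁_ne_zero_of_one_le_re {s : ℂ} (hs : 1 ≤ s.re) : riemannZeta₁ s ≠ 0 := by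
  rcases eq_or_ne s 1 with rfl | h
  · simp
  · rw [riemannZeta₁_eq_mul h]
    exact mul_ne_zero (sub_ne_zero.mpr h) (riemannZeta_ne_zero_of_one_le_re hs)

lemma analyticAt_negLogDerivSubZeta {s : ℂ} (hs : riemannZeta₁ s ≠ 0) :
    AnalyticAt ℂ negLogDerivSubZeta s :=
  (((differentiable_riemannZeta₁.analyticAt s).deriv.neg).div
    (differentiable_riemannZeta₁.analyticAt s) hs).sub (differentiable_riemannZeta₀.analyticAt s)

lemma norm_iteratedDeriv_negLogDerivSubZeta_le_of_two_le {a : ℝ} (ha : 0 < a) (ha1 : a ≤ 1)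
    {s : ℂ} (h1 : 1 < s.re) (h2 : s.re ≤ 2) (ht : 2 ≤ |s.im|)
    (hζ : a * (|s.im| ^ (1 / 50 : ℝ))⁻¹ ^ 4 ≤ ‖riemannZeta s‖) :
    ‖iteratedDeriv 2 negLogDerivSubZeta s‖ ≤
      2 * (100250 / a) * (100000 / a) ^ 2 * (|s.im| ^ (1 / 50 : ℝ)) ^ 15 := by
  set U : ℝ := |s.im| ^ (1 / 50 : ℝ) with hU
  have hU1 : 1 ≤ U := Real.one_le_rpow (by linarith) (by norm_num)
  have hU0 : 0 < U := by linarith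
  set ρ : ℝ := a * U⁻¹ ^ 5 / 100000 with hρ
  have hρ0 : 0 < ρ := by positivity
  have hUi : U⁻¹ ^ 5 ≤ 1 := pow_le_one₀ (by positivity) (inv_le_one_of_one_le₀ hU1)
  have hρ1 : ρ ≤ 1 / 200 := by
    have : a * U⁻¹ ^ 5 ≤ 1 * 1 := by gcongr
    rw [hρ]; linarith
  have hsub : Metric.closedBall s ρ ⊆ Metric.closedBall s (1 / 200) :=
    Metric.closedBall_subset_closedBall hρ1
  have hsub' : Metric.closedBall s (1 / 200) ⊆ Metric.closedBall s (1 / 100) :=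
    Metric.closedBall_subset_closedBall (by norm_num)
  have hne : ∀ w ∈ Metric.closedBall s ρ, w ≠ 1 := fun w hw =>
    ne_one_of_mem_closedBall ht (hsub' (hsub hw))
  have hder : ∀ w ∈ Metric.closedBall s ρ, ‖deriv riemannZeta w‖ ≤ 50000 * U := fun w hw =>
    norm_deriv_riemannZeta_le_of_mem_closedBall h1.le (by linarith) ht (hsub hw)
  have hup : ∀ w ∈ Metric.closedBall s ρ, ‖riemannZeta w‖ ≤ 250 * U := fun w hw =>
    norm_riemannZeta_le_of_mem_closedBall h1.le (by linarith) ht (hsub' (hsub hw))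
  have hlow : ∀ w ∈ Metric.closedBall s ρ, a / 2 * U⁻¹ ^ 4 ≤ ‖riemannZeta w‖ := by
    intro w hw
    have hdiff : ‖riemannZeta w - riemannZeta s‖ ≤ 50000 * U * ‖w - s‖ :=
      (convex_closedBall s ρ).norm_image_sub_le_of_norm_deriv_le
        (fun w hw => differentiableAt_riemannZeta (hne w hw)) hder
        (Metric.mem_closedBall_self hρ0.le) hw
    have hws : ‖w - s‖ ≤ ρ := by simpa [dist_eq_norm] using hw
    have h3 : 50000 * U * ‖w - s‖ ≤ 50000 * U * ρ := by gcongr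
    have h4 : 50000 * U * ρ = a / 2 * U⁻¹ ^ 4 := by
      rw [hρ]; field_simp; norm_num
    have h5 := norm_sub_norm_le (riemannZeta s) (riemannZeta w)
    rw [norm_sub_rev] at h5
    linarith
  have hlow0 : 0 < a / 2 * U⁻¹ ^ 4 := by positivity
  have hnz : ∀ w ∈ Metric.closedBall s ρ, riemannZeta w ≠ 0 := fun w hw =>
    norm_pos_iff.mp (hlow0.trans_le (hlow w hw))
  have hbd : ∀ w ∈ Metric.closedBall s ρ, ‖negLogDerivSubZeta w‖ ≤ 100250 / a * U ^ 5 := by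
    intro w hw
    rw [negLogDerivSubZeta_eq (hne w hw) (hnz w hw)]
    have h6 : ‖-deriv riemannZeta w / riemannZeta w‖ ≤ 50000 * U / (a / 2 * U⁻¹ ^ 4) := by
      rw [norm_div, norm_neg]
      exact div_le_div₀ (by positivity) (hder w hw) hlow0 (hlow w hw)
    have h7 : 50000 * U / (a / 2 * U⁻¹ ^ 4) = 100000 / a * U ^ 5 := by
      field_simp; norm_num
    have h8 : 250 * U ≤ 250 / a * U ^ 5 := by
      have : 250 ≤ 250 / a := by rw [le_div_iff₀ ha]; linarith
      have : U ≤ U ^ 5 := le_self_pow₀ hU1 (by norm_num)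
      gcongr
    have h9 := norm_sub_le (-deriv riemannZeta w / riemannZeta w) (riemannZeta w)
    have h10 := hup w hw
    have h11 : 100250 / a * U ^ 5 = 100000 / a * U ^ 5 + 250 / a * U ^ 5 := by ring
    linarith
  have hd : DiffContOnCl ℂ negLogDerivSubZeta (Metric.ball s ρ) := by
    apply DifferentiableOn.diffContOnCl
    intro w hw
    have hw' : w ∈ Metric.closedBall s ρ := Metric.closure_ball_subset_closedBall hw
    refine (analyticAt_negLogDerivSubZeta ?_).differentiableAt.differentiableWithinAt
    rw [riemannZeta₁_eq_mul (hne w hw')]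
    exact mul_ne_zero (sub_ne_zero.mpr (hne w hw')) (hnz w hw')
  have := Complex.norm_iteratedDeriv_le_of_forall_mem_sphere_norm_le 2 hρ0 hd
    (fun w hw => hbd w (Metric.sphere_subset_closedBall hw))
  refine this.trans (le_of_eq ?_)
  rw [hρ]
  field_simp
  norm_num

lemma exists_norm_iteratedDeriv_negLogDerivSubZeta_le :
    ∃ C : ℝ, 0 < C ∧ ∀ s : ℂ, 1 < s.re → s.re ≤ 2 →
      ‖iteratedDeriv 2 negLogDerivSubZeta s‖ ≤ C * (1 + |s.im|) ^ (3 / 10 : ℝ) := by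
  obtain ⟨a, ha, ha1, hζ⟩ := exists_le_norm_riemannZeta
  have hK : IsCompact (Set.Icc (1 : ℝ) 2 ×ℂ Set.Icc (-2 : ℝ) 2) :=
    isCompact_Icc.reProdIm isCompact_Icc
  have hcont : ContinuousOn (iteratedDeriv 2 negLogDerivSubZeta)
      (Set.Icc (1 : ℝ) 2 ×ℂ Set.Icc (-2 : ℝ) 2) := by
    intro s hs
    have hs1 : 1 ≤ s.re := by
      rw [Complex.mem_reProdIm] at hs; exact hs.1.1
    have := (analyticAt_negLogDerivSubZeta (riemannZeta₁_ne_zero_of_one_le_re hs1)).deriv.deriv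
    rw [iteratedDeriv_succ, iteratedDeriv_one]
    exact this.continuousAt.continuousWithinAt
  obtain ⟨B, hB⟩ := hK.exists_bound_of_continuousOn hcont
  refine ⟨max B (2 * (100250 / a) * (100000 / a) ^ 2), lt_max_of_lt_right (by positivity), ?_⟩
  intro s h1 h2
  have hpos : (1 : ℝ) ≤ (1 + |s.im|) ^ (3 / 10 : ℝ) :=
    Real.one_le_rpow (by linarith [abs_nonneg s.im]) (by norm_num)
  have hmax : 0 ≤ max B (2 * (100250 / a) * (100000 / a) ^ 2) :=
    le_max_of_le_right (by positivity)
  rcases le_total 2 |s.im| with ht | ht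
  · refine (norm_iteratedDeriv_negLogDerivSubZeta_le_of_two_le ha ha1 h1 h2 ht
      (hζ s h1 h2 ht)).trans ?_
    have : (|s.im| ^ (1 / 50 : ℝ)) ^ 15 ≤ (1 + |s.im|) ^ (3 / 10 : ℝ) := by
      rw [← Real.rpow_natCast, ← Real.rpow_mul (abs_nonneg _)]
      norm_num
      gcongr
      linarith
    gcongr
    exact le_max_right _ _
  · refine (hB s ?_).trans ?_
    · rw [Complex.mem_reProdIm]
      exact ⟨⟨h1.le, h2⟩, abs_le.mp ht⟩
    · exact (le_max_left _ _).trans (le_mul_of_one_le_right hmax hpos)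

lemma LSeriesSummable_vonMangoldt_sub_one {s : ℂ} (hs : 1 < s.re) :
    LSeriesSummable ((fun n => (ArithmeticFunction.vonMangoldt n : ℂ)) - 1) s :=
  (ArithmeticFunction.LSeriesSummable_vonMangoldt hs).sub (LSeriesSummable_one_iff.mpr hs)

lemma abscissaOfAbsConv_vonMangoldt_sub_one_le :
    LSeries.abscissaOfAbsConv ((fun n => (ArithmeticFunction.vonMangoldt n : ℂ)) - 1) ≤ 1 :=
  LSeries.abscissaOfAbsConv_le_of_forall_lt_LSeriesSummable fun x hx =>
    LSeriesSummable_vonMangoldt_sub_one (by simpa using hx)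

lemma negLogDerivSubZeta_eq_LSeries {s : ℂ} (hs : 1 < s.re) :
    negLogDerivSubZeta s = LSeries ((fun n => (ArithmeticFunction.vonMangoldt n : ℂ)) - 1) s := by
  have h1 : s ≠ 1 := by rintro rfl; simp at hs
  rw [negLogDerivSubZeta_eq h1 (riemannZeta_ne_zero_of_one_le_re hs.le),
    LSeries_sub (ArithmeticFunction.LSeriesSummable_vonMangoldt hs)
      (LSeriesSummable_one_iff.mpr hs),
    ArithmeticFunction.LSeries_vonMangoldt_eq_deriv_riemannZeta_div hs,
    LSeries_one_eq_riemannZeta hs]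

lemma iteratedDeriv_negLogDerivSubZeta {s : ℂ} (hs : 1 < s.re) :
    iteratedDeriv 2 negLogDerivSubZeta s =
      LSeries (LSeries.logMul^[2] ((fun n => (ArithmeticFunction.vonMangoldt n : ℂ)) - 1)) s := by
  have hev : negLogDerivSubZeta =ᶠ[nhds s]
      LSeries ((fun n => (ArithmeticFunction.vonMangoldt n : ℂ)) - 1) := by
    filter_upwards [(isOpen_lt continuous_const Complex.continuous_re).mem_nhds hs] with w hw
    exact negLogDerivSubZeta_eq_LSeries hw
  rw [hev.iteratedDeriv_eq, LSeries_iteratedDeriv]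
  · simp
  · exact abscissaOfAbsConv_vonMangoldt_sub_one_le.trans_lt (by exact_mod_cast hs)

lemma LSeriesSummable_logMul_vonMangoldt_sub_one {s : ℂ} (hs : 1 < s.re) :
    LSeriesSummable
      (LSeries.logMul^[2] ((fun n => (ArithmeticFunction.vonMangoldt n : ℂ)) - 1)) s := by
  apply LSeriesSummable_of_abscissaOfAbsConv_lt_re
  rw [LSeries.absicssaOfAbsConv_logPowMul]
  exact abscissaOfAbsConv_vonMangoldt_sub_one_le.trans_lt (by exact_mod_cast hs)

lemma integrableOn_mul_exp_neg_mul {c : ℝ} (hc : 0 < c) :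
    IntegrableOn (fun v : ℝ => v * Real.exp (-c * v)) (Set.Ioi 0) := by
  refine (integrableOn_rpow_mul_exp_neg_mul_rpow (s := 1) (p := 1) (by norm_num) one_pos hc).congr_fun
    (fun v _ => ?_) measurableSet_Ioi
  simp

lemma integral_mul_cexp_neg_mul {w : ℂ} (hw : 0 < w.re) :
    ∫ v in Set.Ioi (0 : ℝ), (v : ℂ) * Complex.exp (-w * v) = 1 / w ^ 2 := by
  have hw0 : w ≠ 0 := by rintro rfl; simp at hw
  have hnorm : ∀ v : ℝ, ‖Complex.exp (-w * v)‖ = Real.exp (-w.re * v) := by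
    intro v; rw [Complex.norm_exp]; simp
  have hderiv : ∀ v ∈ Set.Ici (0 : ℝ), HasDerivAt
      (fun v : ℝ => -((v : ℂ) / w + 1 / w ^ 2) * Complex.exp (-w * v))
      ((v : ℂ) * Complex.exp (-w * v)) v := by
    intro v _
    have h1 : HasDerivAt (fun v : ℝ => (v : ℂ)) 1 v := Complex.ofRealCLM.hasDerivAt
    have h2 := ((h1.div_const w).add_const (1 / w ^ 2)).neg.mul ((h1.const_mul (-w)).cexp)
    refine h2.congr_deriv ?_
    simp only [Pi.neg_apply]
    field_simp
    ring
  have hint : IntegrableOn (fun v : ℝ => (v : ℂ) * Complex.exp (-w * v)) (Set.Ioi 0) := by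
    refine (integrableOn_mul_exp_neg_mul hw).mono' (by fun_prop) ?_
    filter_upwards [self_mem_ae_restrict measurableSet_Ioi] with v hv
    rw [norm_mul, hnorm, Complex.norm_real, Real.norm_of_nonneg (le_of_lt hv)]
  have hlim : Filter.Tendsto (fun v : ℝ => -((v : ℂ) / w + 1 / w ^ 2) * Complex.exp (-w * v))
      Filter.atTop (nhds 0) := by
    have h1 : Filter.Tendsto (fun v : ℝ => v * Real.exp (-w.re * v)) Filter.atTop (nhds 0) := by
      have := tendsto_rpow_mul_exp_neg_mul_atTop_nhds_zero 1 w.re hw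
      simpa using this
    have h2 : Filter.Tendsto (fun v : ℝ => Real.exp (-w.re * v)) Filter.atTop (nhds 0) := by
      have := tendsto_rpow_mul_exp_neg_mul_atTop_nhds_zero 0 w.re hw
      simpa using this
    have h3 := (h1.const_mul (1 / ‖w‖)).add (h2.const_mul (1 / ‖w‖ ^ 2))
    simp only [mul_zero, add_zero] at h3
    refine squeeze_zero_norm' ?_ h3
    filter_upwards [Filter.eventually_ge_atTop 0] with v hv
    rw [norm_mul, hnorm, norm_neg]
    have := norm_add_le ((v : ℂ) / w) (1 / w ^ 2)
    rw [norm_div, norm_div, norm_one, norm_pow, Complex.norm_real, Real.norm_of_nonneg hv] at this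
    calc _ ≤ (v / ‖w‖ + 1 / ‖w‖ ^ 2) * Real.exp (-w.re * v) := by gcongr
      _ = _ := by ring
  rw [integral_Ioi_of_hasDerivAt_of_tendsto' hderiv hint hlim]
  simp

/-- The ramp `v ↦ v₊ exp(-c v)`. -/
noncomputable def expRamp (c v : ℝ) : ℝ := max v 0 * Real.exp (-c * v)

lemma continuous_expRamp (c : ℝ) : Continuous (expRamp c) := by
  unfold expRamp; fun_prop

lemma expRamp_eq_indicator (c : ℝ) :
    expRamp c = (Set.Ioi 0).indicator fun v => v * Real.exp (-c * v) := by
  ext v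
  by_cases hv : 0 < v
  · simp [expRamp, Set.indicator, hv, max_eq_left hv.le]
  · simp [expRamp, Set.indicator, hv, max_eq_right (not_lt.mp hv)]

lemma integrable_expRamp {c : ℝ} (hc : 0 < c) : Integrable (fun v => (expRamp c v : ℂ)) := by
  have h : Integrable (expRamp c) := by
    rw [expRamp_eq_indicator]
    exact (integrableOn_mul_exp_neg_mul hc).integrable_indicator measurableSet_Ioi
  exact h.ofReal

lemma fourier_expRamp {c : ℝ} (hc : 0 < c) (ξ : ℝ) :
    FourierTransform.fourier (fun v => (expRamp c v : ℂ)) ξ =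
      1 / ((c : ℂ) + 2 * Real.pi * ξ * Complex.I) ^ 2 := by
  rw [Real.fourier_real_eq_integral_exp_smul,
    ← integral_mul_cexp_neg_mul (w := (c : ℂ) + 2 * Real.pi * ξ * Complex.I) (by simpa using hc),
    ← integral_indicator measurableSet_Ioi]
  congr 1
  ext v
  rw [expRamp_eq_indicator]
  by_cases hv : 0 < v
  · simp only [Set.indicator, Set.mem_Ioi, hv, if_true, smul_eq_mul]
    push_cast
    rw [mul_left_comm, ← Complex.exp_add]
    congr 2
    ring
  · simp [Set.indicator, hv]

lemma norm_fourier_expRamp_eq {c : ℝ} (ξ : ℝ) :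
    ‖1 / ((c : ℂ) + 2 * Real.pi * ξ * Complex.I) ^ 2‖ = 1 / (c ^ 2 + (2 * Real.pi * ξ) ^ 2) := by
  rw [norm_div, norm_one, norm_pow, ← Complex.normSq_eq_norm_sq, Complex.normSq_apply]
  congr 1
  simp
  ring

lemma norm_fourier_expRamp_le {c : ℝ} (hc : 1 / 2 ≤ c) (ξ : ℝ) :
    ‖1 / ((c : ℂ) + 2 * Real.pi * ξ * Complex.I) ^ 2‖ ≤ 8 * (1 + ‖ξ‖) ^ (-2 : ℝ) := by
  rw [norm_fourier_expRamp_eq, Real.rpow_neg (by positivity), Real.rpow_two, ← div_eq_mul_inv,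
    div_le_div_iff₀ (by positivity) (by positivity), Real.norm_eq_abs]
  have h1 : (1 / 4 : ℝ) ≤ c ^ 2 := by nlinarith
  have h2 : |ξ| ^ 2 ≤ (2 * Real.pi * ξ) ^ 2 := by
    rw [sq_abs, mul_pow]
    have : 1 ≤ (2 * Real.pi) ^ 2 := by nlinarith [Real.pi_gt_three]
    nlinarith [sq_nonneg ξ]
  nlinarith [sq_nonneg (|ξ| - 1)]

lemma integrable_fourier_expRamp {c : ℝ} (hc : 1 / 2 ≤ c) :
    Integrable (fun ξ : ℝ => 1 / ((c : ℂ) + 2 * Real.pi * ξ * Complex.I) ^ 2) := by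
  have h := (integrable_one_add_norm (E := ℝ) (μ := volume) (r := 2) (by simp)).const_mul 8
  refine h.mono' (Measurable.aestronglyMeasurable (by fun_prop)) ?_
  exact Filter.Eventually.of_forall fun ξ => norm_fourier_expRamp_le hc ξ

lemma integral_exp_mul_fourier_expRamp {c : ℝ} (hc : 1 / 2 ≤ c) (v : ℝ) :
    ∫ ξ : ℝ, Complex.exp (2 * Real.pi * ξ * v * Complex.I) *
      (1 / ((c : ℂ) + 2 * Real.pi * ξ * Complex.I) ^ 2) = (expRamp c v : ℂ) := by
  have hc0 : 0 < c := by linarith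
  have hF : FourierTransform.fourier (fun v => (expRamp c v : ℂ)) =
      fun ξ : ℝ => 1 / ((c : ℂ) + 2 * Real.pi * ξ * Complex.I) ^ 2 :=
    funext (fourier_expRamp hc0)
  have h := (integrable_expRamp hc0).fourierInv_fourier_eq
    (by rw [hF]; exact integrable_fourier_expRamp hc) (v := v)
    ((Complex.continuous_ofReal.comp (continuous_expRamp c)).continuousAt)
  rw [← h, hF, Real.fourierInv_eq']
  congr 1
  ext ξ
  simp only [smul_eq_mul, RCLike.inner_apply, conj_trivial]
  push_cast
  congr 2
  ring

lemma LSeries_term_sub_mul_I (b : ℕ → ℂ) (σ ξ : ℝ) (n : ℕ) :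
    LSeries.term b (σ - 2 * Real.pi * ξ * Complex.I) n =
      LSeries.term b σ n * Complex.exp (2 * Real.pi * ξ * Real.log n * Complex.I) := by
  rcases eq_or_ne n 0 with rfl | hn
  · simp
  · have hn' : (n : ℂ) ≠ 0 := by exact_mod_cast hn
    rw [LSeries.term_of_ne_zero hn, LSeries.term_of_ne_zero hn, Complex.cpow_sub _ _ hn',
      Complex.cpow_def_of_ne_zero hn' (2 * Real.pi * ξ * Complex.I), Complex.natCast_log,
      div_div_eq_mul_div]
    ring_nf

lemma hasSum_LSeries_term_mul_expRamp {b : ℕ → ℂ} {σ c : ℝ} (hc : 1 / 2 ≤ c) (x : ℝ)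
    (hb : LSeriesSummable b σ) :
    HasSum (fun n : ℕ => LSeries.term b σ n * expRamp c (Real.log n - x))
      (∫ ξ : ℝ, Complex.exp (-(2 * Real.pi * ξ * x * Complex.I)) *
        (1 / ((c : ℂ) + 2 * Real.pi * ξ * Complex.I) ^ 2) *
        LSeries b (σ - 2 * Real.pi * ξ * Complex.I)) := by
  set F : ℕ → ℝ → ℂ := fun n ξ => LSeries.term b σ n *
    (Complex.exp (2 * Real.pi * ξ * (Real.log n - x : ℝ) * Complex.I) *
      (1 / ((c : ℂ) + 2 * Real.pi * ξ * Complex.I) ^ 2)) with hF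
  have hexp : ∀ (n : ℕ) (ξ : ℝ),
      ‖Complex.exp (2 * Real.pi * ξ * (Real.log n - x : ℝ) * Complex.I)‖ = 1 := by
    intro n ξ
    have : (2 * Real.pi * ξ * (Real.log n - x : ℝ) * Complex.I : ℂ) =
        ((2 * Real.pi * ξ * (Real.log n - x) : ℝ) : ℂ) * Complex.I := by push_cast; ring
    rw [this, Complex.norm_exp_ofReal_mul_I]
  have hint : ∀ n, Integrable (F n) := by
    intro n
    refine Integrable.const_mul ?_ _
    refine (integrable_fourier_expRamp hc).bdd_mul (c := 1) (by fun_prop) ?_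
    exact Filter.Eventually.of_forall fun ξ => (hexp n ξ).le
  have hsum : Summable fun n => ∫ ξ, ‖F n ξ‖ := by
    have : ∀ n, ∫ ξ, ‖F n ξ‖ = ‖LSeries.term b σ n‖ *
        ∫ ξ : ℝ, ‖1 / ((c : ℂ) + 2 * Real.pi * ξ * Complex.I) ^ 2‖ := by
      intro n
      rw [← integral_const_mul]
      congr 1
      ext ξ
      rw [hF]
      simp only
      rw [norm_mul, norm_mul, hexp, one_mul]
    simp_rw [this]
    exact hb.norm.mul_right _
  have h := hasSum_integral_of_summable_integral_norm hint hsum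
  have h1 : (fun n : ℕ => ∫ ξ, F n ξ) =
      fun n : ℕ => LSeries.term b σ n * expRamp c (Real.log n - x) := by
    funext n
    simp only [hF]
    rw [integral_const_mul, integral_exp_mul_fourier_expRamp hc]
  have h2 : (fun ξ : ℝ => ∑' n, F n ξ) = fun ξ : ℝ =>
      Complex.exp (-(2 * Real.pi * ξ * x * Complex.I)) *
        (1 / ((c : ℂ) + 2 * Real.pi * ξ * Complex.I) ^ 2) *
        LSeries b (σ - 2 * Real.pi * ξ * Complex.I) := by
    funext ξ
    rw [LSeries, ← tsum_mul_left]
    refine tsum_congr fun n => ?_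
    rw [LSeries_term_sub_mul_I]
    simp only [hF]
    have : Complex.exp (2 * Real.pi * ξ * (Real.log n - x : ℝ) * Complex.I) =
        Complex.exp (-(2 * Real.pi * ξ * x * Complex.I)) *
          Complex.exp (2 * Real.pi * ξ * Real.log n * Complex.I) := by
      rw [← Complex.exp_add]
      push_cast
      ring_nf
    rw [this]
    ring
  rwa [h1, h2] at h

lemma exists_norm_tsum_logMul_vonMangoldt_sub_one_le :
    ∃ C : ℝ, 0 < C ∧ ∀ σ c x : ℝ, 1 < σ → σ ≤ 2 → 1 / 2 ≤ c →
      ‖∑' n : ℕ, LSeries.term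
        (LSeries.logMul^[2] ((fun n => (ArithmeticFunction.vonMangoldt n : ℂ)) - 1)) σ n *
          expRamp c (Real.log n - x)‖ ≤ C := by
  obtain ⟨C, hC, hG⟩ := exists_norm_iteratedDeriv_negLogDerivSubZeta_le
  have hI := (integrable_one_add_norm (E := ℝ) (μ := volume) (r := 17 / 10)
    (by norm_num)).const_mul (64 * C)
  refine ⟨(∫ ξ : ℝ, 64 * C * (1 + ‖ξ‖) ^ (-(17 / 10) : ℝ)) + 1, ?_, ?_⟩
  · have : 0 ≤ ∫ ξ : ℝ, 64 * C * (1 + ‖ξ‖) ^ (-(17 / 10) : ℝ) :=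
      integral_nonneg fun ξ => by positivity
    linarith
  intro σ c x h1 h2 hc
  rw [(hasSum_LSeries_term_mul_expRamp hc x
    (LSeriesSummable_logMul_vonMangoldt_sub_one (by simpa using h1))).tsum_eq]
  refine (norm_integral_le_of_norm_le hI (Filter.Eventually.of_forall fun ξ => ?_)).trans
    (by linarith)
  have hre : ((σ : ℂ) - 2 * Real.pi * ξ * Complex.I).re = σ := by simp
  have him : ((σ : ℂ) - 2 * Real.pi * ξ * Complex.I).im = -(2 * Real.pi * ξ) := by simp
  rw [norm_mul, norm_mul, ← iteratedDeriv_negLogDerivSubZeta (by rw [hre]; exact h1)]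
  have hexp : ‖Complex.exp (-(2 * Real.pi * ξ * x * Complex.I))‖ = 1 := by
    rw [Complex.norm_exp]; simp
  have hG' := hG ((σ : ℂ) - 2 * Real.pi * ξ * Complex.I) (by rw [hre]; exact h1)
    (by rw [hre]; exact h2)
  rw [him, abs_neg, abs_mul, abs_of_pos Real.two_pi_pos] at hG'
  have h8 : (1 + 2 * Real.pi * |ξ|) ^ (3 / 10 : ℝ) ≤ 8 * (1 + ‖ξ‖) ^ (3 / 10 : ℝ) := by
    calc (1 + 2 * Real.pi * |ξ|) ^ (3 / 10 : ℝ) ≤ (8 * (1 + ‖ξ‖)) ^ (3 / 10 : ℝ) := by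
          apply Real.rpow_le_rpow (by positivity) _ (by norm_num)
          rw [Real.norm_eq_abs]
          nlinarith [Real.pi_lt_four, abs_nonneg ξ]
      _ = 8 ^ (3 / 10 : ℝ) * (1 + ‖ξ‖) ^ (3 / 10 : ℝ) :=
          Real.mul_rpow (by norm_num) (by positivity)
      _ ≤ _ := by
          gcongr
          calc (8 : ℝ) ^ (3 / 10 : ℝ) ≤ 8 ^ (1 : ℝ) :=
                Real.rpow_le_rpow_of_exponent_le (by norm_num) (by norm_num)
            _ = 8 := Real.rpow_one 8
  rw [hexp, one_mul]
  calc _ ≤ 8 * (1 + ‖ξ‖) ^ (-2 : ℝ) * (C * (8 * (1 + ‖ξ‖) ^ (3 / 10 : ℝ))) := by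
        refine mul_le_mul (norm_fourier_expRamp_le hc ξ) (hG'.trans (by gcongr))
          (norm_nonneg _) (by positivity)
    _ = 64 * C * ((1 + ‖ξ‖) ^ (-2 : ℝ) * (1 + ‖ξ‖) ^ (3 / 10 : ℝ)) := by ring
    _ = _ := by
        rw [← Real.rpow_add (by positivity)]
        norm_num

lemma logMul_iterate_apply (f : ℕ → ℂ) (m n : ℕ) :
    LSeries.logMul^[m] f n = (Real.log n : ℂ) ^ m * f n := by
  induction m with
  | zero => simp
  | succ m ih =>
    rw [Function.iterate_succ_apply', LSeries.logMul, ih, ← Complex.natCast_log]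
    ring

lemma LSeries_term_mul_expRamp_eq (f : ℕ → ℝ) (y : ℝ) (n : ℕ) :
    LSeries.term (LSeries.logMul^[2] fun n => (f n : ℂ)) ((1 + 1 / Real.log y : ℝ) : ℂ) n *
      expRamp (1 - 1 / Real.log y) (Real.log n - Real.log y) =
    ((Real.exp (Real.log y - (Real.log y) / Real.log y) *
      (f n * Real.log n ^ 2 / n ^ 2 * max (Real.log n - Real.log y) 0) : ℝ) : ℂ) := by
  rcases eq_or_ne n 0 with rfl | hn
  · simp
  have hn0 : (0 : ℝ) < n := by positivity
  rw [LSeries.term_of_ne_zero hn, logMul_iterate_apply, expRamp, ← Complex.ofReal_natCast n,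
    ← Complex.ofReal_cpow hn0.le]
  have hsq : (n : ℝ) ^ 2 = Real.exp (2 * Real.log n) := by
    rw [two_mul, Real.exp_add, Real.exp_log hn0, sq]
  rw [hsq, Real.rpow_def_of_pos hn0]
  norm_cast
  rw [div_eq_mul_inv, div_eq_mul_inv _ (Real.exp (2 * Real.log n)), ← Real.exp_neg,
    ← Real.exp_neg]
  have h : Real.exp (-(Real.log n * (1 + 1 / Real.log y))) *
      Real.exp (-(1 - 1 / Real.log y) * (Real.log n - Real.log y)) =
      Real.exp (Real.log y - (Real.log y) / Real.log y) * Real.exp (-(2 * Real.log n)) := by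
    rw [← Real.exp_add, ← Real.exp_add]
    congr 1
    ring
  linear_combination (Real.log n ^ 2 * f n * max (Real.log n - Real.log y) 0) * h

lemma exists_abs_tsum_vonMangoldt_sub_one_le :
    ∃ C : ℝ, 0 < C ∧ ∀ y : ℝ, Real.exp 2 ≤ y →
      |∑' n : ℕ, (ArithmeticFunction.vonMangoldt n - 1) * Real.log n ^ 2 / n ^ 2 *
        max (Real.log n - Real.log y) 0| ≤ C / y := by
  obtain ⟨C, hC, h⟩ := exists_norm_tsum_logMul_vonMangoldt_sub_one_le
  refine ⟨C * Real.exp 1, by positivity, fun y hy => ?_⟩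
  have hy0 : 0 < y := (Real.exp_pos 2).trans_le hy
  have hL : 2 ≤ Real.log y := (Real.le_log_iff_exp_le hy0).mpr hy
  have h1 : 1 / Real.log y ≤ 1 / 2 := one_div_le_one_div_of_le (by norm_num) hL
  have h2 : 0 < 1 / Real.log y := by positivity
  have hf : ((fun n => (ArithmeticFunction.vonMangoldt n : ℂ)) - 1) =
      fun n => ((ArithmeticFunction.vonMangoldt n - 1 : ℝ) : ℂ) := by
    ext n; simp
  have := h (1 + 1 / Real.log y) (1 - 1 / Real.log y) (Real.log y) (by linarith) (by linarith)
    (by linarith)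
  rw [hf] at this
  simp_rw [LSeries_term_mul_expRamp_eq (fun n => ArithmeticFunction.vonMangoldt n - 1) y]
    at this
  rw [← Complex.ofReal_tsum, Complex.norm_real, tsum_mul_left, norm_mul,
    div_self (by linarith), Real.exp_sub, Real.exp_log hy0, Real.norm_of_nonneg (by positivity),
    Real.norm_eq_abs] at this
  rw [le_div_iff₀ hy0]
  rw [div_mul_eq_mul_div, div_le_iff₀ (Real.exp_pos 1)] at this
  linarith

lemma summable_vonMangoldt_mul_log_pow_div_sq (m : ℕ) :
    Summable fun n : ℕ => ArithmeticFunction.vonMangoldt n * Real.log n ^ m / n ^ 2 := by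
  have h : LSeriesSummable
      (LSeries.logMul^[m] fun n => (ArithmeticFunction.vonMangoldt n : ℂ)) 2 := by
    apply LSeriesSummable_of_abscissaOfAbsConv_lt_re
    rw [LSeries.absicssaOfAbsConv_logPowMul]
    refine (LSeries.abscissaOfAbsConv_le_of_forall_lt_LSeriesSummable (x := 1) fun x hx =>
      ArithmeticFunction.LSeriesSummable_vonMangoldt (by simpa using hx)).trans_lt ?_
    rw [Complex.re_ofNat]
    exact_mod_cast (one_lt_two : (1 : ℝ) < 2)
  refine h.norm.congr fun n => ?_
  rcases eq_or_ne n 0 with rfl | hn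
  · simp
  rw [LSeries.term_of_ne_zero hn, logMul_iterate_apply, norm_div, norm_mul, norm_pow,
    Complex.norm_real, Complex.norm_real, Real.norm_of_nonneg (Real.log_natCast_nonneg n),
    Real.norm_of_nonneg ArithmeticFunction.vonMangoldt_nonneg]
  have : ‖(n : ℂ) ^ (2 : ℂ)‖ = (n : ℝ) ^ 2 := by
    rw [Complex.norm_natCast_cpow_of_pos (Nat.pos_of_ne_zero hn)]; norm_num
  rw [this, mul_comm (Real.log n ^ m)]

lemma summable_log_pow_div_sq (m : ℕ) :
    Summable fun n : ℕ => Real.log n ^ m / (n : ℝ) ^ 2 := by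
  have h : LSeriesSummable (LSeries.logMul^[m] 1) 2 := by
    apply LSeriesSummable_of_abscissaOfAbsConv_lt_re
    rw [LSeries.absicssaOfAbsConv_logPowMul]
    refine (LSeries.abscissaOfAbsConv_le_of_forall_lt_LSeriesSummable (x := 1) fun x hx =>
      LSeriesSummable_one_iff.mpr (by simpa using hx)).trans_lt ?_
    rw [Complex.re_ofNat]
    exact_mod_cast (one_lt_two : (1 : ℝ) < 2)
  refine h.norm.congr fun n => ?_
  rcases eq_or_ne n 0 with rfl | hn
  · simp
  rw [LSeries.term_of_ne_zero hn, logMul_iterate_apply, norm_div, norm_mul, norm_pow,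
    Complex.norm_real, Real.norm_of_nonneg (Real.log_natCast_nonneg n)]
  have : ‖(n : ℂ) ^ (2 : ℂ)‖ = (n : ℝ) ^ 2 := by
    rw [Complex.norm_natCast_cpow_of_pos (Nat.pos_of_ne_zero hn)]; norm_num
  rw [this]
  simp

lemma sub_mul_log_sq_div_sq_le {u v : ℝ} (hu : 3 ≤ u) (huv : u ≤ v) :
    (v - u) * (Real.log v ^ 2 / v ^ 2) ≤
      (Real.log u ^ 2 + 2 * Real.log u + 2) / u - (Real.log v ^ 2 + 2 * Real.log v + 2) / v := by
  rcases huv.eq_or_lt with rfl | huv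
  · simp
  have hd : ∀ x : ℝ, 0 < x → HasDerivAt
      (fun x => (Real.log x ^ 2 + 2 * Real.log x + 2) / x) (-(Real.log x ^ 2 / x ^ 2)) x := by
    intro x hx
    have h1 := Real.hasDerivAt_log hx.ne'
    have h2 := (((h1.fun_pow 2).add (h1.const_mul 2)).add_const 2).div (hasDerivAt_id x) hx.ne'
    refine h2.congr_deriv ?_
    simp only [id, Pi.add_apply]
    field_simp
    ring
  obtain ⟨ξ, hξ, hξe⟩ := exists_hasDerivAt_eq_slope _ _ huv
    (fun x hx => (hd x (by linarith [hx.1])).continuousAt.continuousWithinAt)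
    (fun x hx => hd x (by linarith [hx.1]))
  rw [eq_div_iff (by linarith)] at hξe
  have he : Real.exp 1 ≤ 3 := by linarith [Real.exp_one_lt_d9]
  have hanti := Real.log_div_self_antitoneOn (show ξ ∈ {x | Real.exp 1 ≤ x} by
    simp only [Set.mem_ofPred_eq]; linarith [hξ.1]) (show v ∈ {x | Real.exp 1 ≤ x} by
    simp only [Set.mem_ofPred_eq]; linarith) hξ.2.le
  have hv0 : 0 ≤ Real.log v / v := div_nonneg (Real.log_nonneg (by linarith)) (by linarith)
  have h3 : (Real.log v / v) ^ 2 ≤ (Real.log ξ / ξ) ^ 2 := by gcongr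
  rw [div_pow, div_pow] at h3
  nlinarith

lemma sum_log_sq_div_sq_le {w : ℝ} (hw : 3 ≤ w) (T : Finset ℕ) (hT : ∀ n ∈ T, w < n) :
    ∑ n ∈ T, Real.log n ^ 2 / (n : ℝ) ^ 2 ≤
      (Real.log w ^ 2 + 2 * Real.log w + 2) / w + Real.log w ^ 2 / w ^ 2 := by
  set F : ℝ → ℝ := fun x => (Real.log x ^ 2 + 2 * Real.log x + 2) / x with hF
  have hFnn : ∀ x : ℝ, 3 ≤ x → 0 ≤ F x := by
    intro x hx
    have : 0 ≤ Real.log x := Real.log_nonneg (by linarith)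
    simp only [hF]
    positivity
  set N : ℕ := ⌊w⌋₊ + 1 with hN
  have hwN : w < N := by rw [hN]; exact_mod_cast Nat.lt_floor_add_one w
  have htel : ∀ m : ℕ, ∑ n ∈ Finset.Ico (N + 1) (N + 1 + m), Real.log n ^ 2 / (n : ℝ) ^ 2 ≤
      F N - F (N + m : ℕ) := by
    intro m
    induction m with
    | zero => simp
    | succ m ih =>
      rw [← add_assoc, Finset.sum_Ico_succ_top (by omega)]
      have := sub_mul_log_sq_div_sq_le (u := (N + m : ℕ)) (v := (N + 1 + m : ℕ))
        (by push_cast; linarith [(Nat.cast_nonneg m : (0 : ℝ) ≤ m)]) (by push_cast; linarith)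
      have h1 : ((N + 1 + m : ℕ) : ℝ) - ((N + m : ℕ) : ℝ) = 1 := by push_cast; ring
      rw [h1, one_mul] at this
      have h2 : N + (m + 1) = N + 1 + m := by ring
      rw [h2]
      simp only [hF] at ih ⊢
      linarith
  obtain ⟨m, hm⟩ : ∃ m : ℕ, ∀ n ∈ T, n < N + 1 + m :=
    ⟨T.sup id, fun n hn => by
      have : n ≤ T.sup id := Finset.le_sup (f := id) hn
      omega⟩
  have hsub : T ⊆ Finset.Ico N (N + 1 + m) := fun n hn => by
    rw [Finset.mem_Ico]
    refine ⟨?_, hm n hn⟩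
    have : ⌊w⌋₊ < n := (Nat.floor_lt (by linarith)).mpr (hT n hn)
    omega
  have h1 : ∑ n ∈ T, Real.log n ^ 2 / (n : ℝ) ^ 2 ≤
      ∑ n ∈ Finset.Ico N (N + 1 + m), Real.log n ^ 2 / (n : ℝ) ^ 2 :=
    Finset.sum_le_sum_of_subset_of_nonneg hsub fun _ _ _ => by positivity
  rw [Finset.sum_eq_sum_Ico_succ_bot (by omega)] at h1
  have h2 := htel m
  have h3 := hFnn (N + m : ℕ) (by push_cast; linarith [(Nat.cast_nonneg m : (0 : ℝ) ≤ m)])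
  have h4 := sub_mul_log_sq_div_sq_le hw hwN.le
  have h5 : 0 ≤ ((N : ℝ) - w) * (Real.log N ^ 2 / (N : ℝ) ^ 2) :=
    mul_nonneg (by linarith) (by positivity)
  have he : Real.exp 1 ≤ 3 := by linarith [Real.exp_one_lt_d9]
  have hanti := Real.log_div_self_antitoneOn (show w ∈ {x | Real.exp 1 ≤ x} by
    simp only [Set.mem_ofPred_eq]; linarith) (show (N : ℝ) ∈ {x | Real.exp 1 ≤ x} by
    simp only [Set.mem_ofPred_eq]; linarith) hwN.le
  have hv0 : 0 ≤ Real.log N / N := div_nonneg (Real.log_nonneg (by linarith)) (by linarith)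
  have h6 : (Real.log N / N) ^ 2 ≤ (Real.log w / w) ^ 2 := by gcongr
  rw [div_pow, div_pow] at h6
  simp only [hF] at h2 h3
  linarith

lemma summable_mul_max_log_sub {f : ℕ → ℝ} (hf : Summable fun n : ℕ => f n * Real.log n ^ 3 / n ^ 2)
    (hf0 : ∀ n, 0 ≤ f n) {y : ℝ} (hy : 1 ≤ y) :
    Summable fun n : ℕ => f n * Real.log n ^ 2 / n ^ 2 * max (Real.log n - Real.log y) 0 := by
  have hlog := Real.log_nonneg hy
  refine Summable.of_nonneg_of_le (fun n => ?_) (fun n => ?_) hf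
  · have := hf0 n
    positivity
  · have h1 : max (Real.log n - Real.log y) 0 ≤ Real.log n :=
      max_le (by linarith) (Real.log_natCast_nonneg n)
    have := hf0 n
    calc _ ≤ f n * Real.log n ^ 2 / n ^ 2 * Real.log n := by gcongr
      _ = _ := by ring

/-- The sum of `1/p²` over primes `p > y` is at most `(1 + O(1/log y)) / (y log y)`. -/
lemma exists_sum_prime_inv_sq_le :
    ∃ C : ℝ, 0 < C ∧ ∀ y : ℝ, Real.exp 4 ≤ y → ∀ S : Finset ℕ,
      (∀ p ∈ S, p.Prime ∧ y < p) →
      ∑ p ∈ S, 1 / (p : ℝ) ^ 2 ≤ (1 + C / Real.log y) / (y * Real.log y) := by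
  obtain ⟨C, hC, hmain⟩ := exists_abs_tsum_vonMangoldt_sub_one_le
  refine ⟨8 + 3 * C, by positivity, fun y hy S hS => ?_⟩
  have hy0 : 0 < y := (Real.exp_pos 4).trans_le hy
  set L := Real.log y with hL
  have hL4 : 4 ≤ L := (Real.le_log_iff_exp_le hy0).mpr hy
  set δ : ℝ := 1 / L with hδ
  have hδ0 : 0 < δ := by positivity
  have hδL : δ * L = 1 := by rw [hδ]; field_simp
  have hδ4 : δ ≤ 1 / 4 := one_div_le_one_div_of_le (by norm_num) hL4
  set w : ℝ := Real.exp (L - δ) with hw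
  have hlogw : Real.log w = L - δ := Real.log_exp _
  have hw0 : 0 < w := Real.exp_pos _
  have hwy : y * (1 - δ) ≤ w := by
    rw [hw, sub_eq_add_neg L, Real.exp_add, hL, Real.exp_log hy0]
    gcongr
    linarith [Real.add_one_le_exp (-δ)]
  have hwley : w ≤ y := by
    rw [← Real.exp_log hy0, hw]
    gcongr
    linarith
  have hw2 : Real.exp 2 ≤ w := by rw [hw]; gcongr; linarith
  have hw3 : 3 ≤ w := by linarith [Real.add_one_le_exp (2 : ℝ)]
  have hsΛ : ∀ x : ℝ, 1 ≤ x → Summable fun n : ℕ => ArithmeticFunction.vonMangoldt n *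
      Real.log n ^ 2 / n ^ 2 * max (Real.log n - Real.log x) 0 := fun x hx =>
    summable_mul_max_log_sub (summable_vonMangoldt_mul_log_pow_div_sq 3)
      (fun _ => ArithmeticFunction.vonMangoldt_nonneg) hx
  have hs1 : ∀ x : ℝ, 1 ≤ x → Summable fun n : ℕ => (1 : ℝ) *
      Real.log n ^ 2 / n ^ 2 * max (Real.log n - Real.log x) 0 := fun x hx =>
    summable_mul_max_log_sub (f := fun _ => 1) (by simpa using summable_log_pow_div_sq 3)
      (fun _ => zero_le_one) hx
  have hdiff : ∀ x : ℝ, Real.exp 2 ≤ x →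
      |(∑' n : ℕ, ArithmeticFunction.vonMangoldt n *
        Real.log n ^ 2 / n ^ 2 * max (Real.log n - Real.log x) 0) - ∑' n : ℕ, (1 : ℝ) *
        Real.log n ^ 2 / n ^ 2 * max (Real.log n - Real.log x) 0| ≤ C / x := by
    intro x hx
    have hx1 : 1 ≤ x := by linarith [Real.add_one_le_exp (2 : ℝ)]
    rw [← (hsΛ x hx1).tsum_sub (hs1 x hx1)]
    refine le_of_eq_of_le ?_ (hmain x hx)
    refine congrArg _ (tsum_congr fun n => ?_)
    ring
  have hw1 : 1 ≤ w := by linarith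
  have hy1 : 1 ≤ y := by linarith
  have hlow : δ * ∑ n ∈ S, ArithmeticFunction.vonMangoldt n * Real.log n ^ 2 / (n : ℝ) ^ 2 ≤
      (∑' n : ℕ, ArithmeticFunction.vonMangoldt n *
        Real.log n ^ 2 / n ^ 2 * max (Real.log n - Real.log w) 0) - ∑' n : ℕ,
        ArithmeticFunction.vonMangoldt n *
        Real.log n ^ 2 / n ^ 2 * max (Real.log n - Real.log y) 0 := by
    rw [← (hsΛ w hw1).tsum_sub (hsΛ y hy1), Finset.mul_sum]
    refine le_trans (Finset.sum_le_sum fun n hn => ?_)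
      (((hsΛ w hw1).sub (hsΛ y hy1)).sum_le_tsum S fun n _ => ?_)
    · have hny : L ≤ Real.log n := Real.log_le_log hy0 (hS n hn).2.le
      rw [hlogw, max_eq_left (by linarith), max_eq_left (by linarith)]
      apply le_of_eq
      ring
    · rw [← mul_sub]
      refine mul_nonneg ?_ (sub_nonneg.mpr (max_le_max_right _ ?_))
      · have := ArithmeticFunction.vonMangoldt_nonneg (n := n)
        positivity
      · rw [hlogw]; linarith
  have hup : (∑' n : ℕ, (1 : ℝ) *
        Real.log n ^ 2 / n ^ 2 * max (Real.log n - Real.log w) 0) - ∑' n : ℕ,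
        (1 : ℝ) * Real.log n ^ 2 / n ^ 2 * max (Real.log n - Real.log y) 0 ≤
      δ * ((Real.log w ^ 2 + 2 * Real.log w + 2) / w + Real.log w ^ 2 / w ^ 2) := by
    rw [← (hs1 w hw1).tsum_sub (hs1 y hy1)]
    refine ((hs1 w hw1).sub (hs1 y hy1)).tsum_le_of_sum_le fun T => ?_
    have hterm : ∀ n ∈ T, ((1 : ℝ) *
        Real.log n ^ 2 / n ^ 2 * max (Real.log n - Real.log w) 0) -
        (1 : ℝ) * Real.log n ^ 2 / n ^ 2 * max (Real.log n - Real.log y) 0 ≤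
        if w < n then δ * (Real.log n ^ 2 / (n : ℝ) ^ 2) else 0 := by
      intro n _
      rw [one_mul, ← mul_sub]
      split_ifs with h
      · rw [mul_comm δ]
        gcongr
        rw [hlogw, ← hL]
        rcases le_total (Real.log n - L) 0 with h1 | h1
        · rw [max_eq_right h1]
          simp only [sub_zero]
          exact max_le (by linarith) hδ0.le
        · rw [max_eq_left h1, max_eq_left (by linarith)]
          linarith
      · rcases Nat.eq_zero_or_pos n with rfl | hn
        · simp
        have h1 : Real.log n ≤ Real.log w :=
          Real.log_le_log (by exact_mod_cast hn) (not_lt.mp h)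
        have h2 : Real.log w ≤ Real.log y := Real.log_le_log hw0 hwley
        rw [max_eq_right (by linarith), max_eq_right (by linarith)]
        simp
    refine (Finset.sum_le_sum hterm).trans ?_
    rw [← Finset.sum_filter, ← Finset.mul_sum]
    exact mul_le_mul_of_nonneg_left
      (sum_log_sq_div_sq_le hw3 _ fun n hn => (Finset.mem_filter.mp hn).2) hδ0.le
  have hdw := (abs_le.mp (hdiff w hw2)).2
  have hdy := (abs_le.mp (hdiff y (hw2.trans hwley))).1
  have hyw : 1 / w ≤ (1 + 2 * δ) / y := by
    rw [div_le_div_iff₀ hw0 hy0]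
    nlinarith
  have hT : ∑ n ∈ S, ArithmeticFunction.vonMangoldt n * Real.log n ^ 2 / (n : ℝ) ^ 2 ≤
      (Real.log w ^ 2 + 2 * Real.log w + 2) / w + Real.log w ^ 2 / w ^ 2 +
        L * (C / w + C / y) := by
    refine le_of_mul_le_mul_left ?_ hδ0
    have : δ * (L * (C / w + C / y)) = C / w + C / y := by rw [← mul_assoc, hδL, one_mul]
    rw [mul_add, this]
    linarith
  have hprime : L ^ 3 * ∑ p ∈ S, 1 / (p : ℝ) ^ 2 ≤
      ∑ n ∈ S, ArithmeticFunction.vonMangoldt n * Real.log n ^ 2 / (n : ℝ) ^ 2 := by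
    rw [Finset.mul_sum]
    refine Finset.sum_le_sum fun p hp => ?_
    have hpy : L ≤ Real.log p := Real.log_le_log hy0 (hS p hp).2.le
    rw [ArithmeticFunction.vonMangoldt_apply_prime (hS p hp).1, mul_one_div]
    have : L ^ 3 ≤ Real.log p * Real.log p ^ 2 := by
      calc L ^ 3 ≤ Real.log p ^ 3 := by gcongr
        _ = _ := by ring
    gcongr
  have hB : (Real.log w ^ 2 + 2 * Real.log w + 2) / w + Real.log w ^ 2 / w ^ 2 ≤
      (1 + 2 * δ) / y * (L ^ 2 + 3 * L + 2) := by
    have hl0 : 0 ≤ Real.log w := Real.log_nonneg hw1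
    have hlL : Real.log w ≤ L := by rw [hlogw]; linarith
    have h1 : Real.log w ^ 2 / w ^ 2 ≤ 1 / w * L := by
      have h2 : Real.log w / w ≤ 1 := by
        rw [div_le_one hw0]; linarith [Real.log_le_sub_one_of_pos hw0]
      calc Real.log w ^ 2 / w ^ 2 = 1 / w * (Real.log w * (Real.log w / w)) := by
            field_simp
        _ ≤ 1 / w * (L * 1) := by gcongr
        _ = _ := by ring
    calc _ ≤ (L ^ 2 + 2 * L + 2) / w + 1 / w * L := by gcongr
      _ = 1 / w * (L ^ 2 + 3 * L + 2) := by ring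
      _ ≤ _ := by gcongr
  have hC2 : L * (C / w + C / y) ≤ 3 * C * L / y := by
    have : C / w ≤ 2 * C / y := by
      calc C / w = C * (1 / w) := by ring
        _ ≤ C * ((1 + 2 * δ) / y) := by gcongr
        _ ≤ C * (2 / y) := by gcongr; linarith
        _ = _ := by ring
    calc L * (C / w + C / y) ≤ L * (2 * C / y + C / y) := by gcongr
      _ = _ := by ring
  have hfin : L ^ 3 * ∑ p ∈ S, 1 / (p : ℝ) ^ 2 ≤ (L ^ 2 + 8 * L + 3 * C * L) / y := by
    have h1 : (1 + 2 * δ) / y * (L ^ 2 + 3 * L + 2) ≤ (L ^ 2 + 8 * L) / y := by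
      rw [div_mul_eq_mul_div]
      gcongr
      have : δ * L ^ 2 = L := by rw [sq, ← mul_assoc, hδL, one_mul]
      nlinarith
    rw [add_div]
    linarith
  rw [le_div_iff₀ (by positivity)]
  have hcalc : L ^ 2 * ((∑ p ∈ S, 1 / (p : ℝ) ^ 2) * (y * L)) ≤ L ^ 2 * (1 + (8 + 3 * C) / L) := by
    rw [le_div_iff₀ hy0] at hfin
    have : L ^ 2 * (1 + (8 + 3 * C) / L) = L ^ 2 + 8 * L + 3 * C * L := by field_simp; ring
    rw [this]
    linarith
  exact le_of_mul_le_mul_left hcalc (by positivity)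

lemma Nat.exists_update_of_mem_finMulAntidiag_mul {l m p : ℕ} (hp : p.Prime) {u : Fin l → ℕ}
    (hu : u ∈ Nat.finMulAntidiag l (p * m)) :
    ∃ i, ∃ v ∈ Nat.finMulAntidiag l m, u = Function.update v i (p * v i) := by
  obtain ⟨hprod, hne⟩ := Nat.mem_finMulAntidiag.mp hu
  obtain ⟨i, -, c, hc⟩ := hp.prime.exists_mem_finset_dvd (s := Finset.univ) (f := u)
    (hprod ▸ dvd_mul_right p m)
  refine ⟨i, Function.update u i c, ?_, ?_⟩
  · refine Nat.mem_finMulAntidiag.mpr ⟨?_, right_ne_zero_of_mul hne⟩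
    refine Nat.eq_of_mul_eq_mul_left hp.pos ?_
    rw [← hprod, Finset.prod_update_of_mem (Finset.mem_univ i), ← mul_assoc, ← hc,
      Finset.sdiff_singleton_eq_erase, Finset.mul_prod_erase _ _ (Finset.mem_univ i)]
  · simp [← hc]

lemma Nat.card_finMulAntidiag_mul_prime_le {l m p : ℕ} (hp : p.Prime) :
    (Nat.finMulAntidiag l (p * m)).card ≤ l * (Nat.finMulAntidiag l m).card := by
  have hsub : Nat.finMulAntidiag l (p * m) ⊆ (Finset.univ : Finset (Fin l)).biUnion fun i =>
      (Nat.finMulAntidiag l m).image fun v => Function.update v i (p * v i) := by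
    intro u hu
    obtain ⟨i, v, hv, rfl⟩ := Nat.exists_update_of_mem_finMulAntidiag_mul hp hu
    exact Finset.mem_biUnion.mpr ⟨i, Finset.mem_univ i, Finset.mem_image_of_mem _ hv⟩
  calc _ ≤ _ := Finset.card_le_card hsub
    _ ≤ (Finset.univ : Finset (Fin l)).card * (Nat.finMulAntidiag l m).card :=
        Finset.card_biUnion_le_card_mul _ _ _ fun i _ => Finset.card_image_le
    _ = _ := by simp

lemma Nat.card_finMulAntidiag_le_pow {l m : ℕ} (hm : m ≠ 0) :
    (Nat.finMulAntidiag l m).card ≤ l ^ ArithmeticFunction.cardFactors m := by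
  induction m using induction_on_primes with
  | zero => exact absurd rfl hm
  | one => simp [Nat.finMulAntidiag_one]
  | prime_mul p m hp ih =>
    have hm' : m ≠ 0 := right_ne_zero_of_mul hm
    rw [ArithmeticFunction.cardFactors_mul hp.ne_zero hm',
      ArithmeticFunction.cardFactors_apply_prime hp, pow_add, pow_one]
    exact (Nat.card_finMulAntidiag_mul_prime_le hp).trans (Nat.mul_le_mul_left l (ih hm'))

/-- Ordered factorizations of `m` into `d` factors, each at least `2`. -/
noncomputable def Nat.properFactorizations (d m : ℕ) : Finset (Fin d → ℕ) :=
  (Nat.finMulAntidiag d m).filter fun u => ∀ i, 2 ≤ u i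

lemma Nat.card_properFactorizations_mul_prime_le {d m p : ℕ} (hp : p.Prime) :
    (Nat.properFactorizations (d + 1) (p * m)).card ≤
      (d + 1) * ((Nat.properFactorizations (d + 1) m).card +
        (Nat.properFactorizations d m).card) := by
  have hsub : Nat.properFactorizations (d + 1) (p * m) ⊆
      (Finset.univ : Finset (Fin (d + 1))).biUnion fun i =>
        ((Nat.properFactorizations (d + 1) m).image fun v => Function.update v i (p * v i)) ∪
        ((Nat.properFactorizations d m).image fun v => Fin.insertNth i p v) := by
    intro u hu
    obtain ⟨hu, hu2⟩ := Finset.mem_filter.mp hu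
    obtain ⟨i, v, hv, rfl⟩ := Nat.exists_update_of_mem_finMulAntidiag_mul hp hu
    obtain ⟨hprod, hne⟩ := Nat.mem_finMulAntidiag.mp hv
    refine Finset.mem_biUnion.mpr ⟨i, Finset.mem_univ i, Finset.mem_union.mpr ?_⟩
    have hj : ∀ j, j ≠ i → 2 ≤ v j := fun j hj => by simpa [hj] using hu2 j
    have hvi : v i ≠ 0 := Nat.ne_zero_of_mem_finMulAntidiag hv i
    rcases (show v i = 1 ∨ 2 ≤ v i by omega) with h1 | h2
    · right
      refine Finset.mem_image.mpr ⟨fun j => v (i.succAbove j), ?_, ?_⟩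
      · refine Finset.mem_filter.mpr ⟨Nat.mem_finMulAntidiag.mpr ⟨?_, hne⟩, fun j =>
          hj _ (Fin.succAbove_ne i j)⟩
        rw [← hprod, Fin.prod_univ_succAbove v i, h1, one_mul]
      · ext j
        rcases Fin.eq_self_or_eq_succAbove i j with rfl | ⟨j, rfl⟩
        · simp [h1]
        · simp
    · left
      refine Finset.mem_image_of_mem _ (Finset.mem_filter.mpr ⟨hv, fun j => ?_⟩)
      by_cases h : j = i
      · exact h ▸ h2
      · exact hj j h
  calc _ ≤ _ := Finset.card_le_card hsub
    _ ≤ (Finset.univ : Finset (Fin (d + 1))).card * ((Nat.properFactorizations (d + 1) m).card +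
        (Nat.properFactorizations d m).card) :=
        Finset.card_biUnion_le_card_mul _ _ _ fun i _ => (Finset.card_union_le _ _).trans
          (add_le_add Finset.card_image_le Finset.card_image_le)
    _ = _ := by simp

lemma Nat.card_properFactorizations_mul_pow_le {K m : ℕ} (hm : m ≠ 0) {d : ℕ} (hd : d ≤ K) :
    (Nat.properFactorizations d m).card * K ^ d ≤
      d.factorial * (ArithmeticFunction.cardFactors m).choose d *
        K ^ ArithmeticFunction.cardFactors m := by
  induction m using induction_on_primes generalizing d with
  | zero => exact absurd rfl hm
  | one =>
    cases d with
    | zero => simp [Nat.properFactorizations, Nat.finMulAntidiag_one]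
    | succ d =>
      have : Nat.properFactorizations (d + 1) 1 = ∅ := by
        rw [Nat.properFactorizations, Nat.finMulAntidiag_one, Finset.filter_singleton]
        simp
      simp [this]
  | prime_mul p m hp ih =>
    have hm' : m ≠ 0 := right_ne_zero_of_mul hm
    rw [ArithmeticFunction.cardFactors_mul hp.ne_zero hm',
      ArithmeticFunction.cardFactors_apply_prime hp, add_comm 1]
    set w := ArithmeticFunction.cardFactors m with hw
    cases d with
    | zero =>
      have : Nat.properFactorizations 0 (p * m) = ∅ := by
        rw [Nat.properFactorizations, Nat.finMulAntidiag_zero_left, Finset.filter_empty]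
        intro h
        exact hp.ne_one (Nat.eq_one_of_mul_eq_one_right h)
      simp [this]
    | succ d =>
      have h1 := ih hm' hd
      have h2 := ih hm' (d := d) (by omega)
      calc _ ≤ (d + 1) * ((Nat.properFactorizations (d + 1) m).card +
              (Nat.properFactorizations d m).card) * K ^ (d + 1) :=
            Nat.mul_le_mul_right _ (Nat.card_properFactorizations_mul_prime_le hp)
        _ = (d + 1) * ((Nat.properFactorizations (d + 1) m).card * K ^ (d + 1)) +
              (d + 1) * K * ((Nat.properFactorizations d m).card * K ^ d) := by ring
        _ ≤ K * ((d + 1).factorial * w.choose (d + 1) * K ^ w) +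
              (d + 1) * K * (d.factorial * w.choose d * K ^ w) := by gcongr
        _ = _ := by
            rw [Nat.choose_succ_succ, Nat.factorial_succ, pow_succ]
            ring

lemma DirichletCharacter.sum_mul_conj_eq {q : ℕ} [NeZero q] (a b : ZMod q) :
    ∑ χ : DirichletCharacter ℂ q, χ a * (starRingEnd ℂ) (χ b) =
      if b = a ∧ IsUnit b then (q.totient : ℂ) else 0 := by
  by_cases hb : IsUnit b
  · have h := DirichletCharacter.sum_char_inv_mul_char_eq ℂ hb a
    simp only [hb, and_true]
    rw [← h]
    refine Finset.sum_congr rfl fun χ _ => ?_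
    have : (starRingEnd ℂ) (χ b) = χ b⁻¹ := by
      obtain ⟨b, rfl⟩ := hb
      rw [starRingEnd_apply, ← MulChar.star_apply, MulChar.star_eq_inv, MulChar.inv_apply,
        Ring.inverse_unit, ZMod.inv_coe_unit]
    rw [this, mul_comm]
  · simp only [hb, and_false, if_false]
    refine Finset.sum_eq_zero fun χ _ => ?_
    rw [MulChar.map_nonunit χ hb]
    simp

lemma sum_norm_charSum_pow_le {q : ℕ} [NeZero q] {B : Finset ℕ} {l : ℕ}
    (hB : ∀ u ∈ Fintype.piFinset fun _ : Fin l => B, ∏ i, u i < q) (c : ℕ → ℂ)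
    (hc : ∀ n ∈ B, ‖c n‖ ≤ 1 / n) :
    ∑ χ : DirichletCharacter ℂ q, ‖∑ n ∈ B, c n * χ (n : ZMod q)‖ ^ (2 * l) ≤
      q.totient * ∑ u ∈ Fintype.piFinset fun _ : Fin l => B,
        (((Fintype.piFinset fun _ : Fin l => B).filter fun v => ∏ i, v i = ∏ i, u i).card : ℝ) /
          ((∏ i, u i : ℕ) : ℝ) ^ 2 := by
  set W := Fintype.piFinset fun _ : Fin l => B with hW
  set D : (Fin l → ℕ) → ℂ := fun u => ∏ i, c (u i) with hD
  have hDle : ∀ u ∈ W, ‖D u‖ ≤ 1 / ((∏ i, u i : ℕ) : ℝ) := by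
    intro u hu
    rw [hD, norm_prod, Nat.cast_prod, one_div, ← Finset.prod_inv_distrib]
    refine Finset.prod_le_prod (fun _ _ => norm_nonneg _) fun i _ => ?_
    rw [← one_div]
    exact hc _ (Fintype.mem_piFinset.mp hu i)
  have hpow : ∀ χ : DirichletCharacter ℂ q, (∑ n ∈ B, c n * χ (n : ZMod q)) ^ l =
      ∑ u ∈ W, D u * χ ((∏ i, u i : ℕ) : ZMod q) := by
    intro χ
    rw [Finset.sum_pow']
    refine Finset.sum_congr rfl fun u _ => ?_
    rw [Finset.prod_mul_distrib, Nat.cast_prod, map_prod]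
  have hexp : ((∑ χ : DirichletCharacter ℂ q, ‖∑ n ∈ B, c n * χ (n : ZMod q)‖ ^ (2 * l) : ℝ) : ℂ) =
      ∑ u ∈ W, ∑ v ∈ W, D u * (starRingEnd ℂ) (D v) *
        ∑ χ : DirichletCharacter ℂ q, χ ((∏ i, u i : ℕ) : ZMod q) *
          (starRingEnd ℂ) (χ ((∏ i, v i : ℕ) : ZMod q)) := by
    have h1 : ∀ χ : DirichletCharacter ℂ q,
        ((‖∑ n ∈ B, c n * χ (n : ZMod q)‖ ^ (2 * l) : ℝ) : ℂ) =
        ∑ u ∈ W, ∑ v ∈ W, D u * (starRingEnd ℂ) (D v) * (χ ((∏ i, u i : ℕ) : ZMod q) *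
          (starRingEnd ℂ) (χ ((∏ i, v i : ℕ) : ZMod q))) := by
      intro χ
      rw [mul_comm 2 l, pow_mul, ← norm_pow, Complex.ofReal_pow, ← Complex.mul_conj', hpow,
        map_sum, Finset.sum_mul_sum]
      refine Finset.sum_congr rfl fun u _ => Finset.sum_congr rfl fun v _ => ?_
      rw [map_mul]
      ring
    rw [Complex.ofReal_sum, Finset.sum_congr rfl fun χ _ => h1 χ, Finset.sum_comm]
    refine Finset.sum_congr rfl fun u _ => ?_
    rw [Finset.sum_comm]
    refine Finset.sum_congr rfl fun v _ => ?_
    rw [Finset.mul_sum]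
  have hnn : 0 ≤ ∑ χ : DirichletCharacter ℂ q, ‖∑ n ∈ B, c n * χ (n : ZMod q)‖ ^ (2 * l) :=
    Finset.sum_nonneg fun _ _ => by positivity
  rw [← Real.norm_of_nonneg hnn, ← Complex.norm_real, hexp, Finset.mul_sum]
  refine (norm_sum_le _ _).trans (Finset.sum_le_sum fun u hu => ?_)
  refine (norm_sum_le _ _).trans ?_
  have hterm : ∀ v ∈ W, ‖D u * (starRingEnd ℂ) (D v) *
        ∑ χ : DirichletCharacter ℂ q, χ ((∏ i, u i : ℕ) : ZMod q) *
          (starRingEnd ℂ) (χ ((∏ i, v i : ℕ) : ZMod q))‖ ≤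
      if ∏ i, v i = ∏ i, u i then (q.totient : ℝ) / ((∏ i, u i : ℕ) : ℝ) ^ 2 else 0 := by
    intro v hv
    rw [DirichletCharacter.sum_mul_conj_eq]
    have hiff : ((∏ i, v i : ℕ) : ZMod q) = ((∏ i, u i : ℕ) : ZMod q) → ∏ i, v i = ∏ i, u i := by
      intro h
      rw [ZMod.natCast_eq_natCast_iff'] at h
      rwa [Nat.mod_eq_of_lt (hB v hv), Nat.mod_eq_of_lt (hB u hu)] at h
    have hq : (0 : ℝ) ≤ (q.totient : ℝ) / ((∏ i, u i : ℕ) : ℝ) ^ 2 := by positivity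
    split_ifs with h1 h2 h2
    · rw [norm_mul, norm_mul, RCLike.norm_conj, Complex.norm_natCast]
      have h3 := hDle u hu
      have h4 := hDle v hv
      rw [h2] at h4
      calc ‖D u‖ * ‖D v‖ * q.totient ≤ 1 / ((∏ i, u i : ℕ) : ℝ) * (1 / ((∏ i, u i : ℕ) : ℝ)) *
            q.totient := by gcongr
        _ = _ := by ring
    · exact absurd (hiff h1.1) h2
    · simpa using hq
    · simp
  refine (Finset.sum_le_sum hterm).trans (le_of_eq ?_)
  rw [← Finset.sum_filter, Finset.sum_const, nsmul_eq_mul]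
  ring

lemma cardFactors_prod_univ {l : ℕ} {u : Fin l → ℕ} (hu : ∀ i, u i ≠ 0) :
    ArithmeticFunction.cardFactors (∏ i, u i) = ∑ i, ArithmeticFunction.cardFactors (u i) := by
  induction l with
  | zero => simp
  | succ l ih =>
    rw [Fin.prod_univ_succ, Fin.sum_univ_succ, ArithmeticFunction.cardFactors_mul (hu 0)
      (Finset.prod_ne_zero_iff.mpr fun i _ => hu i.succ), ih fun i => hu i.succ]

lemma sum_card_div_sq_le {B : Finset ℕ} {l : ℕ} {K : ℝ} {g : ℕ → ℝ}
    (h : ∀ u ∈ Fintype.piFinset fun _ : Fin l => B,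
      (((Fintype.piFinset fun _ : Fin l => B).filter fun v => ∏ i, v i = ∏ i, u i).card : ℝ) ≤
        K * ∏ i, g (u i)) :
    ∑ u ∈ Fintype.piFinset fun _ : Fin l => B,
        (((Fintype.piFinset fun _ : Fin l => B).filter fun v => ∏ i, v i = ∏ i, u i).card : ℝ) /
          ((∏ i, u i : ℕ) : ℝ) ^ 2 ≤ K * (∑ n ∈ B, g n / (n : ℝ) ^ 2) ^ l := by
  rw [Finset.sum_pow', Finset.mul_sum]
  refine Finset.sum_le_sum fun u hu => ?_
  rw [Finset.prod_div_distrib, Finset.prod_pow, Nat.cast_prod, ← mul_div_assoc]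
  gcongr
  exact h u hu

lemma card_filter_prod_eq_le_pow {B : Finset ℕ} {l : ℕ} (hB : ∀ n ∈ B, n ≠ 0) {u : Fin l → ℕ}
    (hu : u ∈ Fintype.piFinset fun _ : Fin l => B) :
    (((Fintype.piFinset fun _ : Fin l => B).filter fun v => ∏ i, v i = ∏ i, u i).card : ℝ) ≤
      1 * ∏ i, (l : ℝ) ^ ArithmeticFunction.cardFactors (u i) := by
  have hu0 : ∀ i, u i ≠ 0 := fun i => hB _ (Fintype.mem_piFinset.mp hu i)
  have hne : ∏ i, u i ≠ 0 := Finset.prod_ne_zero_iff.mpr fun i _ => hu0 i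
  rw [one_mul, Finset.prod_pow_eq_pow_sum, ← cardFactors_prod_univ hu0]
  have hsub : ((Fintype.piFinset fun _ : Fin l => B).filter fun v => ∏ i, v i = ∏ i, u i) ⊆
      Nat.finMulAntidiag l (∏ i, u i) := fun v hv =>
    Nat.mem_finMulAntidiag.mpr ⟨(Finset.mem_filter.mp hv).2, hne⟩
  exact_mod_cast (Finset.card_le_card hsub).trans (Nat.card_finMulAntidiag_le_pow hne)

lemma card_filter_prod_eq_le_factorial_mul {B : Finset ℕ} {k R : ℕ} (hk : 0 < k)
    (hB : ∀ n ∈ B, 2 ≤ n) (hR : ∀ n ∈ B, ArithmeticFunction.cardFactors n ≤ R) {T : ℝ}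
    (hT : 0 < T) {u : Fin k → ℕ} (hu : u ∈ Fintype.piFinset fun _ : Fin k => B) :
    (((Fintype.piFinset fun _ : Fin k => B).filter fun v => ∏ i, v i = ∏ i, u i).card : ℝ) ≤
      k.factorial * Real.exp (R * k ^ 2 / T) *
        ∏ i, T ^ (ArithmeticFunction.cardFactors (u i) - 1) := by
  have huB : ∀ i, u i ∈ B := Fintype.mem_piFinset.mp hu
  have hu0 : ∀ i, u i ≠ 0 := fun i => by have := hB _ (huB i); omega
  have hne : ∏ i, u i ≠ 0 := Finset.prod_ne_zero_iff.mpr fun i _ => hu0 i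
  have hΩ : ∀ i, 1 ≤ ArithmeticFunction.cardFactors (u i) := fun i =>
    Nat.one_le_iff_ne_zero.mpr fun h => by
      rcases ArithmeticFunction.cardFactors_eq_zero_iff_eq_zero_or_one.mp h with h | h <;>
      have := hB _ (huB i) <;> omega
  have hsub : ((Fintype.piFinset fun _ : Fin k => B).filter fun v => ∏ i, v i = ∏ i, u i) ⊆
      Nat.properFactorizations k (∏ i, u i) := fun v hv => by
    obtain ⟨hv, hprod⟩ := Finset.mem_filter.mp hv
    exact Finset.mem_filter.mpr ⟨Nat.mem_finMulAntidiag.mpr ⟨hprod, hne⟩,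
      fun i => hB _ (Fintype.mem_piFinset.mp hv i)⟩
  have hcard := Finset.card_le_card hsub
  have hD := Nat.card_properFactorizations_mul_pow_le hne (le_refl k)
  set w := ArithmeticFunction.cardFactors (∏ i, u i) with hw
  have hwsum : w = ∑ i, ArithmeticFunction.cardFactors (u i) := cardFactors_prod_univ hu0
  obtain ⟨r, hr⟩ : ∃ r, r = ∑ i, (ArithmeticFunction.cardFactors (u i) - 1) := ⟨_, rfl⟩
  have hwr : w = r + k := by
    have : ∑ i : Fin k, ((ArithmeticFunction.cardFactors (u i) - 1) + 1) = r + k := by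
      rw [Finset.sum_add_distrib, ← hr]; simp
    rw [hwsum, ← this]
    exact Finset.sum_congr rfl fun i _ => (Nat.sub_add_cancel (hΩ i)).symm
  have hwR : w ≤ R * k := by
    rw [hwsum]
    calc _ ≤ ∑ _i : Fin k, R := Finset.sum_le_sum fun i _ => hR _ (huB i)
      _ = R * k := by simp [mul_comm]
  rw [Finset.prod_pow_eq_pow_sum, ← hr]
  have hk0 : (0 : ℝ) < k := by exact_mod_cast hk
  have h1 : ((Nat.properFactorizations k (∏ i, u i)).card : ℝ) ≤
      k.factorial * w.choose k * k ^ r := by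
    have h2 : ((Nat.properFactorizations k (∏ i, u i)).card : ℝ) * k ^ k ≤
        k.factorial * w.choose k * k ^ w := by exact_mod_cast hD
    rw [hwr, pow_add, ← mul_assoc] at h2
    rw [← hwr] at h2
    exact le_of_mul_le_mul_right h2 (by positivity)
  have h3 : (w.choose k : ℝ) ≤ (w : ℝ) ^ r / r.factorial := by
    have h4 : w.choose k = w.choose r := by
      rw [hwr]; exact Nat.choose_symm_of_eq_add (by ring)
    rw [h4]
    exact Nat.choose_le_pow_div r w
  have h5 : (w : ℝ) ^ r / r.factorial * k ^ r ≤ T ^ r * Real.exp (R * k ^ 2 / T) := by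
    have h6 : ((R * k ^ 2 / T : ℝ)) ^ r / r.factorial ≤ Real.exp (R * k ^ 2 / T) :=
      Real.pow_div_factorial_le_exp _ (by positivity) r
    have h7 : (w : ℝ) ≤ R * k := by exact_mod_cast hwR
    calc (w : ℝ) ^ r / r.factorial * k ^ r ≤ (R * k : ℝ) ^ r / r.factorial * k ^ r := by gcongr
      _ = T ^ r * ((R * k ^ 2 / T : ℝ) ^ r / r.factorial) := by
          rw [div_pow, mul_pow, mul_pow]
          field_simp
          ring
      _ ≤ _ := by gcongr
  calc _ ≤ ((Nat.properFactorizations k (∏ i, u i)).card : ℝ) := by exact_mod_cast hcard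
    _ ≤ k.factorial * w.choose k * k ^ r := h1
    _ ≤ k.factorial * ((w : ℝ) ^ r / r.factorial) * k ^ r := by gcongr
    _ = k.factorial * ((w : ℝ) ^ r / r.factorial * k ^ r) := by ring
    _ ≤ k.factorial * (T ^ r * Real.exp (R * k ^ 2 / T)) := by gcongr
    _ = _ := by ring

lemma sum_pow_cardFactors_sub_one_div_sq_le {y T P : ℝ} (hT : 0 < T) (hTP : T * P < 1)
    (hprime : ∀ S : Finset ℕ, (∀ p ∈ S, p.Prime ∧ y < p) → ∑ p ∈ S, 1 / (p : ℝ) ^ 2 ≤ P)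
    {B : Finset ℕ} (hB : ∀ n ∈ B, 2 ≤ n ∧ ∀ p : ℕ, p.Prime → p ∣ n → y < p) :
    ∑ n ∈ B, T ^ (ArithmeticFunction.cardFactors n - 1) / (n : ℝ) ^ 2 ≤ P / (1 - T * P) := by
  set N := B.sup id with hN
  set Q := (Finset.Icc 2 N).filter fun n => ∀ p : ℕ, p.Prime → p ∣ n → y < p with hQ
  set S := Q.filter Nat.Prime with hS
  set g : ℕ → ℝ := fun n => T ^ ArithmeticFunction.cardFactors n / (n : ℝ) ^ 2 with hg
  have hg0 : ∀ n, 0 ≤ g n := fun n => by positivity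
  have hg1 : g 1 = 1 := by simp [hg]
  have hgmul : ∀ m n : ℕ, m ≠ 0 → n ≠ 0 → g (m * n) = g m * g n := by
    intro m n hm hn
    simp only [hg]
    rw [ArithmeticFunction.cardFactors_mul hm hn, pow_add, Nat.cast_mul, mul_pow, mul_div_mul_comm]
  have hSP : ∑ p ∈ S, g p ≤ T * P := by
    have h1 : ∀ p ∈ S, g p = T * (1 / (p : ℝ) ^ 2) := by
      intro p hp
      simp only [hg]
      rw [ArithmeticFunction.cardFactors_apply_prime (Finset.mem_filter.mp hp).2, pow_one]
      ring
    rw [Finset.sum_congr rfl h1, ← Finset.mul_sum]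
    refine mul_le_mul_of_nonneg_left (hprime S fun p hp => ?_) hT.le
    obtain ⟨hp1, hp2⟩ := Finset.mem_filter.mp hp
    exact ⟨hp2, (Finset.mem_filter.mp hp1).2 p hp2 dvd_rfl⟩
  have hrec : ∑ n ∈ Q, g n ≤ (∑ p ∈ S, g p) * (1 + ∑ n ∈ Q, g n) := by
    have h1Q : 1 ∉ Q := by simp [hQ]
    rw [← hg1, ← Finset.sum_insert h1Q, Finset.sum_mul_sum, ← Finset.sum_product']
    have hmem : ∀ n ∈ Q, (n.minFac, n / n.minFac) ∈ S ×ˢ insert 1 Q := by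
      intro n hn
      obtain ⟨hn1, hn2⟩ := Finset.mem_filter.mp hn
      rw [Finset.mem_Icc] at hn1
      have hp : n.minFac.Prime := Nat.minFac_prime (by omega)
      have hple : n.minFac ≤ n := Nat.minFac_le (by omega)
      refine Finset.mem_product.mpr ⟨?_, ?_⟩
      · refine Finset.mem_filter.mpr ⟨Finset.mem_filter.mpr ⟨Finset.mem_Icc.mpr
          ⟨hp.two_le, by simp only; omega⟩, fun p hp' hd => hn2 p hp' (hd.trans n.minFac_dvd)⟩, hp⟩
      · have hpos : 0 < n / n.minFac := Nat.div_pos hple hp.pos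
        rcases eq_or_ne (n / n.minFac) 1 with h | h
        · exact Finset.mem_insert.mpr (Or.inl h)
        · refine Finset.mem_insert_of_mem (Finset.mem_filter.mpr ⟨Finset.mem_Icc.mpr
            ⟨by simp only; omega, (Nat.div_le_self _ _).trans hn1.2⟩,
            fun p hp' hd => hn2 p hp' (hd.trans (Nat.div_dvd_of_dvd n.minFac_dvd))⟩)
    have hval : ∀ n ∈ Q, g n = g (n.minFac) * g (n / n.minFac) := by
      intro n hn
      obtain ⟨hn1, -⟩ := Finset.mem_filter.mp hn
      rw [Finset.mem_Icc] at hn1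
      have hp : n.minFac.Prime := Nat.minFac_prime (by omega)
      have hple : n.minFac ≤ n := Nat.minFac_le (by omega)
      rw [← hgmul _ _ hp.ne_zero (Nat.div_pos hple hp.pos).ne', Nat.mul_div_cancel' n.minFac_dvd]
    have hinj : Set.InjOn (fun n : ℕ => (n.minFac, n / n.minFac)) Q := by
      intro a _ b _ hab
      simp only [Prod.mk.injEq] at hab
      rw [← Nat.mul_div_cancel' a.minFac_dvd, hab.2, hab.1, Nat.mul_div_cancel' b.minFac_dvd]
    rw [Finset.sum_congr rfl hval,
      ← Finset.sum_image (f := fun x : ℕ × ℕ => g x.1 * g x.2) hinj]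
    refine Finset.sum_le_sum_of_subset_of_nonneg (fun x hx => ?_) fun x _ _ =>
      mul_nonneg (hg0 _) (hg0 _)
    obtain ⟨n, hn, rfl⟩ := Finset.mem_image.mp hx
    exact hmem n hn
  have hQ0 : 0 ≤ ∑ n ∈ Q, g n := Finset.sum_nonneg fun n _ => hg0 n
  have hBQ : B ⊆ Q := fun n hn => Finset.mem_filter.mpr
    ⟨Finset.mem_Icc.mpr ⟨(hB n hn).1, Finset.le_sup (f := id) hn⟩, (hB n hn).2⟩
  have hQle : ∑ n ∈ Q, g n ≤ T * P / (1 - T * P) := by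
    rw [le_div_iff₀ (by linarith)]
    nlinarith
  have hfin : T * ∑ n ∈ B, T ^ (ArithmeticFunction.cardFactors n - 1) / (n : ℝ) ^ 2 ≤
      ∑ n ∈ Q, g n := by
    rw [Finset.mul_sum]
    refine (Finset.sum_le_sum fun n hn => ?_).trans
      (Finset.sum_le_sum_of_subset_of_nonneg hBQ fun n _ _ => hg0 n)
    have h1 : 1 ≤ ArithmeticFunction.cardFactors n := Nat.one_le_iff_ne_zero.mpr fun h => by
      rcases ArithmeticFunction.cardFactors_eq_zero_iff_eq_zero_or_one.mp h with h | h <;>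
      have := (hB n hn).1 <;> omega
    simp only [hg]
    rw [← mul_div_assoc, mul_pow_sub_one (by omega)]
  refine le_of_mul_le_mul_left ?_ hT
  rw [← mul_div_assoc]
  exact hfin.trans hQle

lemma pow_cardFactors_le {y : ℝ} (hy : 0 ≤ y) {n : ℕ} (hn : n ≠ 0)
    (h : ∀ p : ℕ, p.Prime → p ∣ n → y < p) :
    y ^ ArithmeticFunction.cardFactors n ≤ n := by
  induction n using induction_on_primes with
  | zero => exact absurd rfl hn
  | one => simp
  | prime_mul p a hp ih =>
    have ha : a ≠ 0 := right_ne_zero_of_mul hn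
    rw [ArithmeticFunction.cardFactors_mul hp.ne_zero ha,
      ArithmeticFunction.cardFactors_apply_prime hp, pow_add, pow_one, Nat.cast_mul]
    exact mul_le_mul (h p hp (dvd_mul_right p a)).le
      (ih ha fun r hr hd => h r hr (hd.mul_left p)) (by positivity) (by positivity)

lemma cardFactors_mul_log_le {y : ℝ} (hy : 0 < y) {n : ℕ} (hn : n ≠ 0)
    (h : ∀ p : ℕ, p.Prime → p ∣ n → y < p) :
    ArithmeticFunction.cardFactors n * Real.log y ≤ Real.log n := by
  rw [← Real.log_pow]
  exact Real.log_le_log (by positivity) (pow_cardFactors_le hy.le hn h)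

lemma factorial_le_mul_div_exp_pow {k : ℕ} (hk : 0 < k) :
    (k.factorial : ℝ) ≤ Real.exp (1 + Real.log k) * (k / Real.exp 1) ^ k := by
  induction k, hk using Nat.le_induction with
  | base => simp
  | succ k hk ih =>
    have hk0 : (0 : ℝ) < k := by exact_mod_cast hk
    have h1 : Real.exp 1 * (k : ℝ) ^ (k + 1) ≤ (k + 1 : ℝ) ^ (k + 1) := by
      have h2 : Real.exp (k + 1)⁻¹ ≤ (k + 1) / k := by
        have h3 := Real.one_sub_inv_le_log_of_pos (x := ((k : ℝ) + 1) / k) (by positivity)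
        rw [← Real.le_log_iff_exp_le (by positivity)]
        refine le_trans (le_of_eq ?_) h3
        field_simp
        ring
      have h4 := pow_le_pow_left₀ (Real.exp_nonneg _) h2 (k + 1)
      rwa [← Real.exp_nat_mul, div_pow, le_div_iff₀ (by positivity), Nat.cast_add_one,
        mul_inv_cancel₀ (by positivity)] at h4
    rw [Nat.factorial_succ, Nat.cast_mul]
    rw [Real.exp_add, Real.exp_log hk0] at ih
    rw [Real.exp_add, Real.exp_log (by positivity)]
    push_cast
    rw [mul_assoc, mul_left_comm]
    refine mul_le_mul_of_nonneg_left (ih.trans ?_) (by positivity)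
    rw [mul_assoc]
    refine mul_le_mul_of_nonneg_left ?_ (Real.exp_nonneg _)
    rw [div_pow, div_pow, pow_succ (Real.exp 1), ← mul_div_assoc, div_le_div_iff₀ (by positivity)
      (by positivity)]
    calc _ = (Real.exp 1 * (k : ℝ) ^ (k + 1)) * Real.exp 1 ^ k := by ring
      _ ≤ _ := by gcongr

lemma sq_log_le_four_mul {x : ℝ} (hx : 1 ≤ x) : Real.log x ^ 2 ≤ 4 * x := by
  have h0 : 0 < x := by linarith
  have h1 : Real.log (√x) ≤ √x := (Real.log_le_sub_one_of_pos (by positivity)).trans (by linarith)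
  rw [Real.log_sqrt h0.le] at h1
  have h2 : 0 ≤ Real.log x := Real.log_nonneg hx
  nlinarith [Real.sq_sqrt h0.le, Real.sqrt_nonneg x]

lemma exists_sum_norm_charSum_small_le : ∃ C : ℝ, 0 < C ∧ ∀ (q k : ℕ) (y : ℝ), k ^ (200 * k) < q →
    1 ≤ Real.log k → (k : ℝ) * Real.log k ≤ y → Real.exp 4 ≤ y →
    ∀ B : Finset ℕ, (∀ n ∈ B, y < n ∧ n ≤ k ^ 200 ∧ ∀ p : ℕ, p.Prime → p ∣ n → y < p) →
    ∀ c : ℕ → ℂ, (∀ n ∈ B, ‖c n‖ ≤ 1 / n) →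
    ∑ χ : DirichletCharacter ℂ q, ‖∑ n ∈ B, c n * χ (n : ZMod q)‖ ^ (2 * k) ≤
      q.totient * (Real.exp (C * k / Real.log k) * (k : ℝ) ^ k /
        (Real.exp 1 * y * Real.log y) ^ k) := by
  obtain ⟨C, hC, hprime⟩ := exists_sum_prime_inv_sq_le
  refine ⟨400 * (1 + C) + C * 200 + 1 + 8, by positivity, ?_⟩
  intro q k y hq hL hy hy4 B hB c hc
  have hk1 : 1 < k := by
    by_contra! h
    interval_cases k <;> simp at hL <;> linarith
  have hk0 : (0 : ℝ) < k := by positivity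
  have : NeZero q := ⟨by omega⟩
  have hy0 : 0 < y := (Real.exp_pos 4).trans_le hy4
  have hly : 4 ≤ Real.log y := (Real.le_log_iff_exp_le hy0).mpr hy4
  set L := Real.log k with hLdef
  rcases B.eq_empty_or_nonempty with rfl | ⟨n₀, hn₀⟩
  · simp only [Finset.sum_empty, norm_zero]
    rw [zero_pow (by omega), Finset.sum_const_zero]
    positivity
  have hky : (k : ℝ) ≤ y := by nlinarith
  have hLy : L ≤ Real.log y := Real.log_le_log hk0 hky
  have hyL : Real.log y ≤ 200 * L := by
    have h1 : y ≤ (k : ℝ) ^ 200 := (hB n₀ hn₀).1.le.trans (by exact_mod_cast (hB n₀ hn₀).2.1)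
    have h2 := Real.log_le_log hy0 h1
    rwa [Real.log_pow] at h2
  have hB2 : ∀ n ∈ B, 2 ≤ n := fun n hn => by
    have : (k : ℝ) < n := hky.trans_lt (hB n hn).1
    have : k < n := by exact_mod_cast this
    omega
  have hR : ∀ n ∈ B, ArithmeticFunction.cardFactors n ≤ 200 := fun n hn => by
    have h1 := cardFactors_mul_log_le hy0 (by have := hB2 n hn; omega) (hB n hn).2.2
    have h2 : Real.log n ≤ 200 * L := by
      have h3 : (n : ℝ) ≤ (k : ℝ) ^ 200 := by exact_mod_cast (hB n hn).2.1
      have h4 := Real.log_le_log (by have := hB2 n hn; positivity) h3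
      rwa [Real.log_pow] at h4
    have h5 : (ArithmeticFunction.cardFactors n : ℝ) * L ≤ 200 * L :=
      le_trans (by gcongr) (h1.trans h2)
    exact_mod_cast le_of_mul_le_mul_right h5 (by linarith)
  have hprod : ∀ u ∈ Fintype.piFinset (fun _ : Fin k => B), ∏ i, u i < q := fun u hu => by
    refine lt_of_le_of_lt ?_ hq
    rw [pow_mul]
    refine (Finset.prod_le_pow_card _ _ _ fun i _ =>
      (hB _ (Fintype.mem_piFinset.mp hu i)).2.1).trans ?_
    simp
  set P := (1 + C / Real.log y) / (y * Real.log y) with hP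
  set T := k * L / (2 * (1 + C)) with hT
  have hT0 : 0 < T := by positivity
  have hTP : T * P ≤ 1 / (2 * L) := by
    have h1 : P ≤ (1 + C) / (k * L * L) := by
      rw [hP]
      gcongr
      exact div_le_self hC.le (by linarith)
    calc T * P ≤ T * ((1 + C) / (k * L * L)) := by gcongr
      _ = _ := by rw [hT]; field_simp
  have hTP2 : T * P ≤ 1 / 2 := hTP.trans (by gcongr; linarith)
  have hmain := (sum_norm_charSum_pow_le hprod c hc).trans (mul_le_mul_of_nonneg_left
    (sum_card_div_sq_le (g := fun n => T ^ (ArithmeticFunction.cardFactors n - 1)) fun u hu =>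
      card_filter_prod_eq_le_factorial_mul (by omega) hB2 hR hT0 hu)
    (Nat.cast_nonneg _))
  have hsum := sum_pow_cardFactors_sub_one_div_sq_le hT0 (by linarith) (hprime y hy4)
    (B := B) fun n hn => ⟨hB2 n hn, (hB n hn).2.2⟩
  refine hmain.trans (mul_le_mul_of_nonneg_left ?_ (Nat.cast_nonneg _))
  have hP0 : 0 ≤ P := by positivity
  have hbase : P / (1 - T * P) ≤ Real.exp (C / Real.log y + 1 / L) / (y * Real.log y) := by
    have h1 : 1 / (1 - T * P) ≤ Real.exp (1 / L) := by
      have h2 : 1 - T * P ≥ 1 - 1 / (2 * L) := by linarith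
      have hL2 : 1 / (2 * L) ≤ 1 / 2 := by gcongr; linarith
      have h3 : 1 / (1 - T * P) ≤ 1 + 1 / L := by
        rw [div_le_iff₀ (by linarith)]
        have h4 : 1 / L = 2 * (1 / (2 * L)) := by field_simp
        have h5 : 0 ≤ 1 / (2 * L) := by positivity
        rw [h4]
        nlinarith
      linarith [Real.add_one_le_exp (1 / L)]
    have h2 : 1 + C / Real.log y ≤ Real.exp (C / Real.log y) := by
      linarith [Real.add_one_le_exp (C / Real.log y)]
    rw [Real.exp_add]
    calc P / (1 - T * P) = (1 + C / Real.log y) * (1 / (1 - T * P)) / (y * Real.log y) := by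
          rw [hP]; ring
      _ ≤ _ := by
          have : 0 ≤ 1 / (1 - T * P) := by
            apply div_nonneg zero_le_one; linarith
          gcongr
  have hfac := factorial_le_mul_div_exp_pow (k := k) (by omega)
  have hsum0 : 0 ≤ ∑ n ∈ B, T ^ (ArithmeticFunction.cardFactors n - 1) / (n : ℝ) ^ 2 :=
    Finset.sum_nonneg fun n _ => by positivity
  have hexpo : (1 + L) + (200 : ℕ) * k ^ 2 / T + k * (C / Real.log y + 1 / L) ≤
      (400 * (1 + C) + C * 200 + 1 + 8) * k / L := by
    have h1 : (1 + L) ≤ 8 * k / L := by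
      rw [le_div_iff₀ (by linarith)]
      have := sq_log_le_four_mul (x := (k : ℝ)) (by exact_mod_cast hk1.le)
      nlinarith
    have h2 : ((200 : ℕ) : ℝ) * k ^ 2 / T = 400 * (1 + C) * k / L := by
      rw [hT]; push_cast; field_simp; ring
    have h3 : C / Real.log y ≤ C * 200 / L := by
      gcongr
      linarith
    have h4 : k * (C / Real.log y + 1 / L) ≤ k * (C * 200 / L + 1 / L) := by gcongr
    rw [h2]
    calc _ ≤ 8 * k / L + 400 * (1 + C) * k / L + k * (C * 200 / L + 1 / L) := by gcongr
      _ = _ := by ring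
  calc _ ≤ Real.exp (1 + L) * (k / Real.exp 1) ^ k * Real.exp ((200 : ℕ) * k ^ 2 / T) *
        (Real.exp (C / Real.log y + 1 / L) / (y * Real.log y)) ^ k := by
        gcongr
        exact hsum.trans hbase
    _ = Real.exp ((1 + L) + (200 : ℕ) * k ^ 2 / T + k * (C / Real.log y + 1 / L)) * (k : ℝ) ^ k /
        (Real.exp 1 * y * Real.log y) ^ k := by
        rw [Real.exp_add (1 + L + _), Real.exp_add (1 + L), Real.exp_nat_mul, div_pow, div_pow,
          mul_pow, mul_pow, mul_pow]
        field_simp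
    _ ≤ _ := by gcongr

lemma sum_one_div_le_one_add_log {B : Finset ℕ} {z : ℝ} (hz : 1 ≤ z)
    (hB : ∀ n ∈ B, 1 ≤ n ∧ (n : ℝ) ≤ z) : ∑ n ∈ B, 1 / (n : ℝ) ≤ 1 + Real.log z := by
  have hsub : B ⊆ Finset.Icc 1 ⌊z⌋₊ := fun n hn =>
    Finset.mem_Icc.mpr ⟨(hB n hn).1, Nat.le_floor (hB n hn).2⟩
  have h1 := harmonic_floor_le_one_add_log z hz
  rw [harmonic_eq_sum_Icc] at h1
  push_cast at h1
  refine le_trans ?_ h1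
  simp only [one_div]
  exact Finset.sum_le_sum_of_subset_of_nonneg hsub fun n _ _ => by positivity

lemma norm_charSum_le {q : ℕ} {B : Finset ℕ} {c : ℕ → ℂ} (hc : ∀ n ∈ B, ‖c n‖ ≤ 1 / n)
    (χ : DirichletCharacter ℂ q) :
    ‖∑ n ∈ B, c n * χ (n : ZMod q)‖ ≤ ∑ n ∈ B, 1 / (n : ℝ) := by
  refine (norm_sum_le _ _).trans (Finset.sum_le_sum fun n hn => ?_)
  rw [norm_mul]
  exact (mul_le_of_le_one_right (norm_nonneg _) (χ.norm_le_one _)).trans (hc n hn)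

lemma sum_norm_charSum_block_le {q k b : ℕ} {y W : ℝ} (hq : k ^ (400 * k) < q)
    (hL : 1 ≤ Real.log k) (hy : (k : ℝ) * Real.log k ≤ y) (hb : 200 ≤ b) (hbk : b ≤ k)
    {B : Finset ℕ}
    (hB : ∀ n ∈ B, k ^ b ≤ n ∧ n ≤ k ^ (b + 1) ∧ ∀ p : ℕ, p.Prime → p ∣ n → y < p)
    (hW : 1 ≤ W) (hBW : ∑ n ∈ B, 1 / (n : ℝ) ≤ W) {c : ℕ → ℂ}
    (hc : ∀ n ∈ B, ‖c n‖ ≤ 1 / n) :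
    ∑ χ : DirichletCharacter ℂ q, ‖∑ n ∈ B, c n * χ (n : ZMod q)‖ ^ (2 * k) ≤
      q.totient * (W ^ (2 * k) / Real.log k ^ (132 * k)) := by
  have hk0 : (0 : ℝ) < k := by have : 0 < k := by omega
                               exact_mod_cast this
  have : NeZero q := ⟨by omega⟩
  set L := Real.log k with hLdef
  set ℓ := Real.log L with hℓdef
  have hL0 : 0 < L := by linarith
  have hℓ0 : 0 ≤ ℓ := Real.log_nonneg hL
  have hℓL : 2 * ℓ ≤ L := by
    have h1 := Real.log_le_sub_one_of_pos (x := L / 2) (by linarith)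
    rw [Real.log_div (by positivity) (by norm_num)] at h1
    linarith [Real.log_two_lt_d9]
  have hy0 : 0 < y := (by positivity : 0 < (k : ℝ) * L).trans_le hy
  have hly : L + ℓ ≤ Real.log y := by
    rw [hℓdef, hLdef, ← Real.log_mul hk0.ne' (by positivity)]
    exact Real.log_le_log (by positivity) hy
  set l := 200 * k / b with hl
  have hlk : l ≤ k := Nat.div_le_of_le_mul (by nlinarith)
  have hlb : l * b ≤ 200 * k := Nat.div_mul_le_self _ _
  have hlb' : 199 * k ≤ l * b := by
    have := Nat.lt_div_mul_add (a := 200 * k) (b := b) (by omega)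
    rw [← hl] at this
    omega
  clear_value l
  clear hl
  have hn0 : ∀ n ∈ B, n ≠ 0 := fun n hn => by
    have h1 : 0 < k ^ b := pow_pos (by omega) b
    have := (hB n hn).1
    omega
  have hprod : ∀ u ∈ Fintype.piFinset (fun _ : Fin l => B), ∏ i, u i < q := fun u hu => by
    refine lt_of_le_of_lt ?_ hq
    refine (Finset.prod_le_pow_card _ _ _ fun i _ =>
      (hB _ (Fintype.mem_piFinset.mp hu i)).2.1).trans ?_
    rw [← pow_mul, Finset.card_univ, Fintype.card_fin]
    exact Nat.pow_le_pow_right (by omega) (by nlinarith)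
  have hmain := (sum_norm_charSum_pow_le hprod c hc).trans (mul_le_mul_of_nonneg_left
    (sum_card_div_sq_le (g := fun n => (l : ℝ) ^ ArithmeticFunction.cardFactors n) fun u hu =>
      card_filter_prod_eq_le_pow hn0 hu) (Nat.cast_nonneg _))
  have hterm : ∀ n ∈ B, (l : ℝ) ^ ArithmeticFunction.cardFactors n / (n : ℝ) ^ 2 ≤
      Real.exp (-(2 / 3 * b * ℓ)) * (1 / n) := by
    intro n hn
    have hnpos : (0 : ℝ) < n := by exact_mod_cast Nat.pos_of_ne_zero (hn0 n hn)
    set w := ArithmeticFunction.cardFactors n with hw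
    have h1 : (w : ℝ) * Real.log y ≤ Real.log n := cardFactors_mul_log_le hy0 (hn0 n hn) (hB n hn).2.2
    have h2 : b * L ≤ Real.log n := by
      rw [hLdef, ← Real.log_pow]
      exact Real.log_le_log (by positivity) (by exact_mod_cast (hB n hn).1)
    have h3 : (w : ℝ) * (L + ℓ) ≤ Real.log n := le_trans (by gcongr) h1
    have h4 : w * L ≤ Real.log n - 2 / 3 * b * ℓ := by
      have h5 : (w : ℝ) ≤ Real.log n / (L + ℓ) := (le_div_iff₀ (by linarith)).mpr h3
      have h6 : w * L ≤ Real.log n / (L + ℓ) * L := by gcongr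
      have h7 : Real.log n / (L + ℓ) * L = Real.log n - Real.log n * ℓ / (L + ℓ) := by
        field_simp; ring
      have h8 : 2 / 3 * b * ℓ ≤ Real.log n * ℓ / (L + ℓ) := by
        rw [le_div_iff₀ (by linarith)]
        have h9 : b * L * ℓ ≤ Real.log n * ℓ := by gcongr
        have h10 : (0 : ℝ) ≤ b * ℓ := by positivity
        nlinarith
      linarith
    have h5 : (l : ℝ) ^ w ≤ Real.exp (-(2 / 3 * b * ℓ)) * n := by
      calc (l : ℝ) ^ w ≤ (k : ℝ) ^ w := by gcongr
        _ = Real.exp (w * L) := by rw [Real.exp_nat_mul, hLdef, Real.exp_log hk0]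
        _ ≤ Real.exp (Real.log n - 2 / 3 * b * ℓ) := by gcongr
        _ = _ := by rw [sub_eq_neg_add, Real.exp_add, Real.exp_log hnpos]
    rw [div_le_iff₀ (by positivity)]
    refine h5.trans (le_of_eq ?_)
    field_simp
  have hsum : ∑ n ∈ B, (l : ℝ) ^ ArithmeticFunction.cardFactors n / (n : ℝ) ^ 2 ≤
      Real.exp (-(2 / 3 * b * ℓ)) * W := by
    refine (Finset.sum_le_sum hterm).trans ?_
    rw [← Finset.mul_sum]
    gcongr
  have hsum0 : 0 ≤ ∑ n ∈ B, (l : ℝ) ^ ArithmeticFunction.cardFactors n / (n : ℝ) ^ 2 :=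
    Finset.sum_nonneg fun n _ => by positivity
  have hexp : Real.exp (-(2 / 3 * b * ℓ)) ^ l ≤ 1 / L ^ (132 * k) := by
    have h1 : (199 * k : ℝ) ≤ l * b := by exact_mod_cast hlb'
    have h2 : L ^ (132 * k) = Real.exp ((132 * k : ℕ) * ℓ) := by
      rw [Real.exp_nat_mul, hℓdef, Real.exp_log hL0]
    rw [h2, one_div, ← Real.exp_neg, ← Real.exp_nat_mul]
    refine Real.exp_le_exp.mpr ?_
    push_cast
    have h3 : 199 * k * ℓ ≤ l * b * ℓ := by gcongr
    have h4 : 0 ≤ k * ℓ := by positivity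
    nlinarith
  have hpow : ∀ χ : DirichletCharacter ℂ q, ‖∑ n ∈ B, c n * χ (n : ZMod q)‖ ^ (2 * k) ≤
      W ^ (2 * (k - l)) * ‖∑ n ∈ B, c n * χ (n : ZMod q)‖ ^ (2 * l) := fun χ => by
    have h1 : 2 * k = 2 * (k - l) + 2 * l := by omega
    rw [h1, pow_add]
    gcongr
    exact (norm_charSum_le hc χ).trans hBW
  calc _ ≤ ∑ χ : DirichletCharacter ℂ q,
        W ^ (2 * (k - l)) * ‖∑ n ∈ B, c n * χ (n : ZMod q)‖ ^ (2 * l) :=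
        Finset.sum_le_sum fun χ _ => hpow χ
    _ = W ^ (2 * (k - l)) * ∑ χ : DirichletCharacter ℂ q,
        ‖∑ n ∈ B, c n * χ (n : ZMod q)‖ ^ (2 * l) := by rw [Finset.mul_sum]
    _ ≤ W ^ (2 * (k - l)) * (q.totient * (1 * (Real.exp (-(2 / 3 * b * ℓ)) * W) ^ l)) := by
        gcongr
        exact hmain.trans (by gcongr)
    _ = q.totient * (W ^ (2 * (k - l) + l) * Real.exp (-(2 / 3 * b * ℓ)) ^ l) := by
        rw [pow_add, mul_pow]; ring
    _ ≤ q.totient * (W ^ (2 * k) * (1 / L ^ (132 * k))) := by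
        gcongr
        omega
    _ = _ := by rw [mul_one_div]

lemma sum_norm_charSum_large_le {q k : ℕ} {y z : ℝ} (hq : k ^ (400 * k) < q)
    (hL : 3 ≤ Real.log k) (hy : (k : ℝ) * Real.log k ≤ y)
    (hz : z ≤ (k : ℝ) ^ Real.log (Real.log k)) {B : Finset ℕ}
    (hB : ∀ n ∈ B, k ^ 200 < n ∧ (n : ℝ) ≤ z ∧ ∀ p : ℕ, p.Prime → p ∣ n → y < p) {c : ℕ → ℂ}
    (hc : ∀ n ∈ B, ‖c n‖ ≤ 1 / n) :
    ∑ χ : DirichletCharacter ℂ q, ‖∑ n ∈ B, c n * χ (n : ZMod q)‖ ^ (2 * k) ≤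
      q.totient * (1 / Real.log k ^ (126 * k)) := by
  have hk1 : 1 < k := by
    by_contra! h
    interval_cases k <;> simp at hL <;> linarith
  have hk0 : (0 : ℝ) < k := by positivity
  have hlk : Real.log k ≤ k := (Real.log_le_sub_one_of_pos hk0).trans (by linarith)
  set L := Real.log k with hLdef
  set ℓ := Real.log L with hℓdef
  have hL0 : 0 < L := by linarith
  have hℓ1 : 1 ≤ ℓ := by
    rw [hℓdef, Real.le_log_iff_exp_le hL0]
    linarith [Real.exp_one_lt_d9]
  have hℓL : ℓ + 1 ≤ L := by linarith [Real.log_le_sub_one_of_pos hL0]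
  have hkz : (1 : ℝ) ≤ (k : ℝ) ^ ℓ := Real.one_le_rpow (by exact_mod_cast hk1.le) (by linarith)
  have hlogz : Real.log ((k : ℝ) ^ ℓ) = ℓ * L := Real.log_rpow hk0 _
  have hW : 1 + ℓ * L ≤ L ^ 2 := by nlinarith
  have hBz : ∀ n ∈ B, 1 ≤ n ∧ (n : ℝ) ≤ (k : ℝ) ^ ℓ := fun n hn =>
    ⟨by have := (hB n hn).1; omega, (hB n hn).2.1.trans hz⟩
  have hmaps : ∀ n ∈ B, Nat.log k n ∈ Finset.Icc 200 ⌊ℓ⌋₊ := fun n hn => by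
    have hn1 := (hBz n hn).1
    refine Finset.mem_Icc.mpr ⟨Nat.le_log_of_pow_le hk1 (hB n hn).1.le, Nat.le_floor ?_⟩
    have h1 : (k : ℝ) ^ Nat.log k n ≤ n := by exact_mod_cast Nat.pow_log_le_self k (by omega)
    have h2 : (k : ℝ) ^ (Nat.log k n : ℝ) ≤ (k : ℝ) ^ ℓ := by
      rw [Real.rpow_natCast]
      exact h1.trans (hBz n hn).2
    exact (Real.rpow_le_rpow_left_iff (by exact_mod_cast hk1)).mp h2
  set J := Finset.Icc 200 ⌊ℓ⌋₊ with hJ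
  have hJcard : (J.card : ℝ) ≤ L := by
    have h1 : J.card ≤ ⌊ℓ⌋₊ := by rw [hJ, Nat.card_Icc]; omega
    have h2 : (J.card : ℝ) ≤ ⌊ℓ⌋₊ := by exact_mod_cast h1
    linarith [Nat.floor_le (by linarith : 0 ≤ ℓ)]
  have hblock : ∀ b ∈ J, ∑ χ : DirichletCharacter ℂ q,
      ‖∑ n ∈ B with Nat.log k n = b, c n * χ (n : ZMod q)‖ ^ (2 * k) ≤
        q.totient * ((L ^ 2) ^ (2 * k) / L ^ (132 * k)) := fun b hb => by
    rw [hJ, Finset.mem_Icc] at hb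
    have hbℓ : (b : ℝ) ≤ ℓ := (Nat.le_floor_iff (by linarith)).mp hb.2
    have hbk : b ≤ k := by
      have : (b : ℝ) ≤ k := by linarith
      exact_mod_cast this
    refine sum_norm_charSum_block_le hq (by linarith) hy hb.1 hbk (fun n hn => ?_)
      (by nlinarith) ?_ fun n hn => hc n (Finset.filter_subset _ _ hn)
    · obtain ⟨hnB, rfl⟩ := Finset.mem_filter.mp hn
      have hn1 := (hBz n hnB).1
      exact ⟨Nat.pow_log_le_self k (by omega), (Nat.lt_pow_succ_log_self hk1 n).le, (hB n hnB).2.2⟩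
    · refine (sum_one_div_le_one_add_log hkz fun n hn => hBz n (Finset.filter_subset _ _ hn)).trans
        ?_
      rw [hlogz]
      exact hW
  have hsplit : ∀ χ : DirichletCharacter ℂ q, ‖∑ n ∈ B, c n * χ (n : ZMod q)‖ ^ (2 * k) ≤
      L ^ (2 * k - 1) * ∑ b ∈ J, ‖∑ n ∈ B with Nat.log k n = b, c n * χ (n : ZMod q)‖ ^ (2 * k) :=
    fun χ => by
    obtain ⟨m, hm⟩ : ∃ m, 2 * k = m + 1 := ⟨2 * k - 1, by omega⟩
    rw [hm, Nat.add_sub_cancel, ← Finset.sum_fiberwise_of_maps_to hmaps]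
    refine (pow_le_pow_left₀ (norm_nonneg _) (norm_sum_le _ _) _).trans ?_
    refine (pow_sum_le_card_mul_sum_pow (fun b _ => norm_nonneg _) m).trans ?_
    exact mul_le_mul_of_nonneg_right (pow_le_pow_left₀ (Nat.cast_nonneg _) hJcard _)
      (Finset.sum_nonneg fun b _ => by positivity)
  calc _ ≤ ∑ χ : DirichletCharacter ℂ q, L ^ (2 * k - 1) *
        ∑ b ∈ J, ‖∑ n ∈ B with Nat.log k n = b, c n * χ (n : ZMod q)‖ ^ (2 * k) :=
        Finset.sum_le_sum fun χ _ => hsplit χ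
    _ = L ^ (2 * k - 1) * ∑ b ∈ J, ∑ χ : DirichletCharacter ℂ q,
        ‖∑ n ∈ B with Nat.log k n = b, c n * χ (n : ZMod q)‖ ^ (2 * k) := by
        rw [← Finset.mul_sum, Finset.sum_comm]
    _ ≤ L ^ (2 * k - 1) * ∑ _b ∈ J, q.totient * ((L ^ 2) ^ (2 * k) / L ^ (132 * k)) := by
        gcongr with b hb
        exact hblock b hb
    _ = L ^ (2 * k - 1) * (J.card * (q.totient * ((L ^ 2) ^ (2 * k) / L ^ (132 * k)))) := by
        rw [Finset.sum_const, nsmul_eq_mul]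
    _ ≤ L ^ (2 * k - 1) * (L * (q.totient * ((L ^ 2) ^ (2 * k) / L ^ (132 * k)))) := by gcongr
    _ = q.totient * (L ^ (2 * k - 1 + 1) * L ^ (4 * k) / L ^ (132 * k)) := by
        rw [← pow_mul, pow_succ]; ring
    _ = _ := by
        have h1 : 132 * k = (2 * k - 1 + 1) + 4 * k + 126 * k := by omega
        rw [h1, pow_add _ _ (126 * k), pow_add _ _ (4 * k)]
        field_simp

lemma add_pow_le_one_add_pow_mul {a b δ : ℝ} (ha : 0 ≤ a) (hb : 0 ≤ b) (hδ : 0 < δ) (m : ℕ) :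
    (a + b) ^ m ≤ (1 + δ) ^ m * (a ^ m + (b / δ) ^ m) := by
  have hbδ : 0 ≤ b / δ := by positivity
  have hbeq : b = δ * (b / δ) := by field_simp
  rcases le_total a (b / δ) with h | h
  · calc (a + b) ^ m ≤ ((1 + δ) * (b / δ)) ^ m := by
          gcongr
          linarith
      _ = (1 + δ) ^ m * (0 + (b / δ) ^ m) := by rw [mul_pow, zero_add]
      _ ≤ _ := by gcongr; positivity
  · calc (a + b) ^ m ≤ ((1 + δ) * a) ^ m := by
          gcongr
          nlinarith
      _ = (1 + δ) ^ m * (a ^ m + 0) := by rw [mul_pow, add_zero]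
      _ ≤ _ := by gcongr; positivity

lemma norm_e2pi (x : ℝ) : ‖e2pi x‖ = 1 := by
  rw [e2pi, Complex.norm_exp]
  simp

lemma norm_e2pi_sub_e2pi_le (a b : ℝ) : ‖e2pi a - e2pi b‖ ≤ 2 * Real.pi * |a - b| := by
  have h1 : e2pi a - e2pi b =
      e2pi b * (Complex.exp (Complex.I * ((2 * Real.pi * (a - b) : ℝ) : ℂ)) - 1) := by
    simp only [e2pi]
    rw [mul_sub, ← Complex.exp_add, mul_one]
    congr 2
    push_cast
    ring
  rw [h1, norm_mul, norm_e2pi, one_mul]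
  refine (Real.norm_exp_I_mul_ofReal_sub_one_le).trans (le_of_eq ?_)
  rw [norm_mul, Real.norm_eq_abs, Real.norm_eq_abs, abs_of_pos (by positivity)]

lemma SA_nonneg {q : ℕ} (χ : DirichletCharacter ℂ q) (A : Finset ℕ) : 0 ≤ SA χ A :=
  Real.iSup_nonneg fun _ => norm_nonneg _

lemma SA_pow_le {q : ℕ} (χ : DirichletCharacter ℂ q) {A : Finset ℕ} {z ε δ : ℝ}
    (hA : ∀ n ∈ A, 1 ≤ n ∧ (n : ℝ) ≤ z) {N : ℕ} (hN : 0 < N)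
    (hz : 0 ≤ z) (hε : 2 * Real.pi * z / N ≤ ε) (hδ : 0 < δ) (m : ℕ) :
    SA χ A ^ m ≤ (1 + δ) ^ m * (∑ j ∈ Finset.range (N + 1),
      ‖∑ n ∈ A, e2pi (n * (j / N : ℝ)) / n * χ (n : ZMod q)‖ ^ m + (ε / δ) ^ m) := by
  set F : ℝ → ℂ := fun α => ∑ n ∈ A, e2pi (n * α) / n * χ (n : ZMod q) with hF
  have hN0 : (0 : ℝ) < N := by exact_mod_cast hN
  have hε0 : 0 ≤ ε := le_trans (by positivity) hε
  have hcard : (A.card : ℝ) ≤ z := by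
    have hsub : A ⊆ Finset.Icc 1 ⌊z⌋₊ := fun n hn =>
      Finset.mem_Icc.mpr ⟨(hA n hn).1, Nat.le_floor (hA n hn).2⟩
    have h1 := Finset.card_le_card hsub
    rw [Nat.card_Icc, Nat.add_sub_cancel] at h1
    exact (Nat.le_floor_iff hz).mp h1
  have hlip : ∀ α β : ℝ, |α - β| ≤ 1 / N → ‖F α‖ ≤ ‖F β‖ + ε := by
    intro α β hαβ
    have h1 : ‖F α - F β‖ ≤ ε := by
      refine le_trans ?_ hε
      simp only [hF]
      rw [← Finset.sum_sub_distrib]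
      calc _ ≤ ∑ n ∈ A, ‖e2pi (n * α) / n * χ (n : ZMod q) - e2pi (n * β) / n * χ (n : ZMod q)‖ :=
            norm_sum_le _ _
        _ ≤ ∑ _n ∈ A, 2 * Real.pi / N := by
            refine Finset.sum_le_sum fun n hn => ?_
            have hn0 : (0 : ℝ) < n := by exact_mod_cast (hA n hn).1
            rw [← sub_mul, ← sub_div, norm_mul, norm_div, Complex.norm_natCast]
            refine (mul_le_of_le_one_right (by positivity) (χ.norm_le_one _)).trans ?_
            rw [div_le_iff₀ hn0]
            refine (norm_e2pi_sub_e2pi_le _ _).trans ?_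
            rw [← mul_sub, abs_mul, abs_of_pos hn0]
            calc 2 * Real.pi * (n * |α - β|) ≤ 2 * Real.pi * (n * (1 / N)) := by gcongr
              _ = _ := by ring
        _ = A.card * (2 * Real.pi / N) := by rw [Finset.sum_const, nsmul_eq_mul]
        _ ≤ z * (2 * Real.pi / N) := by gcongr
        _ = _ := by ring
    have h2 := norm_sub_norm_le (F α) (F β)
    linarith
  obtain ⟨j₀, hj₀, hmax⟩ := Finset.exists_max_image (Finset.range (N + 1))
    (fun j : ℕ => ‖F (j / N)‖) ⟨0, by simp⟩
  have hSA : SA χ A ≤ ‖F (j₀ / N)‖ + ε := by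
    have : Nonempty (Set.Icc (0 : ℝ) 1) := ⟨⟨0, by simp⟩⟩
    refine ciSup_le fun α => ?_
    obtain ⟨α, hα0, hα1⟩ := α
    have h0 : 0 ≤ α * N := by positivity
    have hj : ⌊α * N⌋₊ ∈ Finset.range (N + 1) := by
      rw [Finset.mem_range, Nat.lt_succ_iff]
      exact Nat.floor_le_of_le (by nlinarith)
    have h1 : |α - (⌊α * N⌋₊ / N : ℝ)| ≤ 1 / N := by
      have h2 := Nat.floor_le h0
      have h3 := (Nat.lt_floor_add_one (α * N)).le
      have h4 : α - (⌊α * N⌋₊ / N : ℝ) = (α * N - ⌊α * N⌋₊) / N := by field_simp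
      rw [h4, abs_of_nonneg (div_nonneg (by linarith) hN0.le)]
      gcongr
      linarith
    have h5 : ∑ n ∈ A, χ (n : ZMod q) * e2pi (n * α) / n = F α :=
      Finset.sum_congr rfl fun n _ => by ring
    rw [h5]
    exact (hlip α _ h1).trans (by linarith [hmax _ hj])
  refine (pow_le_pow_left₀ (SA_nonneg χ A) hSA m).trans
    ((add_pow_le_one_add_pow_mul (norm_nonneg _) hε0 hδ m).trans ?_)
  gcongr
  exact Finset.single_le_sum (f := fun j : ℕ => ‖F (j / N)‖ ^ m) (fun j _ => by positivity) hj₀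

lemma pow_lt_of_le_log_div {q k : ℕ} (hk : 3 ≤ k)
    (h : (k : ℝ) ≤ Real.log q / (400 * Real.log (Real.log q))) : k ^ (400 * k) < q := by
  have hk3 : (3 : ℝ) ≤ k := by exact_mod_cast hk
  have hq3 : 3 ≤ q := by
    by_contra! hq
    interval_cases q
    · simp at h; linarith
    · simp at h; linarith
    · have h1 : Real.log ((2 : ℕ) : ℝ) = Real.log 2 := by norm_num
      rw [h1] at h
      have h2 : Real.log (Real.log 2) ≤ 0 :=
        Real.log_nonpos (Real.log_nonneg (by norm_num)) (by linarith [Real.log_two_lt_d9])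
      have h3 : Real.log 2 / (400 * Real.log (Real.log 2)) ≤ 0 :=
        div_nonpos_of_nonneg_of_nonpos (Real.log_nonneg (by norm_num)) (by linarith)
      linarith
  set Q := Real.log q with hQ
  have hq0 : (0 : ℝ) < q := by positivity
  have hQ1 : 1.098 ≤ Q := by
    have h1 : Real.log 3 ≤ Q := Real.log_le_log (by norm_num) (by exact_mod_cast hq3)
    linarith [Real.log_three_gt_d9]
  have hlQ : 1 / 400 ≤ Real.log Q := by
    have h1 := Real.one_sub_inv_le_log_of_pos (x := Q) (by linarith)
    have h2 : Q⁻¹ ≤ (1.098 : ℝ)⁻¹ := by gcongr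
    norm_num at h2 ⊢
    linarith
  rw [le_div_iff₀ (by linarith)] at h
  have hk0 : (0 : ℝ) < k := by linarith
  have hkQ : (k : ℝ) ≤ Q := by nlinarith
  have hlogk : 1 ≤ Real.log k := by
    rw [Real.le_log_iff_exp_le hk0]
    linarith [Real.exp_one_lt_d9]
  have hlkQ : Real.log k ≤ Real.log Q := Real.log_le_log hk0 hkQ
  have hkQ' : (k : ℝ) < Q := by nlinarith
  have hlt : Real.log k < Real.log Q := Real.log_lt_log hk0 hkQ'
  have h1 : Real.log ((k : ℝ) ^ (400 * k)) < Real.log q := by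
    rw [Real.log_pow]
    push_cast
    nlinarith
  exact_mod_cast (Real.log_lt_log_iff (by positivity) hq0).mp h1

lemma three_le_log_of_mul_log_le_rpow {k : ℕ} (hk : 3 ≤ k)
    (h : (k : ℝ) * Real.log k ≤ (k : ℝ) ^ Real.log (Real.log k)) : 3 ≤ Real.log k := by
  have hk3 : (3 : ℝ) ≤ k := by exact_mod_cast hk
  have hk0 : (0 : ℝ) < k := by linarith
  have hlogk : 1 ≤ Real.log k := by
    rw [Real.le_log_iff_exp_le hk0]
    linarith [Real.exp_one_lt_d9]
  have h1 := Real.log_le_log (by positivity) h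
  rw [Real.log_mul (by positivity) (by positivity), Real.log_rpow hk0] at h1
  set L := Real.log k with hL
  by_contra! hlt
  have h2 : Real.log L ≤ 1.1 := by
    have h3 : Real.log L ≤ Real.log 3 := Real.log_le_log (by linarith) hlt.le
    linarith [Real.log_three_lt_d9]
  nlinarith

lemma sum_norm_charSum_split_le {q k : ℕ} {y z δ X : ℝ} (hq : k ^ (400 * k) < q)
    (hL : 3 ≤ Real.log k) (hy : (k : ℝ) * Real.log k ≤ y)
    (hz : z ≤ (k : ℝ) ^ Real.log (Real.log k)) (hδ : 0 < δ) {A : Finset ℕ}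
    (hA : ∀ n ∈ A, (n : ℝ) ≤ z ∧ ∀ p : ℕ, p.Prime → p ∣ n → y < p) {c : ℕ → ℂ}
    (hc : ∀ n ∈ A, ‖c n‖ ≤ 1 / n)
    (hX : ∑ χ : DirichletCharacter ℂ q,
      ‖∑ n ∈ A with n ≤ k ^ 200, c n * χ (n : ZMod q)‖ ^ (2 * k) ≤ q.totient * X) :
    ∑ χ : DirichletCharacter ℂ q, ‖∑ n ∈ A, c n * χ (n : ZMod q)‖ ^ (2 * k) ≤
      q.totient * ((1 + δ) ^ (2 * k) *
        (X + 1 / δ ^ (2 * k) * (1 / Real.log k ^ (126 * k)))) := by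
  have hlarge := sum_norm_charSum_large_le hq hL hy hz (B := A.filter fun n => ¬ n ≤ k ^ 200)
    (fun n hn => by
      obtain ⟨hnA, hn⟩ := Finset.mem_filter.mp hn
      exact ⟨not_le.mp hn, hA n hnA⟩) fun n hn => hc n (Finset.filter_subset _ _ hn)
  calc _ ≤ ∑ χ : DirichletCharacter ℂ q, (1 + δ) ^ (2 * k) *
        (‖∑ n ∈ A with n ≤ k ^ 200, c n * χ (n : ZMod q)‖ ^ (2 * k) +
          1 / δ ^ (2 * k) * ‖∑ n ∈ A with ¬ n ≤ k ^ 200, c n * χ (n : ZMod q)‖ ^ (2 * k)) := by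
        refine Finset.sum_le_sum fun χ _ => ?_
        rw [← Finset.sum_filter_add_sum_filter_not A fun n => n ≤ k ^ 200]
        refine (pow_le_pow_left₀ (norm_nonneg _) (norm_add_le _ _) _).trans
          ((add_pow_le_one_add_pow_mul (norm_nonneg _) (norm_nonneg _) hδ _).trans (le_of_eq ?_))
        rw [div_pow]
        ring
    _ = (1 + δ) ^ (2 * k) * (∑ χ : DirichletCharacter ℂ q,
          ‖∑ n ∈ A with n ≤ k ^ 200, c n * χ (n : ZMod q)‖ ^ (2 * k) +
          1 / δ ^ (2 * k) * ∑ χ : DirichletCharacter ℂ q,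
            ‖∑ n ∈ A with ¬ n ≤ k ^ 200, c n * χ (n : ZMod q)‖ ^ (2 * k)) := by
        rw [← Finset.mul_sum, Finset.sum_add_distrib, ← Finset.mul_sum]
    _ ≤ (1 + δ) ^ (2 * k) * (q.totient * X +
          1 / δ ^ (2 * k) * (q.totient * (1 / Real.log k ^ (126 * k)))) := by gcongr
    _ = _ := by ring

lemma sum_SA_pow_le {q k N : ℕ} {y z δ ε X : ℝ} (hq : k ^ (400 * k) < q)
    (hL : 3 ≤ Real.log k) (hy : (k : ℝ) * Real.log k ≤ y) (hyz : y ≤ z)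
    (hz : z ≤ (k : ℝ) ^ Real.log (Real.log k)) (hδ : 0 < δ) (hN : 0 < N)
    (hε : 2 * Real.pi * z / N ≤ ε) {A : Finset ℕ}
    (hA : ∀ n ∈ A, y < n ∧ (n : ℝ) ≤ z ∧ ∀ p : ℕ, p.Prime → p ∣ n → y < p)
    (hX : ∀ c : ℕ → ℂ, (∀ n ∈ A, ‖c n‖ ≤ 1 / n) → ∑ χ : DirichletCharacter ℂ q,
      ‖∑ n ∈ A with n ≤ k ^ 200, c n * χ (n : ZMod q)‖ ^ (2 * k) ≤ q.totient * X) :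
    (∑ χ : DirichletCharacter ℂ q, SA χ A ^ (2 * k)) / q.totient ≤
      (1 + δ) ^ (2 * k) * ((N + 1) * ((1 + δ) ^ (2 * k) *
        (X + 1 / δ ^ (2 * k) * (1 / Real.log k ^ (126 * k)))) + (ε / δ) ^ (2 * k)) := by
  have : NeZero q := ⟨by omega⟩
  have hφ : (0 : ℝ) < q.totient := by exact_mod_cast Nat.totient_pos.mpr (Nat.pos_of_neZero q)
  have hy0 : 0 ≤ y := le_trans (by positivity) hy
  have hcard : (Fintype.card (DirichletCharacter ℂ q) : ℝ) = q.totient := by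
    rw [← Nat.card_eq_fintype_card, DirichletCharacter.card_eq_totient_of_hasEnoughRootsOfUnity]
  rw [div_le_iff₀' hφ]
  calc _ ≤ ∑ χ : DirichletCharacter ℂ q, (1 + δ) ^ (2 * k) * (∑ j ∈ Finset.range (N + 1),
      ‖∑ n ∈ A, e2pi (n * (j / N : ℝ)) / n * χ (n : ZMod q)‖ ^ (2 * k) + (ε / δ) ^ (2 * k)) :=
        Finset.sum_le_sum fun χ _ => SA_pow_le χ (fun n hn => ⟨by
          have : (0 : ℝ) < n := hy0.trans_lt (hA n hn).1
          exact_mod_cast this, (hA n hn).2.1⟩) hN (hy0.trans hyz) hε hδ _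
    _ = (1 + δ) ^ (2 * k) * (∑ j ∈ Finset.range (N + 1), ∑ χ : DirichletCharacter ℂ q,
      ‖∑ n ∈ A, e2pi (n * (j / N : ℝ)) / n * χ (n : ZMod q)‖ ^ (2 * k) +
        q.totient * (ε / δ) ^ (2 * k)) := by
        rw [← Finset.mul_sum, Finset.sum_add_distrib, Finset.sum_comm, Finset.sum_const,
          Finset.card_univ, nsmul_eq_mul, hcard]
    _ ≤ (1 + δ) ^ (2 * k) * (∑ _j ∈ Finset.range (N + 1), q.totient * ((1 + δ) ^ (2 * k) *
        (X + 1 / δ ^ (2 * k) * (1 / Real.log k ^ (126 * k)))) +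
        q.totient * (ε / δ) ^ (2 * k)) := by
        gcongr with j hj
        have hc : ∀ n ∈ A, ‖e2pi (n * (j / N : ℝ)) / n‖ ≤ 1 / n := fun n _ => by
          rw [norm_div, norm_e2pi, Complex.norm_natCast]
        exact sum_norm_charSum_split_le hq hL hy hz hδ (fun n hn => (hA n hn).2) hc (hX _ hc)
    _ = _ := by
        rw [Finset.sum_const, Finset.card_range, nsmul_eq_mul]
        push_cast
        ring

lemma natCeil_add_one_le_exp {z Λ L l : ℝ} (hz : 1 ≤ z) (hΛ : 1 ≤ Λ) (hL : 3 ≤ L) (hl : 1 ≤ l)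
    (hlogz : Real.log z ≤ l * L) (hlogΛ : Real.log Λ ≤ 2 * l) :
    (⌈7 * z * Λ ^ 26⌉₊ : ℝ) + 1 ≤ Real.exp (62 * (l * L)) := by
  have h0 : 1 ≤ z * Λ ^ 26 := one_le_mul_of_one_le_of_one_le hz (one_le_pow₀ hΛ)
  have h1 : (⌈7 * z * Λ ^ 26⌉₊ : ℝ) < 7 * z * Λ ^ 26 + 1 := Nat.ceil_lt_add_one (by positivity)
  have h2 : (9 : ℝ) ≤ Real.exp 9 := by linarith [Real.add_one_le_exp 9]
  calc (⌈7 * z * Λ ^ 26⌉₊ : ℝ) + 1 ≤ 9 * (z * Λ ^ 26) := by linarith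
    _ ≤ Real.exp 9 * (z * Λ ^ 26) := by gcongr
    _ = Real.exp (9 + (Real.log z + (26 : ℕ) * Real.log Λ)) := by
        rw [Real.exp_add, Real.exp_add, Real.exp_log (by positivity), Real.exp_nat_mul,
          Real.exp_log (by positivity)]
    _ ≤ _ := by
        refine Real.exp_le_exp.mpr ?_
        push_cast
        nlinarith

lemma two_pi_mul_div_natCeil_le {z w : ℝ} (hz : 0 < z) (hw : 0 < w) :
    2 * Real.pi * z / ⌈7 * z * w⌉₊ ≤ 1 / w := by
  have h1 : 0 < z * w := by positivity
  have h2 : 7 * z * w ≤ ⌈7 * z * w⌉₊ := Nat.le_ceil _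
  rw [div_le_div_iff₀ (by linarith) hw]
  nlinarith [Real.pi_lt_d2]

lemma exp_add_exp_le_exp_mul {k u Λ C : ℝ} (hk : 1 ≤ k) (hΛ : 4 ≤ Λ) (hu : u ≤ 4 * k)
    (hC : 250 ≤ C) :
    Real.exp (4 * k / Λ + 62 * u) + Real.exp (2 * k / Λ) ≤ Real.exp (C * k) := by
  have hΛ0 : 0 < Λ := by linarith
  have h1 : 4 * k / Λ ≤ k := by
    rw [div_le_iff₀ hΛ0]
    nlinarith
  have h2 : 2 * k / Λ ≤ 249 * k := by
    rw [div_le_iff₀ hΛ0]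
    nlinarith
  have h3 : (2 : ℝ) ≤ Real.exp k := by linarith [Real.add_one_le_exp k]
  calc _ ≤ Real.exp (249 * k) + Real.exp (249 * k) := by
        gcongr
        linarith
    _ = 2 * Real.exp (249 * k) := by ring
    _ ≤ Real.exp k * Real.exp (249 * k) := by gcongr
    _ = Real.exp (250 * k) := by rw [← Real.exp_add]; congr 1; ring
    _ ≤ _ := by gcongr

lemma one_div_pow_mul_le {L Λ : ℝ} {k : ℕ} (hΛ : 0 < Λ) (hL : 1 ≤ L) (hΛL : Λ ≤ L ^ 2) :
    1 / (1 / Λ) ^ (2 * k) * (1 / L ^ (126 * k)) ≤ 1 / Λ ^ (50 * k) := by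
  have h1 : Λ ^ (52 * k) ≤ L ^ (126 * k) := calc
    Λ ^ (52 * k) ≤ (L ^ 2) ^ (52 * k) := by gcongr
    _ = L ^ (104 * k) := by rw [← pow_mul]; congr 1; ring
    _ ≤ L ^ (126 * k) := pow_le_pow_right₀ hL (by omega)
  have h2 : Λ ^ (52 * k) = Λ ^ (2 * k) * Λ ^ (50 * k) := by rw [← pow_add]; congr 1; ring
  rw [one_div_pow, one_div_one_div, mul_one_div, div_le_div_iff₀ (by positivity) (by positivity),
    ← h2, one_mul]
  exact h1

/-- Proposition 2: moments of `S_𝒜` for small rough `𝒜`. -/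
theorem moment_bound_rough_small :
    ∃ C : ℝ, 0 < C ∧
      ∀ q k : ℕ, 3 ≤ k → (k : ℝ) ≤ Real.log q / (400 * Real.log (Real.log q)) →
        ∀ y z : ℝ, (k : ℝ) * Real.log k ≤ y → y ≤ z →
          z ≤ (k : ℝ) ^ Real.log (Real.log k) →
          ∀ 𝒜 : Finset ℕ,
            (∀ n ∈ 𝒜, y < (n : ℝ) ∧ (n : ℝ) ≤ z ∧
              ∀ p : ℕ, p.Prime → p ∣ n → y < (p : ℝ)) →
            (∑ χ : DirichletCharacter ℂ q, SA χ 𝒜 ^ (2 * k)) / q.totient ≤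
              Real.exp (C * k * Real.log (Real.log y) / Real.log y) * (k : ℝ) ^ k /
                  (Real.exp 1 * y * Real.log y) ^ k +
                Real.exp (C * k) / Real.log y ^ (50 * k) := by
  obtain ⟨C, hC, hsmall⟩ := exists_sum_norm_charSum_small_le
  refine ⟨4 + 200 * C + 49600, by positivity, ?_⟩
  intro q k hk hqk y z hy hyz hz 𝒜 h𝒜
  have hq := pow_lt_of_le_log_div hk hqk
  have hL : 3 ≤ Real.log k := three_le_log_of_mul_log_le_rpow hk (hy.trans (hyz.trans hz))
  have hk0 : (0 : ℝ) < k := by positivity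
  have hk1 : (1 : ℝ) ≤ k := by exact_mod_cast (by omega : 1 ≤ k)
  set L := Real.log k with hLdef
  set ℓ := Real.log L with hℓdef
  have hL0 : 0 < L := by linarith
  have hℓ1 : 1 ≤ ℓ := by
    rw [hℓdef, Real.le_log_iff_exp_le hL0]
    linarith [Real.exp_one_lt_d9]
  have hℓL : ℓ ≤ L := (Real.log_le_sub_one_of_pos hL0).trans (by linarith)
  have hLk : L ^ 2 ≤ 4 * k := sq_log_le_four_mul hk1
  have hky : (k : ℝ) ≤ y := by nlinarith
  have hy0 : 0 < y := hk0.trans_le hky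
  have hz0 : 0 < z := hy0.trans_le hyz
  set Λ := Real.log y with hΛdef
  have hLΛ : L + ℓ ≤ Λ := by
    rw [hℓdef, hLdef, ← Real.log_mul hk0.ne' hL0.ne']
    exact Real.log_le_log (by positivity) hy
  have hΛ4 : 4 ≤ Λ := by linarith
  have hΛ0 : 0 < Λ := by linarith
  have hy4 : Real.exp 4 ≤ y := (Real.le_log_iff_exp_le hy0).mp hΛ4
  have hlogz : Real.log z ≤ ℓ * L := by
    have h1 := Real.log_le_log hz0 hz
    rwa [Real.log_rpow hk0] at h1
  have hΛL : Λ ≤ L ^ 2 := by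
    have h1 : Λ ≤ Real.log z := Real.log_le_log hy0 hyz
    nlinarith
  set lam := Real.log Λ with hlam
  have hℓlam : ℓ ≤ lam := Real.log_le_log hL0 (by linarith)
  have hlam2 : lam ≤ 2 * ℓ := by
    have h1 := Real.log_le_log hΛ0 hΛL
    rw [Real.log_pow] at h1
    exact_mod_cast h1
  have hN0 : 0 < ⌈7 * z * Λ ^ 26⌉₊ := Nat.ceil_pos.mpr (by positivity)
  have hNle := natCeil_add_one_le_exp (L := L) (hk1.trans (hky.trans hyz)) (by linarith) hL hℓ1
    hlogz hlam2
  have hε := two_pi_mul_div_natCeil_le hz0 (by positivity : 0 < Λ ^ 26)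
  generalize ⌈7 * z * Λ ^ 26⌉₊ = N at hN0 hNle hε
  set E := (Real.exp 1 * y * Λ) ^ k with hE
  have hE0 : 0 < E := by positivity
  obtain ⟨X, hX, hXle⟩ : ∃ X : ℝ, (∀ c : ℕ → ℂ, (∀ n ∈ 𝒜, ‖c n‖ ≤ 1 / n) →
      ∑ χ : DirichletCharacter ℂ q,
        ‖∑ n ∈ 𝒜 with n ≤ k ^ 200, c n * χ (n : ZMod q)‖ ^ (2 * k) ≤ q.totient * X) ∧
      Real.exp (4 * k / Λ + 62 * (ℓ * L)) * X ≤
        Real.exp ((4 + 200 * C + 49600) * k * lam / Λ) * (k : ℝ) ^ k / E := by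
    rcases le_or_gt Λ (200 * L) with hΛ | hΛ
    · refine ⟨Real.exp (C * k / L) * (k : ℝ) ^ k / E, fun c hc => ?_, ?_⟩
      · refine hsmall q k y (lt_of_le_of_lt (Nat.pow_le_pow_right (by omega) (by omega)) hq)
          (by linarith) hy hy4 _ (fun n hn => ?_) c fun n hn => hc n (Finset.filter_subset _ _ hn)
        obtain ⟨hn𝒜, hn⟩ := Finset.mem_filter.mp hn
        exact ⟨(h𝒜 n hn𝒜).1, hn, (h𝒜 n hn𝒜).2.2⟩
      · rw [← mul_div_assoc, ← mul_assoc, ← Real.exp_add]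
        gcongr
        have hlam1 : 1 ≤ lam := by linarith
        have h1 : 4 * k / Λ ≤ 4 * k * lam / Λ := by
          exact div_le_div_of_nonneg_right (le_mul_of_one_le_right (by positivity) hlam1) hΛ0.le
        have h2 : 1 / L ≤ 200 * lam / Λ := by
          rw [div_le_div_iff₀ hL0 hΛ0]
          nlinarith
        have h3 : L ≤ 800 * k / Λ := by
          rw [le_div_iff₀ hΛ0]
          nlinarith
        calc 4 * k / Λ + 62 * (ℓ * L) + C * k / L
            = 4 * k / Λ + 62 * (ℓ * L) + C * k * (1 / L) := by ring
          _ ≤ 4 * k * lam / Λ + 62 * (lam * (800 * k / Λ)) + C * k * (200 * lam / Λ) := by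
              gcongr
          _ = _ := by ring
    · refine ⟨0, fun c _ => ?_, by rw [mul_zero]; positivity⟩
      have hempty : 𝒜.filter (fun n => n ≤ k ^ 200) = ∅ := by
        refine Finset.filter_eq_empty_iff.mpr fun n hn hle => ?_
        have h1 : y < (k : ℝ) ^ 200 := (h𝒜 n hn).1.trans_le (by exact_mod_cast hle)
        have h2 := Real.log_lt_log hy0 h1
        rw [Real.log_pow] at h2
        push_cast at h2
        linarith
      rw [hempty]
      simp only [Finset.sum_empty, norm_zero]
      rw [zero_pow (by omega), Finset.sum_const_zero, mul_zero]
  have hmain := sum_SA_pow_le hq hL hy hyz hz (one_div_pos.mpr hΛ0) hN0 hε h𝒜 hX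
  refine hmain.trans ?_
  have hδ : (1 + 1 / Λ) ^ (2 * k) ≤ Real.exp (2 * k / Λ) := by
    have h1 : 1 + 1 / Λ ≤ Real.exp (1 / Λ) := by linarith [Real.add_one_le_exp (1 / Λ)]
    refine (pow_le_pow_left₀ (by positivity) h1 _).trans (le_of_eq ?_)
    rw [← Real.exp_nat_mul]
    congr 1
    push_cast
    ring
  have hX0 : 0 ≤ X := by
    have hφ : (0 : ℝ) < q.totient := by exact_mod_cast Nat.totient_pos.mpr (by omega)
    have h1 := hX 0 fun n _ => by simp
    have h2 : 0 ≤ q.totient * X := (Finset.sum_nonneg fun χ _ => by positivity).trans h1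
    exact nonneg_of_mul_nonneg_right h2 hφ
  have hsecond := one_div_pow_mul_le (k := k) hΛ0 (by linarith) hΛL
  have hratio : (1 / Λ ^ 26 / (1 / Λ)) ^ (2 * k) = 1 / Λ ^ (50 * k) := by
    have h1 : 1 / Λ ^ 26 / (1 / Λ) = 1 / Λ ^ 25 := by field_simp
    rw [h1, one_div_pow, ← pow_mul]
    congr 2
    ring
  have hexp4 : Real.exp (2 * k / Λ) * (Real.exp (62 * (ℓ * L)) * Real.exp (2 * k / Λ)) =
      Real.exp (4 * k / Λ + 62 * (ℓ * L)) := by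
    rw [← Real.exp_add, ← Real.exp_add]
    congr 1
    ring
  have hexpk := exp_add_exp_le_exp_mul (u := ℓ * L) hk1 hΛ4 (by nlinarith)
    (by linarith : 250 ≤ 4 + 200 * C + 49600)
  rw [hratio]
  calc _ ≤ Real.exp (2 * k / Λ) * (Real.exp (62 * (ℓ * L)) * (Real.exp (2 * k / Λ) *
        (X + 1 / Λ ^ (50 * k))) + 1 / Λ ^ (50 * k)) := by gcongr
    _ = Real.exp (2 * k / Λ) * (Real.exp (62 * (ℓ * L)) * Real.exp (2 * k / Λ)) * X +
        (Real.exp (2 * k / Λ) * (Real.exp (62 * (ℓ * L)) * Real.exp (2 * k / Λ)) +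
          Real.exp (2 * k / Λ)) / Λ ^ (50 * k) := by ring
    _ ≤ _ := by
        rw [hexp4]
        gcongr
end

section
/- There is an absolute constant C > 0 such that for all reals y ≥ 2 and u ≥ 1, one has ∑_{n > y^u, P⁺(n) ≤ y} 1/n ≤ C·((log y)/u^u + e^{−√(log y)}), where the sum is over all positive integers n > y^u all of whose prime factors are at most y. -/
open Real Complex MeasureTheory
open scoped BigOperators

attribute [local instance] Classical.propDecidable

namespace SmoothTail

/-- Abel summation: if the partial sums of `b` are nonpositive and `f` is nonnegative and
antitone, then the partial sums of `b * f` are nonpositive. -/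
lemma sum_mul_nonpos_of_antitone {b f : ℕ → ℝ} (hf : Antitone f) (hf0 : ∀ n, 0 ≤ f n)
    (hb : ∀ n, ∑ i ∈ Finset.range n, b i ≤ 0) (n : ℕ) :
    ∑ i ∈ Finset.range n, b i * f i ≤ 0 := by
  have key : ∀ n, ∑ i ∈ Finset.range n, b i * f i ≤ (∑ i ∈ Finset.range n, b i) * f n := by
    intro n
    induction n with
    | zero => simp
    | succ n ih =>
      rw [Finset.sum_range_succ]
      calc _ ≤ (∑ i ∈ Finset.range n, b i) * f n + b n * f n := by gcongr
        _ = (∑ i ∈ Finset.range (n + 1), b i) * f n := by rw [Finset.sum_range_succ]; ring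
        _ ≤ _ := mul_le_mul_of_nonpos_left (hf n.le_succ) (hb _)
  exact (key n).trans (mul_nonpos_of_nonpos_of_nonneg (hb n) (hf0 n))

lemma sum_primesBelow_succ (N : ℕ) (g : ℕ → ℝ) :
    ∑ p ∈ (N + 1).primesBelow, g p =
      ∑ n ∈ Finset.range N, if (n + 1).Prime then g (n + 1) else 0 := by
  rw [Nat.primesBelow, Finset.sum_filter, Finset.sum_range_succ']
  simp [Nat.not_prime_zero]

lemma sum_log_primesBelow_le (N : ℕ) :
    ∑ p ∈ (N + 1).primesBelow, Real.log p ≤ Real.log 4 * N := by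
  have h := Chebyshev.theta_le_log4_mul_x (x := N) (Nat.cast_nonneg N)
  rw [Chebyshev.theta_eq_sum_primesLE_log] at h
  exact h

/-- A Chebyshev-type bound for sums of `log p` over primes against an antitone weight. -/
lemma sum_log_mul_primesBelow_le {f : ℕ → ℝ} (hf : Antitone fun n => f (n + 1))
    (hf0 : ∀ n, 0 ≤ f n) (N : ℕ) :
    ∑ p ∈ (N + 1).primesBelow, Real.log p * f p ≤
      Real.log 4 * ∑ n ∈ Finset.range N, f (n + 1) := by
  have h := sum_mul_nonpos_of_antitone
    (b := fun n => (if (n + 1).Prime then Real.log ((n + 1 : ℕ) : ℝ) else 0) - Real.log 4)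
    hf (fun n => hf0 _) (fun n => by
      have h := sum_log_primesBelow_le n
      rw [sum_primesBelow_succ n fun p => Real.log p] at h
      rw [Finset.sum_sub_distrib]
      simp only [Finset.sum_const, Finset.card_range, nsmul_eq_mul]
      linarith) N
  rw [sum_primesBelow_succ N fun p => Real.log p * f p, Finset.mul_sum]
  rw [← sub_nonpos, ← Finset.sum_sub_distrib]
  refine le_trans (le_of_eq (Finset.sum_congr rfl fun n _ => ?_)) h
  split_ifs <;> ring

lemma sum_rpow_sub_one_le {δ : ℝ} (hδ : 0 < δ) (hδ1 : δ ≤ 1) (N : ℕ) :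
    ∑ n ∈ Finset.range N, ((n + 1 : ℕ) : ℝ) ^ (δ - 1) ≤ (N : ℝ) ^ δ / δ := by
  induction N with
  | zero => simp [Real.zero_rpow hδ.ne']
  | succ N ih =>
    rw [Finset.sum_range_succ]
    refine (add_le_add_left ih _).trans ?_
    have hx : (0 : ℝ) < ((N + 1 : ℕ) : ℝ) := by positivity
    set x : ℝ := ((N + 1 : ℕ) : ℝ) with hxdef
    have hN : (N : ℝ) = x * (1 + -(1 / x)) := by
      rw [mul_add, mul_neg, mul_one_div_cancel hx.ne', hxdef]; push_cast; ring
    have h1x : 1 / x ≤ 1 := by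
      rw [div_le_one hx, hxdef]; push_cast; linarith [(Nat.cast_nonneg N : (0 : ℝ) ≤ N)]
    have hb := rpow_one_add_le_one_add_mul_self (s := -(1 / x)) (by linarith) hδ.le hδ1
    rw [hN, Real.mul_rpow hx.le (by linarith), Real.rpow_sub_one hx.ne', ← sub_nonneg]
    have hxd : 0 < x ^ δ := by positivity
    have := mul_le_mul_of_nonneg_left hb hxd.le
    have h2 : x ^ δ / δ - (x ^ δ * (1 + -(1 / x)) ^ δ / δ + x ^ δ / x)
        = (x ^ δ * (1 + δ * -(1 / x)) - x ^ δ * (1 + -(1 / x)) ^ δ) / δ := by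
      field_simp; ring
    rw [h2]
    exact div_nonneg (by linarith) hδ.le

lemma sum_inv_succ_le (N : ℕ) :
    ∑ n ∈ Finset.range N, (((n + 1 : ℕ) : ℝ))⁻¹ ≤ 1 + Real.log N := by
  have h := harmonic_le_one_add_log N
  simpa [harmonic] using h

/-- Partial sums of the zeta function at `1 + s`. -/
lemma sum_rpow_neg_one_sub_le {s : ℝ} (hs : 0 < s) (N : ℕ) :
    ∑ n ∈ Finset.range N, ((n + 1 : ℕ) : ℝ) ^ (-1 - s) ≤ 1 + 1 / s := by
  have key : ∀ M : ℕ, ∑ n ∈ Finset.range (M + 1), ((n + 1 : ℕ) : ℝ) ^ (-1 - s) ≤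
      1 + 1 / s - ((M + 1 : ℕ) : ℝ) ^ (-s) / s := by
    intro M
    induction M with
    | zero => simp
    | succ M ih =>
      rw [Finset.sum_range_succ]
      refine (add_le_add_left ih _).trans ?_
      have hx : (0 : ℝ) < ((M + 1 : ℕ) : ℝ) := by positivity
      set x : ℝ := ((M + 1 : ℕ) : ℝ) with hxdef
      have hz : (((M + 1 + 1 : ℕ) : ℝ)) = x + 1 := by rw [hxdef]; push_cast; ring
      rw [hz]
      have hb : (1 + s / (x + 1)) * (x + 1) ^ (-s) ≤ x ^ (-s) := by
        have hl : Real.log x ≤ Real.log (x + 1) - 1 / (x + 1) := by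
          have := Real.log_le_sub_one_of_pos (x := x / (x + 1)) (by positivity)
          rw [Real.log_div hx.ne' (by positivity)] at this
          have h3 : x / (x + 1) - 1 = - (1 / (x + 1)) := by field_simp; ring
          linarith
        rw [Real.rpow_def_of_pos (by positivity), Real.rpow_def_of_pos hx]
        calc _ ≤ Real.exp (s / (x + 1)) * Real.exp (Real.log (x + 1) * -s) := by
              gcongr; linarith [Real.add_one_le_exp (s / (x + 1))]
          _ = Real.exp (s / (x + 1) + Real.log (x + 1) * -s) := by rw [Real.exp_add]
          _ ≤ _ := by
              gcongr
              have := mul_le_mul_of_nonneg_right hl hs.le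
              have h4 : s / (x + 1) = 1 / (x + 1) * s := by ring
              rw [h4]; linarith
      rw [show -1 - s = -s - 1 by ring, Real.rpow_sub_one (by positivity), ← sub_nonneg]
      have h2 : 1 + 1 / s - (x + 1) ^ (-s) / s -
          (1 + 1 / s - x ^ (-s) / s + (x + 1) ^ (-s) / (x + 1))
          = (x ^ (-s) - (1 + s / (x + 1)) * (x + 1) ^ (-s)) / s := by
        field_simp; ring
      rw [h2]
      exact div_nonneg (by linarith) hs.le
  rcases N with _ | M
  · simp; positivity
  · refine (key M).trans ?_
    have : 0 ≤ ((M + 1 : ℕ) : ℝ) ^ (-s) / s := by positivity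
    linarith

/-- The Euler product of `n ↦ n ^ t` over the primes below `N`. -/
lemma hasSum_smoothNumbers_rpow {t : ℝ} (ht : t < 0) (N : ℕ) :
    HasSum (fun m : N.smoothNumbers => ((m : ℕ) : ℝ) ^ t)
      (∏ p ∈ N.primesBelow, (1 - (p : ℝ) ^ t)⁻¹) := by
  let f : ℕ →* ℝ :=
    { toFun := fun n => (n : ℝ) ^ t
      map_one' := by simp
      map_mul' := fun m n => by
        push_cast; exact Real.mul_rpow (Nat.cast_nonneg _) (Nat.cast_nonneg _) }
  refine (EulerProduct.summable_and_hasSum_smoothNumbers_prod_primesBelow_geometric (f := f)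
    (fun {p} hp => ?_) N).2
  change ‖(p : ℝ) ^ t‖ < 1
  rw [Real.norm_of_nonneg (by positivity)]
  exact Real.rpow_lt_one_of_one_lt_of_neg (by exact_mod_cast hp.one_lt) ht

lemma exp_sum_primes_rpow_le {s : ℝ} (hs : 0 < s) (N : ℕ) :
    Real.exp (∑ p ∈ N.primesBelow, (p : ℝ) ^ (-1 - s)) ≤ 1 + 1 / s := by
  have hsum := hasSum_smoothNumbers_rpow (t := -1 - s) (by linarith) N
  calc _ = ∏ p ∈ N.primesBelow, Real.exp ((p : ℝ) ^ (-1 - s)) := Real.exp_sum _ _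
    _ ≤ ∏ p ∈ N.primesBelow, (1 - (p : ℝ) ^ (-1 - s))⁻¹ := by
      refine Finset.prod_le_prod (fun _ _ => (Real.exp_pos _).le) fun p hp => ?_
      have hlt : (p : ℝ) ^ (-1 - s) < 1 := Real.rpow_lt_one_of_one_lt_of_neg
        (by exact_mod_cast (Nat.prime_of_mem_primesBelow hp).one_lt) (by linarith)
      rw [← neg_neg ((p : ℝ) ^ (-1 - s)), Real.exp_neg]
      refine inv_anti₀ (by simpa using hlt) ?_
      have := Real.add_one_le_exp (-(p : ℝ) ^ (-1 - s))
      simp only [neg_neg]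
      linarith
    _ ≤ 1 + 1 / s := by
      refine hasSum_le_of_sum_le hsum fun S => ?_
      obtain ⟨M, hM⟩ := (S.map (Function.Embedding.subtype _)).bddAbove
      calc _ = ∑ n ∈ S.map (Function.Embedding.subtype _), (n : ℝ) ^ (-1 - s) := by
            rw [Finset.sum_map]; rfl
        _ ≤ ∑ n ∈ Finset.range (M + 1), (n : ℝ) ^ (-1 - s) := by
            refine Finset.sum_le_sum_of_subset_of_nonneg (fun n hn => ?_)
              (fun _ _ _ => by positivity)
            exact Finset.mem_range.2 (Nat.lt_succ_of_le (hM hn))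
        _ = ∑ n ∈ Finset.range M, ((n + 1 : ℕ) : ℝ) ^ (-1 - s) := by
            rw [Finset.sum_range_succ']
            simp [Real.zero_rpow (show -1 - s ≠ 0 by linarith)]
        _ ≤ _ := sum_rpow_neg_one_sub_le hs M

lemma inv_one_sub_le_exp {x : ℝ} (hx : x ≤ 2 / 3) :
    (1 - x)⁻¹ ≤ Real.exp (x + 3 * x ^ 2) := by
  rw [inv_le_iff_one_le_mul₀ (by linarith)]
  have := Real.add_one_le_exp (x + 3 * x ^ 2)
  nlinarith [mul_le_mul_of_nonneg_right this (by linarith : 0 ≤ 1 - x),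
    mul_nonneg (sq_nonneg x) (by linarith : 0 ≤ 2 - 3 * x)]

/-- Rankin's Euler product, with the prime squares absorbed into an absolute constant. -/
lemma prod_primesBelow_le_exp {δ : ℝ} (hδ : δ ≤ 1 / 4) (N : ℕ) :
    ∏ p ∈ (N + 1).primesBelow, (1 - (p : ℝ) ^ (δ - 1))⁻¹ ≤
      Real.exp (∑ p ∈ (N + 1).primesBelow, (p : ℝ) ^ (δ - 1) + 9) := by
  have hx : ∀ p ∈ (N + 1).primesBelow, (p : ℝ) ^ (δ - 1) ≤ 2 / 3 := fun p hp => by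
    have hp2 : (2 : ℝ) ≤ p := by exact_mod_cast (Nat.prime_of_mem_primesBelow hp).two_le
    calc (p : ℝ) ^ (δ - 1) ≤ (p : ℝ) ^ (-(3 / 4) : ℝ) :=
          Real.rpow_le_rpow_of_exponent_le (by linarith) (by linarith)
      _ ≤ (2 : ℝ) ^ (-(3 / 4) : ℝ) :=
          Real.rpow_le_rpow_of_nonpos (by norm_num) hp2 (by norm_num)
      _ ≤ 2 / 3 := by
          refine le_of_pow_le_pow_left₀ (n := 4) (by norm_num) (by norm_num) ?_
          rw [← Real.rpow_natCast, ← Real.rpow_mul (by norm_num)]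
          norm_num
  have hsq : ∑ p ∈ (N + 1).primesBelow, ((p : ℝ) ^ (δ - 1)) ^ 2 ≤ 3 := by
    rw [sum_primesBelow_succ N fun p => ((p : ℝ) ^ (δ - 1)) ^ 2]
    refine (Finset.sum_le_sum fun n _ => ?_).trans
      ((sum_rpow_neg_one_sub_le (s := 1 / 2) (by norm_num) N).trans (by norm_num))
    split_ifs
    · rw [← Real.rpow_natCast, ← Real.rpow_mul (by positivity)]
      refine Real.rpow_le_rpow_of_exponent_le ?_ (by push_cast; linarith)
      exact_mod_cast Nat.le_add_left 1 n
    · positivity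
  calc _ ≤ ∏ p ∈ (N + 1).primesBelow,
        Real.exp ((p : ℝ) ^ (δ - 1) + 3 * ((p : ℝ) ^ (δ - 1)) ^ 2) :=
        Finset.prod_le_prod (fun p hp => inv_nonneg.2 (by linarith [hx p hp]))
          fun p hp => inv_one_sub_le_exp (hx p hp)
    _ = Real.exp (∑ p ∈ (N + 1).primesBelow, (p : ℝ) ^ (δ - 1) +
          3 * ∑ p ∈ (N + 1).primesBelow, ((p : ℝ) ^ (δ - 1)) ^ 2) := by
        rw [← Real.exp_sum, Finset.sum_add_distrib, Finset.mul_sum]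
    _ ≤ _ := by gcongr; linarith

lemma half_le_log {y : ℝ} (hy : 2 ≤ y) : 1 / 2 ≤ Real.log y := by
  have := Real.log_le_log (by norm_num) hy
  linarith [Real.log_two_gt_d9]

lemma prime_le_of_mem {y : ℝ} (hy : 2 ≤ y) {p : ℕ} (hp : p ∈ (⌊y⌋₊ + 1).primesBelow) :
    (2 : ℝ) ≤ p ∧ (p : ℝ) ≤ y := by
  refine ⟨by exact_mod_cast (Nat.prime_of_mem_primesBelow hp).two_le, ?_⟩
  exact (Nat.le_floor_iff (by linarith)).1 (Nat.le_of_lt_succ (Nat.lt_of_mem_primesBelow hp))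

lemma sum_log_mul_inv_primes_le {y : ℝ} (hy : 2 ≤ y) :
    ∑ p ∈ (⌊y⌋₊ + 1).primesBelow, Real.log p * (p : ℝ)⁻¹ ≤ Real.log 4 * (1 + Real.log y) := by
  refine (sum_log_mul_primesBelow_le (f := fun n => (n : ℝ)⁻¹) (fun m n hmn => ?_)
    (fun n => by positivity) _).trans ?_
  · exact inv_anti₀ (by positivity) (by exact_mod_cast Nat.succ_le_succ hmn)
  · have h4 : 0 ≤ Real.log 4 := Real.log_nonneg (by norm_num)
    refine mul_le_mul_of_nonneg_left ((sum_inv_succ_le _).trans ?_) h4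
    gcongr
    · exact_mod_cast Nat.floor_pos.2 (by linarith)
    · exact Nat.floor_le (by linarith)

lemma sum_log_mul_rpow_primes_le {y δ : ℝ} (hy : 2 ≤ y) (hδ : 0 < δ) (hδ1 : δ ≤ 1) :
    ∑ p ∈ (⌊y⌋₊ + 1).primesBelow, Real.log p * (p : ℝ) ^ (δ - 1) ≤
      Real.log 4 * (y ^ δ / δ) := by
  refine (sum_log_mul_primesBelow_le (f := fun n => (n : ℝ) ^ (δ - 1)) (fun m n hmn => ?_)
    (fun n => by positivity) _).trans ?_
  · exact Real.rpow_le_rpow_of_nonpos (by positivity)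
      (by exact_mod_cast Nat.succ_le_succ hmn) (by linarith)
  · have h4 : 0 ≤ Real.log 4 := Real.log_nonneg (by norm_num)
    refine mul_le_mul_of_nonneg_left ((sum_rpow_sub_one_le hδ hδ1 _).trans ?_) h4
    gcongr
    exact Nat.floor_le (by linarith)

/-- An upper bound of Mertens type for the sum of reciprocals of primes. -/
lemma exp_sum_inv_primes_le {y : ℝ} (hy : 2 ≤ y) :
    Real.exp (∑ p ∈ (⌊y⌋₊ + 1).primesBelow, (p : ℝ)⁻¹) ≤
      3 * Real.exp (3 * Real.log 4) * Real.log y := by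
  have hL := half_le_log hy
  have hL0 : 0 < Real.log y := by linarith
  have h4 : 0 ≤ Real.log 4 := Real.log_nonneg (by norm_num)
  set s := 1 / Real.log y with hs
  have hs0 : 0 < s := by positivity
  have hz := exp_sum_primes_rpow_le hs0 (⌊y⌋₊ + 1)
  have hdiff : ∑ p ∈ (⌊y⌋₊ + 1).primesBelow, (p : ℝ)⁻¹ ≤
      3 * Real.log 4 + ∑ p ∈ (⌊y⌋₊ + 1).primesBelow, (p : ℝ) ^ (-1 - s) := by
    have h1 : ∑ p ∈ (⌊y⌋₊ + 1).primesBelow, (p : ℝ)⁻¹ ≤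
        ∑ p ∈ (⌊y⌋₊ + 1).primesBelow, (s * (Real.log p * (p : ℝ)⁻¹) + (p : ℝ) ^ (-1 - s)) := by
      refine Finset.sum_le_sum fun p hp => ?_
      have hp0 : (0 : ℝ) < p := by linarith [(prime_le_of_mem hy hp).1]
      rw [show -1 - s = -s + -1 by ring, Real.rpow_add hp0, Real.rpow_neg_one,
        Real.rpow_def_of_pos hp0]
      have := mul_le_mul_of_nonneg_right (Real.add_one_le_exp (Real.log p * -s))
        (inv_pos.2 hp0).le
      linarith
    rw [Finset.sum_add_distrib, ← Finset.mul_sum] at h1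
    have h2 := mul_le_mul_of_nonneg_left (sum_log_mul_inv_primes_le hy) hs0.le
    have h3 : s * (Real.log 4 * (1 + Real.log y)) ≤ 3 * Real.log 4 := by
      have : s * (1 + Real.log y) ≤ 3 := by
        rw [hs, one_div, inv_mul_le_iff₀ hL0]; linarith
      nlinarith
    linarith
  calc _ ≤ Real.exp (3 * Real.log 4 + ∑ p ∈ (⌊y⌋₊ + 1).primesBelow, (p : ℝ) ^ (-1 - s)) := by
        gcongr
    _ ≤ Real.exp (3 * Real.log 4) * (1 + 1 / s) := by rw [Real.exp_add]; gcongr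
    _ ≤ Real.exp (3 * Real.log 4) * (3 * Real.log y) := by
        gcongr; rw [hs, one_div_one_div]; linarith
    _ = _ := by ring

/-- The excess of `∑ p ^ (δ - 1)` over `∑ p ^ (-1)`, where `v = δ log y`. -/
lemma sum_primes_rpow_le {y δ v : ℝ} (hy : 2 ≤ y) (hδ : 0 < δ) (hδ1 : δ ≤ 1)
    (hv : v = δ * Real.log y) :
    ∑ p ∈ (⌊y⌋₊ + 1).primesBelow, (p : ℝ) ^ (δ - 1) ≤
      ∑ p ∈ (⌊y⌋₊ + 1).primesBelow, (p : ℝ)⁻¹ + 40 * (Real.exp v / v) := by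
  have hL := half_le_log hy
  have hL0 : 0 < Real.log y := by linarith
  have hv0 : 0 < v := by rw [hv]; positivity
  have h4 : 0 ≤ Real.log 4 := Real.log_nonneg (by norm_num)
  have hyv : y ^ δ = Real.exp v := by
    rw [Real.rpow_def_of_pos (by linarith), hv, mul_comm]
  have h1 : ∑ p ∈ (⌊y⌋₊ + 1).primesBelow, (p : ℝ) ^ (δ - 1) ≤
      ∑ p ∈ (⌊y⌋₊ + 1).primesBelow, ((p : ℝ)⁻¹ +
        (δ * Real.exp (v / 2) * (Real.log p * (p : ℝ)⁻¹) +
          2 / Real.log y * (Real.log p * (p : ℝ) ^ (δ - 1)))) := by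
    refine Finset.sum_le_sum fun p hp => ?_
    obtain ⟨hp2, hpy⟩ := prime_le_of_mem hy hp
    have hp0 : (0 : ℝ) < p := by linarith
    have hlp : 0 ≤ Real.log p := Real.log_nonneg (by linarith)
    rcases le_total (Real.log p) (Real.log y / 2) with h | h
    · have hpd : (p : ℝ) ^ δ ≤ 1 + δ * Real.exp (v / 2) * Real.log p := by
        rw [Real.rpow_def_of_pos hp0]
        have ha := Real.add_one_le_exp (-(Real.log p * δ))
        have hb := mul_le_mul_of_nonneg_right ha (Real.exp_pos (Real.log p * δ)).le
        rw [← Real.exp_add, neg_add_cancel, Real.exp_zero] at hb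
        have hc : Real.exp (Real.log p * δ) ≤ Real.exp (v / 2) := by
          gcongr; rw [hv]; nlinarith
        nlinarith [mul_le_mul_of_nonneg_left hc (mul_nonneg hlp hδ.le)]
      have hpos : 0 ≤ 2 / Real.log y * (Real.log p * (p : ℝ) ^ (δ - 1)) := by positivity
      have := mul_le_mul_of_nonneg_right hpd (inv_pos.2 hp0).le
      have he : (p : ℝ) ^ (δ - 1) = (p : ℝ) ^ δ * (p : ℝ)⁻¹ := by
        rw [Real.rpow_sub_one hp0.ne', div_eq_mul_inv]
      rw [he] at hpos ⊢
      linarith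
    · have ha : 1 ≤ 2 / Real.log y * Real.log p := by
        rw [div_mul_eq_mul_div, le_div_iff₀ hL0]; linarith
      have hb : 0 ≤ (p : ℝ) ^ (δ - 1) := by positivity
      have hc : 0 ≤ (p : ℝ)⁻¹ + δ * Real.exp (v / 2) * (Real.log p * (p : ℝ)⁻¹) := by positivity
      nlinarith [mul_le_mul_of_nonneg_right ha hb]
  rw [Finset.sum_add_distrib, Finset.sum_add_distrib, ← Finset.mul_sum, ← Finset.mul_sum] at h1
  have h2 := mul_le_mul_of_nonneg_left (sum_log_mul_inv_primes_le hy)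
    (show 0 ≤ δ * Real.exp (v / 2) by positivity)
  have h3 := mul_le_mul_of_nonneg_left (sum_log_mul_rpow_primes_le hy hδ hδ1)
    (show 0 ≤ 2 / Real.log y by positivity)
  have h5 : 2 / Real.log y * (Real.log 4 * (y ^ δ / δ)) = 2 * Real.log 4 * (Real.exp v / v) := by
    rw [hyv, hv]; field_simp
  have h6 : δ * Real.exp (v / 2) * (Real.log 4 * (1 + Real.log y)) ≤
      24 * Real.log 4 * (Real.exp v / v) := by
    have ha : δ * (1 + Real.log y) ≤ 3 * v := by rw [hv]; nlinarith
    have hb : v * Real.exp (v / 2) ≤ 8 * (Real.exp v / v) := by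
      have hq := Real.quadratic_le_exp_of_nonneg (x := v / 2) (by positivity)
      have hee : Real.exp v = Real.exp (v / 2) * Real.exp (v / 2) := by
        rw [← Real.exp_add]; ring_nf
      rw [hee, mul_div_assoc', le_div_iff₀ hv0]
      have hp := Real.exp_pos (v / 2)
      nlinarith [mul_le_mul_of_nonneg_right hq hp.le]
    calc _ = (δ * (1 + Real.log y)) * (Real.exp (v / 2) * Real.log 4) := by ring
      _ ≤ (3 * v) * (Real.exp (v / 2) * Real.log 4) := by gcongr
      _ = 3 * Real.log 4 * (v * Real.exp (v / 2)) := by ring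
      _ ≤ 3 * Real.log 4 * (8 * (Real.exp v / v)) := by gcongr
      _ = _ := by ring
  have h7 : Real.log 4 ≤ 3 / 2 := by
    rw [show (4 : ℝ) = 2 ^ 2 by norm_num, Real.log_pow]
    push_cast; linarith [Real.log_two_lt_d9]
  have h8 : 0 < Real.exp v / v := by positivity
  nlinarith [mul_le_mul_of_nonneg_right h7 h8.le]

/-- Rankin's bound for the tail of the sum of reciprocals of `y`-smooth numbers. -/
lemma tail_le_rankin {y u δ : ℝ} (hy : 2 ≤ y) (hδ : 0 ≤ δ) (hδ1 : δ ≤ 1 / 4) :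
    (∑' n : {n : ℕ // y ^ u < (n : ℝ) ∧ ∀ p : ℕ, p.Prime → p ∣ (n : ℕ) → (p : ℝ) ≤ y},
        (1 : ℝ) / ((n : ℕ) : ℝ)) ≤
      Real.exp (-(u * (δ * Real.log y))) *
        Real.exp (∑ p ∈ (⌊y⌋₊ + 1).primesBelow, (p : ℝ) ^ (δ - 1) + 9) := by
  have hy0 : 0 < y := by linarith
  have hsum := (hasSum_smoothNumbers_rpow (t := δ - 1) (by linarith) (⌊y⌋₊ + 1)).mul_left
    (Real.exp (-(u * (δ * Real.log y))))
  let e : {n : ℕ // y ^ u < (n : ℝ) ∧ ∀ p : ℕ, p.Prime → p ∣ (n : ℕ) → (p : ℝ) ≤ y} →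
      (⌊y⌋₊ + 1).smoothNumbers := fun n => ⟨n, Nat.mem_smoothNumbers'.2 fun p hp hd =>
        Nat.lt_succ_of_le (Nat.le_floor (n.2.2 p hp hd))⟩
  have he : Function.Injective e := fun a b h => Subtype.ext (congrArg (fun z : (⌊y⌋₊ + 1).smoothNumbers => (z : ℕ)) h)
  have hle : ∀ n : {n : ℕ // y ^ u < (n : ℝ) ∧
      ∀ p : ℕ, p.Prime → p ∣ (n : ℕ) → (p : ℝ) ≤ y}, (1 : ℝ) / ((n : ℕ) : ℝ) ≤
      Real.exp (-(u * (δ * Real.log y))) * ((e n : ℕ) : ℝ) ^ (δ - 1) := fun n => by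
    change _ ≤ _ * ((n : ℕ) : ℝ) ^ (δ - 1)
    have hyu : 0 < y ^ u := by positivity
    have hn : (0 : ℝ) < (n : ℕ) := hyu.trans n.2.1
    have hlog : u * Real.log y ≤ Real.log (n : ℕ) := by
      rw [← Real.log_rpow hy0]
      exact Real.log_le_log hyu n.2.1.le
    rw [Real.rpow_sub_one hn.ne', Real.rpow_def_of_pos hn, mul_div_assoc', ← Real.exp_add]
    gcongr
    rw [Real.one_le_exp_iff]
    nlinarith
  have hsf := Summable.of_nonneg_of_le (fun n => by positivity) hle (hsum.summable.comp_injective he)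
  refine (Summable.tsum_le_tsum_of_inj e he (fun c _ => by positivity) hle hsf
    hsum.summable).trans ?_
  rw [hsum.tsum_eq]
  gcongr
  exact prod_primesBelow_le_exp hδ1 _

/-- The tail bound with a free Rankin parameter `v`. -/
lemma tail_le_exp {y u v : ℝ} (hy : 2 ≤ y) (hv : 0 < v) (hv1 : v ≤ Real.log y / 4) :
    (∑' n : {n : ℕ // y ^ u < (n : ℝ) ∧ ∀ p : ℕ, p.Prime → p ∣ (n : ℕ) → (p : ℝ) ≤ y},
        (1 : ℝ) / ((n : ℕ) : ℝ)) ≤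
      3 * Real.exp (3 * Real.log 4 + 9) * Real.log y *
        Real.exp (40 * (Real.exp v / v) - u * v) := by
  have hL0 : 0 < Real.log y := by linarith [half_le_log hy]
  have hδ : v / Real.log y ≤ 1 / 4 := by rw [div_le_iff₀ hL0]; linarith
  have hvd : v = v / Real.log y * Real.log y := by field_simp
  refine (tail_le_rankin hy (by positivity) hδ).trans ?_
  rw [← hvd]
  calc _ ≤ Real.exp (-(u * v)) * Real.exp (∑ p ∈ (⌊y⌋₊ + 1).primesBelow, (p : ℝ)⁻¹ +
          40 * (Real.exp v / v) + 9) := by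
        gcongr
        exact sum_primes_rpow_le hy (by positivity) (by linarith) hvd
    _ = Real.exp (∑ p ∈ (⌊y⌋₊ + 1).primesBelow, (p : ℝ)⁻¹) * (Real.exp 9 *
          Real.exp (40 * (Real.exp v / v) - u * v)) := by
        simp only [← Real.exp_add]; congr 1; ring
    _ ≤ 3 * Real.exp (3 * Real.log 4) * Real.log y * (Real.exp 9 *
          Real.exp (40 * (Real.exp v / v) - u * v)) := by
        gcongr; exact exp_sum_inv_primes_le hy
    _ = _ := by rw [Real.exp_add]; ring

lemma tail_le_log {y u : ℝ} (hy : 2 ≤ y) :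
    (∑' n : {n : ℕ // y ^ u < (n : ℝ) ∧ ∀ p : ℕ, p.Prime → p ∣ (n : ℕ) → (p : ℝ) ≤ y},
        (1 : ℝ) / ((n : ℕ) : ℝ)) ≤ 3 * Real.exp (3 * Real.log 4 + 9) * Real.log y := by
  refine (tail_le_rankin hy le_rfl (by norm_num)).trans ?_
  simp only [zero_mul, mul_zero, neg_zero, Real.exp_zero, one_mul, zero_sub, Real.rpow_neg_one]
  rw [Real.exp_add, Real.exp_add]
  nlinarith [mul_le_mul_of_nonneg_right (exp_sum_inv_primes_le hy) (Real.exp_pos 9).le]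

lemma tail_le_of_log_large {y u w : ℝ} (hy : 2 ≤ y) (hw : 0 < w) (hwu : w ≤ u)
    (hw1 : 120 ≤ Real.log w) (hw2 : 1 + Real.log w ≤ Real.log y / 4) :
    (∑' n : {n : ℕ // y ^ u < (n : ℝ) ∧ ∀ p : ℕ, p.Prime → p ∣ (n : ℕ) → (p : ℝ) ≤ y},
        (1 : ℝ) / ((n : ℕ) : ℝ)) ≤
      3 * Real.exp (3 * Real.log 4 + 9) * Real.log y * Real.exp (-(w * Real.log w)) := by
  have hL0 : 0 < Real.log y := by linarith
  refine (tail_le_exp hy (v := 1 + Real.log w) (by linarith) hw2).trans ?_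
  gcongr
  have h1 : 40 * (Real.exp (1 + Real.log w) / (1 + Real.log w)) ≤ w := by
    rw [Real.exp_add, Real.exp_log hw, mul_div_assoc', div_le_iff₀ (by linarith)]
    nlinarith [Real.exp_one_lt_d9]
  nlinarith

lemma exp_log_tail_le {L : ℝ} (hL : Real.exp 120 ≤ L) :
    1 + Real.log L ≤ L / 4 ∧ L * Real.exp (-(L * Real.log L)) ≤ Real.exp (-Real.sqrt L) := by
  have hL1 : 121 ≤ L := by linarith [Real.add_one_le_exp (120 : ℝ)]
  have hL0 : 0 < L := by linarith
  have hr : 11 ≤ Real.sqrt L := Real.le_sqrt_of_sq_le (by linarith)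
  have hrr := Real.sq_sqrt hL0.le
  constructor
  · have h1 : Real.log L = 2 * Real.log (Real.sqrt L) := by
      rw [Real.log_sqrt hL0.le]; ring
    have h2 := Real.log_le_sub_one_of_pos (x := Real.sqrt L) (by linarith)
    nlinarith
  · have h1 : 120 ≤ Real.log L := (Real.le_log_iff_exp_le hL0).2 hL
    nth_rw 1 [← Real.exp_log hL0]
    rw [← Real.exp_add]
    gcongr
    nlinarith

end SmoothTail

open SmoothTail

/-- Lemma 2: tail of the sum of reciprocals of `y`-smooth numbers. -/
theorem smooth_tail_bound :
    ∃ C : ℝ, 0 < C ∧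
      ∀ y u : ℝ, 2 ≤ y → 1 ≤ u →
        (∑' n : {n : ℕ // y ^ u < (n : ℝ) ∧ ∀ p : ℕ, p.Prime → p ∣ (n : ℕ) → (p : ℝ) ≤ y},
            (1 : ℝ) / ((n : ℕ) : ℝ)) ≤
          C * (Real.log y / u ^ u + Real.exp (-Real.sqrt (Real.log y))) := by
  set U := Real.exp 120 with hU
  set A := 3 * Real.exp (3 * Real.log 4 + 9) with hA
  have hU1 : 1 ≤ U := Real.one_le_exp (by norm_num)
  have hA0 : 0 < A := by positivity
  have hUU : 1 ≤ U ^ U := Real.one_le_rpow hU1 (by linarith)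
  have hB0 : 0 < U * Real.exp (Real.sqrt U) := by positivity
  have hC : ∀ X, 0 ≤ X → A * X ≤ A * (U ^ U + U * Real.exp (Real.sqrt U)) * X := fun X hX => by
    have : 1 ≤ U ^ U + U * Real.exp (Real.sqrt U) := by linarith
    nlinarith [mul_nonneg hA0.le hX]
  refine ⟨A * (U ^ U + U * Real.exp (Real.sqrt U)), by positivity, fun y u hy hu => ?_⟩
  have hu0 : 0 < u := by linarith
  have hL0 : 0 < Real.log y := by linarith [half_le_log hy]
  have huu : 0 < u ^ u := by positivity
  have hexp : Real.exp (-(u * Real.log u)) = (u ^ u)⁻¹ := by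
    rw [Real.rpow_def_of_pos hu0, ← Real.exp_neg, mul_comm]
  rcases le_total u U with huU | huU
  · refine (tail_le_log hy).trans ?_
    have h1 : u ^ u ≤ U ^ U :=
      (Real.rpow_le_rpow hu0.le huU hu0.le).trans (Real.rpow_le_rpow_of_exponent_le hU1 huU)
    have h2 : Real.log y ≤ U ^ U * (Real.log y / u ^ u) := by
      rw [mul_div_assoc', le_div_iff₀ huu]; nlinarith
    rw [← hA, mul_assoc A]
    gcongr
    refine h2.trans ?_
    gcongr <;> linarith [Real.exp_pos (-Real.sqrt (Real.log y))]
  have hlogu : 120 ≤ Real.log u := (Real.le_log_iff_exp_le hu0).2 huU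
  rcases le_total (Real.log y) U with hyU | hyU
  · refine (tail_le_log hy).trans ?_
    have h2 : Real.log y ≤ U * Real.exp (Real.sqrt U) * Real.exp (-Real.sqrt (Real.log y)) := by
      rw [mul_assoc, ← Real.exp_add]
      have := Real.sqrt_le_sqrt hyU
      nlinarith [Real.one_le_exp (x := Real.sqrt U + -Real.sqrt (Real.log y)) (by linarith)]
    rw [← hA, mul_assoc A]
    gcongr
    refine h2.trans ?_
    gcongr
    · linarith
    · linarith [div_pos hL0 huu]
  obtain ⟨h1, h2⟩ := exp_log_tail_le hyU
  rcases le_total u (Real.log y) with huL | huL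
  · refine (tail_le_of_log_large hy hu0 le_rfl hlogu ?_).trans ?_
    · linarith [Real.log_le_log hu0 huL]
    · rw [hexp, mul_assoc, ← div_eq_mul_inv]
      refine le_trans ?_ (hC _ (by positivity))
      gcongr
      linarith [Real.exp_pos (-Real.sqrt (Real.log y))]
  · refine (tail_le_of_log_large hy hL0 huL ((Real.le_log_iff_exp_le hL0).2 hyU) h1).trans ?_
    rw [mul_assoc]
    refine le_trans ?_ (hC _ (by positivity))
    gcongr
    linarith [div_pos hL0 huu]
end
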